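/- Assume (H1) and (H2), and set ω(μ) = ∫_ℍ [μ - b(m)]₊⁰ dv(m) (the hyperbolic area of {b < μ}, finite by (H1)). Assume there exists C₁ > 0 such that for all μ > C₁ and all τ ∈ (0,1): ω((1+τ)μ) - ω(μ) ≤ C₁ τ ω(μ). Then N(λ; q_A) ∼ (1/2π) ∫_ℍ b(m) Σ_{k=0}^∞ [λ - 1/4 - (2k+1)b(m)]₊⁰ dv(m) as λ → +∞, i.e. the ratio of the two sides tends to 1, where [ρ]₊⁰ = 1 if ρ > 0 and 0 otherwise. -/

import Mathlib

open MeasureTheory Real Filter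

noncomputable section

/-- The upper half-plane ℍ as a subset of ℝ². -/
def UHP : Set (ℝ × ℝ) := {p : ℝ × ℝ | 0 < p.2}

/-- The hyperbolic measure `dv = y⁻² dx dy` on ℍ. -/
def volH : Measure (ℝ × ℝ) :=
  (volume.restrict UHP).withDensity fun p => ENNReal.ofReal ((p.2 ^ 2)⁻¹)

/-- x-derivative of a complex function on ℝ². -/
def dX (f : ℝ × ℝ → ℂ) (p : ℝ × ℝ) : ℂ := fderiv ℝ f p (1, 0)

/-- y-derivative of a complex function on ℝ². -/
def dY (f : ℝ × ℝ → ℂ) (p : ℝ × ℝ) : ℂ := fderiv ℝ f p (0, 1)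

/-- x-derivative of a real function on ℝ². -/
def dXr (f : ℝ × ℝ → ℝ) (p : ℝ × ℝ) : ℝ := fderiv ℝ f p (1, 0)

/-- y-derivative of a real function on ℝ². -/
def dYr (f : ℝ × ℝ → ℝ) (p : ℝ × ℝ) : ℝ := fderiv ℝ f p (0, 1)

/-- The magnetic field `b̃ = y² (∂ₓA₂ - ∂_yA₁)`. -/
def fieldB (A₁ A₂ : ℝ × ℝ → ℝ) (p : ℝ × ℝ) : ℝ := p.2 ^ 2 * (dXr A₂ p - dYr A₁ p)

/-- The magnetic intensity `b = |b̃|`. -/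
def intenB (A₁ A₂ : ℝ × ℝ → ℝ) (p : ℝ × ℝ) : ℝ := |fieldB A₁ A₂ p|

/-- Smooth compactly supported test functions with support inside a set `Ω`. -/
def IsTestOn (Ω : Set (ℝ × ℝ)) (f : ℝ × ℝ → ℂ) : Prop :=
  ContDiff ℝ (⊤ : ℕ∞) f ∧ HasCompactSupport f ∧ tsupport f ⊆ Ω

/-- The quadratic form of the magnetic Laplacian on ℍ. -/
def qA (A₁ A₂ : ℝ × ℝ → ℝ) (f : ℝ × ℝ → ℂ) : ℝ :=
  ∫ p, p.2 ^ 2 * (‖-Complex.I * dX f p - (A₁ p : ℂ) * f p‖ ^ 2 +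
    ‖-Complex.I * dY f p - (A₂ p : ℂ) * f p‖ ^ 2) ∂volH

/-- hyperbolic distance from `(x,y)` to `(0,1)`. -/
def hDist (p : ℝ × ℝ) : ℝ :=
  2 * Real.arsinh (Real.sqrt (p.1 ^ 2 + (p.2 - 1) ^ 2) / (2 * Real.sqrt p.2))

/-- (H1) : the magnetic intensity tends to +∞ at infinity. -/
def H1 (A₁ A₂ : ℝ × ℝ → ℝ) : Prop :=
  ∀ M : ℝ, ∃ R : ℝ, ∀ p ∈ UHP, R ≤ hDist p → M ≤ intenB A₁ A₂ p

/-- (H2) : control of the derivative of the magnetic field. -/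
def H2 (C₀ : ℝ) (A₁ A₂ : ℝ × ℝ → ℝ) : Prop :=
  ∀ p ∈ UHP, p.2 * Real.sqrt ((dXr (fieldB A₁ A₂) p) ^ 2 + (dYr (fieldB A₁ A₂) p) ^ 2)
    ≤ C₀ * (intenB A₁ A₂ p + 1)

/-- Counting function of a quadratic form `q` with form domain `dom` and squared
norm `nsq`, via Glazman's lemma. -/
def NN (q : (ℝ × ℝ → ℂ) → ℝ) (dom : Set (ℝ × ℝ → ℂ)) (nsq : (ℝ × ℝ → ℂ) → ℝ)
    (lam : ℝ) : ℕ :=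
  sSup {n : ℕ | ∃ V : Submodule ℂ (ℝ × ℝ → ℂ), (V : Set (ℝ × ℝ → ℂ)) ⊆ dom ∧
    Module.finrank ℂ V = n ∧ ∀ u ∈ V, u ≠ 0 → q u < lam * nsq u}

/-- Heaviside function `[ρ]₊⁰`. -/
def heav (ρ : ℝ) : ℝ := if 0 < ρ then 1 else 0


/-- The eigenvalue counting function of the magnetic Laplacian `-Δ_A` on `L²(ℍ,dv)`. -/
def NH (A₁ A₂ : ℝ × ℝ → ℝ) (lam : ℝ) : ℕ :=
  NN (qA A₁ A₂) {f | IsTestOn UHP f} (fun f => ∫ p, ‖f p‖ ^ 2 ∂volH) lam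

/-- `ω(μ)`, the hyperbolic area of `{b < μ}`. -/
def omegaFn (A₁ A₂ : ℝ × ℝ → ℝ) (μ : ℝ) : ℝ := ∫ p, heav (μ - intenB A₁ A₂ p) ∂volH

notation "R2" => ℝ × ℝ

section SP1
def RD (f : ℝ → ℂ) : Prop := Continuous f ∧ ∀ n : ℕ, ∃ C : ℝ, ∀ x : ℝ, |x| ^ n * ‖f x‖ ≤ C

lemma RD.add {f g : ℝ → ℂ} (hf : RD f) (hg : RD g) : RD (fun x => f x + g x) := by
  refine ⟨hf.1.add hg.1, fun n => ?_⟩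
  obtain ⟨C, hC⟩ := hf.2 n
  obtain ⟨D, hD⟩ := hg.2 n
  refine ⟨C + D, fun x => ?_⟩
  have := norm_add_le (f x) (g x)
  have h0 : 0 ≤ |x| ^ n := by positivity
  nlinarith [hC x, hD x, mul_le_mul_of_nonneg_left this h0]

lemma RD.const_mul {f : ℝ → ℂ} (hf : RD f) (c : ℂ) : RD (fun x => c * f x) := by
  refine ⟨hf.1.const_mul c |>.congr (fun _ => rfl), fun n => ?_⟩
  obtain ⟨C, hC⟩ := hf.2 n
  refine ⟨‖c‖ * C, fun x => ?_⟩
  rw [norm_mul]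
  calc |x| ^ n * (‖c‖ * ‖f x‖) = ‖c‖ * (|x| ^ n * ‖f x‖) := by ring
    _ ≤ _ := mul_le_mul_of_nonneg_left (hC x) (norm_nonneg _)

lemma RD.x_mul {f : ℝ → ℂ} (hf : RD f) : RD (fun x => (x : ℂ) * f x) := by
  refine ⟨Complex.continuous_ofReal.mul hf.1, fun n => ?_⟩
  obtain ⟨C, hC⟩ := hf.2 (n+1)
  refine ⟨C, fun x => ?_⟩
  rw [norm_mul, Complex.norm_real, Real.norm_eq_abs]
  calc _ = |x| ^ (n+1) * ‖f x‖ := by ring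
    _ ≤ _ := hC x

lemma RD.neg {f : ℝ → ℂ} (hf : RD f) : RD (fun x => - f x) := by
  have := hf.const_mul (-1)
  simpa using this

lemma RD.sub {f g : ℝ → ℂ} (hf : RD f) (hg : RD g) : RD (fun x => f x - g x) := by
  simpa [sub_eq_add_neg] using hf.add hg.neg

lemma RD.conj {f : ℝ → ℂ} (hf : RD f) : RD (fun x => starRingEnd ℂ (f x)) := by
  refine ⟨Complex.continuous_conj.comp hf.1, fun n => ?_⟩
  obtain ⟨C, hC⟩ := hf.2 n
  exact ⟨C, fun x => by simpa using hC x⟩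

lemma RD.mul {f g : ℝ → ℂ} (hf : RD f) (hg : RD g) : RD (fun x => f x * g x) := by
  refine ⟨hf.1.mul hg.1, fun n => ?_⟩
  obtain ⟨C, hC⟩ := hf.2 n
  obtain ⟨D, hD⟩ := hg.2 0
  refine ⟨C * D, fun x => ?_⟩
  rw [norm_mul, ← mul_assoc]
  have h1 := hD x
  simp only [pow_zero, one_mul] at h1
  have := norm_nonneg (g x)
  exact mul_le_mul (hC x) h1 this (le_trans (by positivity) (hC x))

lemma RD.integrable {f : ℝ → ℂ} (hf : RD f) : Integrable f := by
  obtain ⟨C, hC⟩ := hf.2 0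
  obtain ⟨D, hD⟩ := hf.2 2
  have := (integrable_inv_one_add_sq).const_mul (C + D)
  refine this.mono' hf.1.aestronglyMeasurable (Eventually.of_forall fun x => ?_)
  have h1 := hC x
  have h2 := hD x
  simp only [pow_zero, one_mul, sq_abs] at h1 h2
  rw [← div_eq_mul_inv, le_div_iff₀ (by positivity)]
  nlinarith

lemma RD.integrable_sq {f : ℝ → ℂ} (hf : RD f) : Integrable (fun x => ‖f x‖ ^ 2) := by
  have := (hf.conj.mul hf).integrable.norm
  refine this.congr (Eventually.of_forall fun x => ?_)
  simp [sq]

lemma RD_of_compact {f : ℝ → ℂ} (hf : Continuous f) (hs : HasCompactSupport f) : RD f := by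
  refine ⟨hf, fun n => ?_⟩
  have hc : Continuous (fun x : ℝ => |x| ^ n * ‖f x‖) := by fun_prop
  have hs' : HasCompactSupport (fun x : ℝ => |x| ^ n * ‖f x‖) := hs.norm.mul_left
  obtain ⟨C, hC⟩ := hs'.exists_bound_of_continuous hc
  exact ⟨C, fun x => (le_abs_self _).trans (hC x)⟩

def RD1 (f : ℝ → ℂ) : Prop := ContDiff ℝ 1 f ∧ RD f ∧ RD (deriv f)

lemma RD1.hasDerivAt {f : ℝ → ℂ} (hf : RD1 f) (x : ℝ) : HasDerivAt f (deriv f x) x :=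
  (hf.1.differentiable (by norm_num) x).hasDerivAt

def opa (w : ℝ) (f : ℝ → ℂ) (x : ℝ) : ℂ := deriv f x + (w : ℂ) * ((x : ℂ) * f x)
def opd (w : ℝ) (f : ℝ → ℂ) (x : ℝ) : ℂ := (w : ℂ) * ((x : ℂ) * f x) - deriv f x

lemma RD1.opa {f : ℝ → ℂ} (hf : RD1 f) (w : ℝ) : RD (opa w f) := hf.2.2.add (hf.2.1.x_mul.const_mul _)
lemma RD1.opd {f : ℝ → ℂ} (hf : RD1 f) (w : ℝ) : RD (opd w f) := (hf.2.1.x_mul.const_mul _).sub hf.2.2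

def ip (f g : ℝ → ℂ) : ℂ := ∫ x, starRingEnd ℂ (f x) * g x
def nq (f : ℝ → ℂ) : ℝ := ∫ x, ‖f x‖ ^ 2

lemma ip_self (f : ℝ → ℂ) : ip f f = (nq f : ℂ) := by
  unfold ip nq
  rw [← integral_complex_ofReal]
  congr 1; ext x
  rw [← Complex.normSq_eq_conj_mul_self, Complex.normSq_eq_norm_sq]

lemma nq_nonneg (f : ℝ → ℂ) : 0 ≤ nq f := integral_nonneg fun x => by positivity

lemma adj {f g : ℝ → ℂ} (hf : RD1 f) (hg : RD1 g) (w : ℝ) :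
    ip f (opa w g) = ip (opd w f) g := by
  unfold ip
  have hc : ∀ x, HasDerivAt (fun x => starRingEnd ℂ (f x)) (starRingEnd ℂ (deriv f x)) x := by
    intro x
    exact (hf.hasDerivAt x).star
  have h := MeasureTheory.integral_mul_deriv_eq_deriv_mul_of_integrable (fun x _ => hc x) (fun x _ => hg.hasDerivAt x)
    (hf.2.1.conj.mul hg.2.2).integrable (hf.2.2.conj.mul hg.2.1).integrable
    (hf.2.1.conj.mul hg.2.1).integrable
  have e1 : ∀ x : ℝ, starRingEnd ℂ (f x) * opa w g x
      = starRingEnd ℂ (f x) * deriv g x + (w : ℂ) * ((x : ℂ) * (starRingEnd ℂ (f x) * g x)) := by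
    intro x; simp only [opa]; ring
  have e2 : ∀ x : ℝ, starRingEnd ℂ (opd w f x) * g x
      = (w : ℂ) * ((x : ℂ) * (starRingEnd ℂ (f x) * g x)) - starRingEnd ℂ (deriv f x) * g x := by
    intro x; simp only [opd, map_sub, map_mul, Complex.conj_ofReal]; ring
  simp_rw [e1, e2]
  have i1 := ((hf.2.1.conj.mul hg.2.1).x_mul.const_mul (w : ℂ)).integrable
  rw [integral_add (hf.2.1.conj.mul hg.2.2).integrable i1,
    integral_sub i1 (hf.2.2.conj.mul hg.2.1).integrable, h]
  ring

lemma ip_conj (f g : ℝ → ℂ) : starRingEnd ℂ (ip f g) = ip g f := by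
  unfold ip
  rw [← integral_conj]
  congr 1; ext x; simp [mul_comm]

lemma cross {g : ℝ → ℂ} (hg : RD1 g) :
    ∫ x : ℝ, 2 * x * (starRingEnd ℂ (g x) * deriv g x).re = - nq g := by
  have hd : ∀ x : ℝ, HasDerivAt (fun x : ℝ => (x : ℝ) * ‖g x‖ ^ 2)
      (‖g x‖ ^ 2 + 2 * x * (starRingEnd ℂ (g x) * deriv g x).re) x := by
    intro x
    have h1 := (hg.hasDerivAt x).norm_sq
    have h2 := (hasDerivAt_id x).mul h1
    refine h2.congr_deriv ?_
    simp only [id, one_mul, Complex.inner]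
    ring
  have i1 := hg.2.1.integrable_sq
  have i2 : Integrable (fun x : ℝ => 2 * x * (starRingEnd ℂ (g x) * deriv g x).re) := by
    have := ((hg.2.1.conj.mul hg.2.2).x_mul.const_mul 2).integrable.re
    refine this.congr (Eventually.of_forall fun x => ?_)
    simp [mul_assoc]
  have i3 : Integrable (fun x : ℝ => x * ‖g x‖ ^ 2) := by
    have := ((hg.2.1.conj.mul hg.2.1).x_mul).integrable.re
    refine this.congr (Eventually.of_forall fun x => ?_)
    simp only [← Complex.normSq_eq_conj_mul_self, Complex.normSq_eq_norm_sq]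
    rw [← Complex.ofReal_mul]; exact Complex.ofReal_re _
  have := integral_eq_zero_of_hasDerivAt_of_integrable hd (i1.add i2) i3
  rw [integral_add i1 i2] at this
  unfold nq
  linarith

lemma opa_sq {g : ℝ → ℂ} (hg : RD1 g) (w : ℝ) :
    nq (opa w g) = (∫ x, (‖deriv g x‖ ^ 2 + w ^ 2 * x ^ 2 * ‖g x‖ ^ 2)) - w * nq g := by
  have e : ∀ x : ℝ, ‖opa w g x‖ ^ 2 = (‖deriv g x‖ ^ 2 + w ^ 2 * x ^ 2 * ‖g x‖ ^ 2)
      + w * (2 * x * (starRingEnd ℂ (g x) * deriv g x).re) := by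
    intro x
    simp only [opa, ← Complex.normSq_eq_norm_sq, Complex.normSq_apply, Complex.add_re, Complex.mul_re,
      Complex.add_im, Complex.mul_im, Complex.ofReal_re, Complex.ofReal_im, Complex.conj_re, Complex.conj_im]
    ring
  have i2 : Integrable (fun x : ℝ => 2 * x * (starRingEnd ℂ (g x) * deriv g x).re) := by
    have := ((hg.2.1.conj.mul hg.2.2).x_mul.const_mul 2).integrable.re
    refine this.congr (Eventually.of_forall fun x => ?_)
    simp [mul_assoc]
  have i1 : Integrable (fun x : ℝ => ‖deriv g x‖ ^ 2 + w ^ 2 * x ^ 2 * ‖g x‖ ^ 2) := by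
    refine hg.2.2.integrable_sq.add ?_
    refine (hg.2.1.x_mul.integrable_sq.const_mul (w^2)).congr (Eventually.of_forall fun x => ?_)
    simp [mul_pow]; ring
  conv_lhs => unfold nq
  simp_rw [e]
  rw [integral_add i1 (i2.const_mul w), integral_const_mul, cross hg]
  ring

lemma opd_sq {g : ℝ → ℂ} (hg : RD1 g) (w : ℝ) :
    nq (opd w g) = nq (opa w g) + 2 * w * nq g := by
  have e : ∀ x : ℝ, ‖opd w g x‖ ^ 2 = ‖opa w g x‖ ^ 2
      - 2 * w * (2 * x * (starRingEnd ℂ (g x) * deriv g x).re) := by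
    intro x
    simp only [opa, opd, ← Complex.normSq_eq_norm_sq, Complex.normSq_apply, Complex.add_re, Complex.mul_re,
      Complex.add_im, Complex.mul_im, Complex.ofReal_re, Complex.ofReal_im, Complex.conj_re, Complex.conj_im,
      Complex.sub_re, Complex.sub_im]
    ring
  have i2 : Integrable (fun x : ℝ => 2 * x * (starRingEnd ℂ (g x) * deriv g x).re) := by
    have := ((hg.2.1.conj.mul hg.2.2).x_mul.const_mul 2).integrable.re
    refine this.congr (Eventually.of_forall fun x => ?_)
    simp [mul_assoc]
  conv_lhs => unfold nq
  simp_rw [e]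
  rw [integral_sub (hg.opa w).integrable_sq (i2.const_mul _), integral_const_mul, cross hg]
  unfold nq; ring

lemma cs_ip {f g : ℝ → ℂ} (hf : RD f) (hg : RD g) : ‖ip f g‖ ^ 2 ≤ nq f * nq g := by
  have key : ∀ t : ℝ, 0 ≤ nq f * (t * t) + (2 * ‖ip f g‖) * t + nq g := by
    intro t
    obtain ⟨c, hc1, hc2⟩ : ∃ c : ℂ, ‖c‖ = 1 ∧ c * ip f g = ‖ip f g‖ := by
      by_cases h : ip f g = 0
      · exact ⟨1, by simp, by simp [h]⟩
      · refine ⟨starRingEnd ℂ (ip f g) / ‖ip f g‖, ?_, ?_⟩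
        · have : ‖ip f g‖ ≠ 0 := by simpa using h
          simp [this]
        · have : (‖ip f g‖ : ℂ) ≠ 0 := by simpa using h
          field_simp
          rw [mul_comm, Complex.mul_conj, Complex.normSq_eq_norm_sq]; push_cast; ring
    have e : ∀ x : ℝ, ‖(t : ℂ) * f x + c * g x‖ ^ 2 = t ^ 2 * ‖f x‖ ^ 2 + ‖g x‖ ^ 2
        + 2 * t * (c * (starRingEnd ℂ (f x) * g x)).re := by
      intro x
      have hcc : ‖g x‖ ^ 2 = ‖c * g x‖ ^ 2 := by rw [norm_mul, hc1, one_mul]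
      rw [hcc]
      simp only [← Complex.normSq_eq_norm_sq, Complex.normSq_apply, Complex.add_re, Complex.mul_re,
        Complex.add_im, Complex.mul_im, Complex.ofReal_re, Complex.ofReal_im, Complex.conj_re, Complex.conj_im]
      ring
    have h0 : 0 ≤ ∫ x, ‖(t : ℂ) * f x + c * g x‖ ^ 2 := integral_nonneg fun x => by positivity
    have i3 := ((hf.conj.mul hg).const_mul c).integrable
    have i4 : Integrable (fun x => (c * (starRingEnd ℂ (f x) * g x)).re) := i3.re
    simp_rw [e] at h0
    have i5 : Integrable (fun x => t ^ 2 * ‖f x‖ ^ 2 + ‖g x‖ ^ 2) :=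
      (hf.integrable_sq.const_mul _).add hg.integrable_sq
    rw [integral_add i5 (i4.const_mul _),
      integral_add (hf.integrable_sq.const_mul _) hg.integrable_sq, integral_const_mul, integral_const_mul] at h0
    have h5 : ∫ x, (c * (starRingEnd ℂ (f x) * g x)).re = ‖ip f g‖ := by
      have h6 : ∫ x, (c * (starRingEnd ℂ (f x) * g x)).re = (∫ x, c * (starRingEnd ℂ (f x) * g x)).re := integral_re i3
      rw [h6, integral_const_mul]
      change (c * ip f g).re = _
      rw [hc2]; simp
    rw [h5] at h0
    unfold nq
    nlinarith [h0]
  have := discrim_le_zero key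
  unfold discrim at this
  nlinarith
end SP1

section SP1b
lemma RD.pow_norm_integrable {f : ℝ → ℂ} (hf : RD f) (n : ℕ) : Integrable (fun x : ℝ => |x| ^ n * ‖f x‖) := by
  induction n generalizing f with
  | zero => simpa using hf.integrable.norm
  | succ n ih =>
    refine (ih hf.x_mul).congr (Eventually.of_forall fun x => ?_)
    simp [pow_succ]; ring

def gs (w x : ℝ) : ℝ := Real.exp (-(w * x ^ 2 / 2))

lemma gs_deriv (w x : ℝ) : HasDerivAt (gs w) (-(w * x) * gs w x) x := by
  unfold gs
  have := ((((hasDerivAt_id x).pow 2).const_mul w).div_const 2).neg.exp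
  refine this.congr_deriv ?_
  simp; ring

lemma gs_cont (w : ℝ) : Continuous (gs w) := by unfold gs; fun_prop

lemma gs_le_one {w : ℝ} (hw : 0 < w) (x : ℝ) : gs w x ≤ 1 := by
  unfold gs; rw [Real.exp_le_one_iff]; have : 0 ≤ w * x ^ 2 / 2 := by positivity
  linarith

lemma gs_pos (w x : ℝ) : 0 < gs w x := Real.exp_pos _

lemma RD.gs_mul {f : ℝ → ℂ} (hf : RD f) {w : ℝ} (hw : 0 < w) : RD (fun x => (gs w x : ℂ) * f x) := by
  refine ⟨(Complex.continuous_ofReal.comp (gs_cont w)).mul hf.1, fun n => ?_⟩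
  obtain ⟨C, hC⟩ := hf.2 n
  refine ⟨C, fun x => le_trans ?_ (hC x)⟩
  rw [norm_mul, Complex.norm_real, Real.norm_eq_abs, abs_of_pos (gs_pos w x)]
  have := gs_le_one hw x
  refine mul_le_mul_of_nonneg_left ?_ (by positivity)
  nlinarith [norm_nonneg (f x)]

lemma ode_solve {f : ℝ → ℂ} (hf : RD f) {w : ℝ} (hw : 0 < w) (h0 : ∫ x, (gs w x : ℂ) * f x = 0) :
    ∃ g, RD1 g ∧ opd w g = f := by
  have hF := hf.gs_mul hw
  set F : ℝ → ℂ := fun x => (gs w x : ℂ) * f x with hFd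
  have hFi := hF.integrable
  set G : ℝ → ℂ := fun x => ∫ s in Set.Iic x, F s with hG
  have hGd : ∀ x, HasDerivAt G (F x) x := by
    intro x
    have e : G = fun x => (∫ s in Set.Iic 0, F s) + ∫ s in (0:ℝ)..x, F s := by
      ext x
      rw [← intervalIntegral.integral_Iic_sub_Iic hFi.integrableOn hFi.integrableOn]; simp [hG]
    rw [e]
    exact (intervalIntegral.integral_hasDerivAt_right (hF.1.intervalIntegrable _ _)
      hF.1.stronglyMeasurable.stronglyMeasurableAtFilter hF.1.continuousAt).const_add _
  set g : ℝ → ℂ := fun x => - (((gs w x)⁻¹ : ℝ) : ℂ) * G x with hg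
  have hgd : ∀ x : ℝ, HasDerivAt g ((w : ℂ) * ((x : ℂ) * g x) - f x) x := by
    intro x
    have h1 := ((gs_deriv w x).inv (gs_pos w x).ne').ofReal_comp.neg.mul (hGd x)
    refine h1.congr_deriv ?_
    have : (gs w x : ℂ) ≠ 0 := by exact_mod_cast (gs_pos w x).ne'
    simp only [hg, hFd]
    push_cast
    field_simp
    simp
    field_simp
    ring
  have hgc : Continuous g := continuous_iff_continuousAt.2 fun x => (hgd x).continuousAt
  have hbound : ∀ n : ℕ, ∀ x : ℝ, |x| ^ n * ‖g x‖ ≤ ∫ s : ℝ, |s| ^ n * ‖f s‖ := by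
    intro n x
    have main : ∀ S : Set ℝ, MeasurableSet S → (∀ s ∈ S, |x| ≤ |s|) →
        |x| ^ n * ((gs w x)⁻¹ * ‖∫ s in S, F s‖) ≤ ∫ s : ℝ, |s| ^ n * ‖f s‖ := by
      intro S hS hxs
      have i1 := hf.pow_norm_integrable n
      calc |x| ^ n * ((gs w x)⁻¹ * ‖∫ s in S, F s‖) 
          ≤ |x| ^ n * ((gs w x)⁻¹ * ∫ s in S, ‖F s‖) := by
            have := (gs_pos w x)
            gcongr; exact norm_integral_le_integral_norm _
        _ = ∫ s in S, |x| ^ n * ((gs w x)⁻¹ * ‖F s‖) := by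
            rw [integral_const_mul, integral_const_mul]
        _ ≤ ∫ s in S, |s| ^ n * ‖f s‖ := by
            refine setIntegral_mono_on ((hFi.norm.const_mul _).const_mul _).integrableOn i1.integrableOn hS ?_
            intro s hs
            have hh := hxs s hs
            have hp := gs_pos w x
            have e1 : gs w s ≤ gs w x := by
              unfold gs
              rw [Real.exp_le_exp]
              have : x ^ 2 ≤ s ^ 2 := sq_le_sq.2 hh
              nlinarith
            have e2 : (gs w x)⁻¹ * ‖F s‖ ≤ ‖f s‖ := by
              rw [inv_mul_le_iff₀ hp]
              simp only [hFd, norm_mul, Complex.norm_real, Real.norm_eq_abs, abs_of_pos (gs_pos w s)]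
              gcongr
            gcongr
        _ ≤ _ := setIntegral_le_integral i1 (Eventually.of_forall fun s => by positivity)
    have e3 : ‖g x‖ = (gs w x)⁻¹ * ‖G x‖ := by
      simp only [hg, norm_mul, norm_neg, Complex.norm_real, Real.norm_eq_abs, abs_of_pos (inv_pos.2 (gs_pos w x))]
    rcases le_total x 0 with hx | hx
    · rw [e3]
      refine main _ measurableSet_Iic ?_
      intro s hs
      rw [abs_of_nonpos hx, abs_of_nonpos (le_trans hs hx)]
      simpa using hs
    · have e4 : ‖G x‖ = ‖∫ s in Set.Ioi x, F s‖ := by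
        have := intervalIntegral.integral_Iic_add_Ioi (b := x) hFi.integrableOn hFi.integrableOn
        rw [h0] at this
        simp only [hG]
        rw [eq_neg_of_add_eq_zero_left this, norm_neg]
      rw [e3, e4]
      refine main _ measurableSet_Ioi ?_
      intro s hs
      have : x < s := hs
      rw [abs_of_nonneg hx, abs_of_nonneg (by linarith)]
      exact this.le
  have hgR : RD g := ⟨hgc, fun n => ⟨_, hbound n⟩⟩
  have hd : deriv g = fun x : ℝ => (w : ℂ) * ((x : ℂ) * g x) - f x := by
    ext x; exact (hgd x).deriv
  have hdR : RD (deriv g) := by rw [hd]; exact (hgR.x_mul.const_mul _).sub hf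
  refine ⟨g, ⟨?_, hgR, hdR⟩, ?_⟩
  · rw [contDiff_one_iff_deriv]
    exact ⟨fun x => (hgd x).differentiableAt, hdR.1⟩
  · ext x; simp only [opd, hd]; ring

open Polynomial in
def HP (w : ℝ) : ℕ → ℝ[X]
  | 0 => C ((w / π) ^ (1/4 : ℝ))
  | (k+1) => C (√(2 * w * (k + 1)))⁻¹ * (C (2 * w) * X * HP w k - derivative (HP w k))

def hr (w : ℝ) (k : ℕ) (x : ℝ) : ℝ := (HP w k).eval x * gs w x
def hf (w : ℝ) (k : ℕ) (x : ℝ) : ℂ := (hr w k x : ℂ)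

open Polynomial in
lemma HP_deriv {w : ℝ} (hw : 0 < w) (k : ℕ) : derivative (HP w (k+1)) = C (√(2 * w * (k + 1))) * HP w k := by
  induction k with
  | zero =>
    have h : √(2 * w) ≠ 0 := by positivity
    have h2 : (√(2*w))⁻¹ * (2 * w) = √(2 * w) := by
      rw [inv_mul_eq_iff_eq_mul₀ h, Real.mul_self_sqrt (by positivity)]
    simp only [HP, derivative_C, sub_zero, derivative_mul, zero_mul, zero_add, derivative_X, mul_one, mul_zero, add_zero, Nat.cast_zero]
    rw [← mul_assoc, ← C_mul, h2]
  | succ k ih =>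
    have e : HP w (k+1+1) = C (√(2 * w * ((k+1:ℕ) + 1)))⁻¹ * (C (2 * w) * X * HP w (k+1) - derivative (HP w (k+1))) := rfl
    have e' : HP w (k+1) = C (√(2 * w * (k + 1)))⁻¹ * (C (2 * w) * X * HP w k - derivative (HP w k)) := rfl
    have hs : √(2 * w * (k + 1)) ≠ 0 := by positivity
    have hs2 : √(2 * w * ((k+1:ℕ) + 1)) ≠ 0 := by positivity
    have e2 : C (2 * w) * X * HP w k - derivative (HP w k) = C (√(2 * w * (k + 1))) * HP w (k+1) := by
      rw [e', ← mul_assoc, ← C_mul, mul_inv_cancel₀ hs]; simp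
    rw [e]
    simp only [derivative_mul, derivative_sub, derivative_C, zero_mul, zero_add, derivative_X, mul_one, ih]
    have e3 : C (2*w) * HP w (k+1) + C (2*w) * X * (C (√(2 * w * (k + 1))) * HP w k) - C (√(2 * w * (k + 1))) * derivative (HP w k)
       = C (2 * w * ((k+1:ℕ) + 1)) * HP w (k+1) := by
      have : C (2*w) * HP w (k+1) + C (2*w) * X * (C (√(2 * w * (k + 1))) * HP w k) - C (√(2 * w * (k + 1))) * derivative (HP w k)
        = C (2*w) * HP w (k+1) + C (√(2 * w * (k + 1))) * (C (2 * w) * X * HP w k - derivative (HP w k)) := by ring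
      rw [this, e2, ← mul_assoc, ← C_mul, Real.mul_self_sqrt (by positivity), ← add_mul, ← C_add]
      congr 2; push_cast; ring
    rw [e3, ← mul_assoc, ← C_mul]
    congr 2
    rw [inv_mul_eq_iff_eq_mul₀ hs2, Real.mul_self_sqrt (by positivity)]

lemma hr_deriv (w : ℝ) (k : ℕ) (x : ℝ) :
    HasDerivAt (hr w k) ((HP w k).derivative.eval x * gs w x - w * x * hr w k x) x := by
  unfold hr
  have := ((HP w k).hasDerivAt x).mul (gs_deriv w x)
  refine this.congr_deriv ?_
  ring

lemma hr_ann {w : ℝ} (hw : 0 < w) (k : ℕ) (x : ℝ) :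
    HasDerivAt (hr w (k+1)) (√(2 * w * (k + 1)) * hr w k x - w * x * hr w (k+1) x) x := by
  refine (hr_deriv w (k+1) x).congr_deriv ?_
  rw [HP_deriv hw]; simp [hr]; ring

lemma hr_ann0 (w : ℝ) (x : ℝ) : HasDerivAt (hr w 0) (- (w * x * hr w 0 x)) x := by
  refine (hr_deriv w 0 x).congr_deriv ?_
  simp [HP]

lemma hr_cre {w : ℝ} (hw : 0 < w) (k : ℕ) (x : ℝ) :
    HasDerivAt (hr w k) (w * x * hr w k x - √(2 * w * (k + 1)) * hr w (k+1) x) x := by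
  refine (hr_deriv w k x).congr_deriv ?_
  have hs : √(2 * w * (k + 1)) ≠ 0 := by positivity
  simp only [hr, HP]
  simp
  field_simp
  ring

lemma hr_deriv2 {w : ℝ} (hw : 0 < w) (k : ℕ) (x : ℝ) :
    HasDerivAt (deriv (hr w k)) ((w ^ 2 * x ^ 2 - (2 * k + 1) * w) * hr w k x) x := by
  have e : deriv (hr w k) = fun x => w * x * hr w k x - √(2 * w * (k + 1)) * hr w (k+1) x := by
    ext x; exact (hr_cre hw k x).deriv
  rw [e]
  have h1 := (((hasDerivAt_id x).const_mul w).mul (hr_cre hw k x)).sub ((hr_ann hw k x).const_mul (√(2 * w * (k + 1))))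
  refine h1.congr_deriv ?_
  have : √(2 * w * (k + 1)) * √(2 * w * (k + 1)) = 2 * w * (k+1) := Real.mul_self_sqrt (by positivity)
  simp only [id, mul_one]
  linear_combination (- hr w k x) * this

open Polynomial in
lemma RD_poly {w : ℝ} (hw : 0 < w) (P : ℝ[X]) : RD (fun x => ((P.eval x * gs w x : ℝ) : ℂ)) := by
  have hG : RD (fun x => ((gs w x : ℝ) : ℂ)) := by
    refine ⟨Complex.continuous_ofReal.comp (gs_cont w), fun n => ?_⟩
    refine ⟨(n.factorial : ℝ) * (2 / w) ^ n + 1, fun x => ?_⟩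
    rw [Complex.norm_real, Real.norm_eq_abs, abs_of_pos (gs_pos w x)]
    rcases le_total |x| 1 with h | h
    · have : |x| ^ n ≤ 1 := pow_le_one₀ (abs_nonneg x) h
      have h2 := gs_le_one hw x
      have := gs_pos w x
      have : 0 ≤ (n.factorial : ℝ) * (2 / w) ^ n := by positivity
      nlinarith
    · have h1 : (w * x ^ 2 / 2) ^ n / n.factorial ≤ Real.exp (w * x ^ 2 / 2) :=
        Real.pow_div_factorial_le_exp _ (by positivity) n
      have h2 : gs w x = (Real.exp (w * x ^ 2 / 2))⁻¹ := by unfold gs; rw [Real.exp_neg]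
      rw [h2, ← div_eq_mul_inv, div_le_iff₀ (Real.exp_pos _)]
      have h3 : |x| ^ n ≤ (x^2) ^ n := by
        rw [← sq_abs]; gcongr; nlinarith
      have h4 : (x^2)^n = (n.factorial : ℝ) * (2 / w) ^ n * ((w * x ^ 2 / 2) ^ n / n.factorial) := by
        have : (n.factorial : ℝ) ≠ 0 := by positivity
        rw [div_pow, div_pow, mul_pow]
        field_simp
      have h5 : (n.factorial : ℝ) * (2 / w) ^ n * ((w * x ^ 2 / 2) ^ n / n.factorial) ≤ (n.factorial : ℝ) * (2 / w) ^ n * Real.exp (w * x ^ 2 / 2) := by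
        gcongr
      have := Real.exp_pos (w * x ^ 2 / 2)
      nlinarith
  induction P using Polynomial.induction_on' with
  | add p q hp hq =>
    have := hp.add hq
    simp only [eval_add, add_mul]
    push_cast at this ⊢
    exact this
  | monomial n a =>
    induction n with
    | zero => simpa using hG.const_mul (a : ℂ)
    | succ n ih =>
      have := ih.x_mul
      convert this using 2 with x
      simp; ring

lemma hf_RD {w : ℝ} (hw : 0 < w) (k : ℕ) : RD (hf w k) := RD_poly hw _

lemma hf_hasDeriv {w : ℝ} (k : ℕ) {x d : ℝ} (h : HasDerivAt (hr w k) d x) : HasDerivAt (hf w k) (d : ℂ) x :=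
  h.ofReal_comp

lemma hf_RD1 {w : ℝ} (hw : 0 < w) (k : ℕ) : RD1 (hf w k) := by
  have hd : deriv (hf w k) = fun x : ℝ => (w : ℂ) * ((x : ℂ) * hf w k x) - (√(2 * w * (k + 1)) : ℂ) * hf w (k+1) x := by
    ext x; rw [(hf_hasDeriv k (hr_cre hw k x)).deriv]; simp [hf]; ring
  have hR : RD (deriv (hf w k)) := by
    rw [hd]; exact ((hf_RD hw k).x_mul.const_mul _).sub ((hf_RD hw (k+1)).const_mul _)
  refine ⟨?_, hf_RD hw k, hR⟩
  rw [contDiff_one_iff_deriv]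
  exact ⟨fun x => (hf_hasDeriv k (hr_cre hw k x)).differentiableAt, hR.1⟩

lemma opd_hf {w : ℝ} (hw : 0 < w) (k : ℕ) : opd w (hf w k) = fun x => (√(2 * w * (k + 1)) : ℂ) * hf w (k+1) x := by
  ext x; unfold opd; rw [(hf_hasDeriv k (hr_cre hw k x)).deriv]; simp [hf]; ring

lemma opa_hf {w : ℝ} (hw : 0 < w) (k : ℕ) : opa w (hf w (k+1)) = fun x => (√(2 * w * (k + 1)) : ℂ) * hf w k x := by
  ext x; unfold opa; rw [(hf_hasDeriv (k+1) (hr_ann hw k x)).deriv]; simp [hf]; ring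

lemma opa_hf0 {w : ℝ} : opa w (hf w 0) = fun _ => 0 := by
  ext x; unfold opa; rw [(hf_hasDeriv 0 (hr_ann0 w x)).deriv]; simp [hf]; ring

lemma ip_const_right (c : ℂ) (f g : ℝ → ℂ) : ip f (fun x => c * g x) = c * ip f g := by
  unfold ip; rw [← integral_const_mul]; congr 1; ext x; ring
lemma ip_const_left (c : ℂ) (f g : ℝ → ℂ) : ip (fun x => c * f x) g = starRingEnd ℂ c * ip f g := by
  unfold ip; rw [← integral_const_mul]; congr 1; ext x; simp; ring

lemma hf_norm {w : ℝ} (hw : 0 < w) (k : ℕ) : nq (hf w k) = 1 := by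
  induction k with
  | zero =>
    unfold nq
    have e : ∀ x : ℝ, ‖hf w 0 x‖ ^ 2 = (w / π) ^ (1/2 : ℝ) * Real.exp (- w * x ^ 2) := by
      intro x
      simp only [hf, hr, Complex.norm_real, Real.norm_eq_abs, sq_abs, HP, Polynomial.eval_C, gs, mul_pow]
      rw [← Real.rpow_natCast, ← Real.rpow_mul (by positivity), ← Real.exp_nat_mul]
      congr 2
      · norm_num
      · push_cast; ring
    simp_rw [e]
    rw [integral_const_mul, integral_gaussian, Real.sqrt_eq_rpow, ← Real.mul_rpow (by positivity) (by positivity)]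
    have : w / π * (π / w) = 1 := by field_simp
    rw [this]; simp
  | succ k ih =>
    have h1 : ip (hf w k) (opa w (hf w (k+1))) = ip (opd w (hf w k)) (hf w (k+1)) := adj (hf_RD1 hw k) (hf_RD1 hw (k+1)) w
    rw [opa_hf hw, opd_hf hw, ip_const_right, ip_const_left, ip_self, ip_self, ih, Complex.conj_ofReal] at h1
    have hs : (√(2 * w * (k + 1)) : ℂ) ≠ 0 := by
      have : √(2 * w * (k + 1)) ≠ 0 := by positivity
      exact_mod_cast this
    have := mul_left_cancel₀ hs h1
    exact_mod_cast this.symm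

lemma gap {w : ℝ} (hw : 0 < w) (K : ℕ) : ∀ f : ℝ → ℂ, RD1 f → (∀ k < K, ip (hf w k) f = 0) →
    2 * K * w * nq f ≤ nq (opa w f) := by
  induction K with
  | zero => intro f _ _; simpa using nq_nonneg _
  | succ K ih =>
    intro f hf1 h
    have h0 : ∫ x, (gs w x : ℂ) * f x = 0 := by
      have := h 0 (by omega)
      have hc : ((w / π) ^ (1/4 : ℝ) : ℝ) ≠ 0 := by positivity
      have e : ip (hf w 0) f = (((w / π) ^ (1/4 : ℝ) : ℝ) : ℂ) * ∫ x, (gs w x : ℂ) * f x := by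
        unfold ip; rw [← integral_const_mul]; congr 1; ext x
        simp only [hf, hr, Complex.conj_ofReal, HP, Polynomial.eval_C]; push_cast; ring
      rw [e] at this
      rcases mul_eq_zero.1 this with h | h
      · exact absurd (by exact_mod_cast h) hc
      · exact h
    obtain ⟨g, hg, hgf⟩ := ode_solve hf1.2.1 hw h0
    have hgo : ∀ k < K, ip (hf w k) g = 0 := by
      intro k hk
      have h1 := adj hg (hf_RD1 hw (k+1)) w
      rw [hgf, opa_hf hw, ip_const_right, ← ip_conj (hf w (k+1)) f, h (k+1) (by omega), map_zero] at h1
      have hs : (√(2 * w * (k + 1)) : ℂ) ≠ 0 := by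
        have : √(2 * w * (k + 1)) ≠ 0 := by positivity
        exact_mod_cast this
      have := (mul_eq_zero.1 h1).resolve_left hs
      rw [← ip_conj, this, map_zero]
    have h2 := ih g hg hgo
    have h3 := opd_sq hg w
    rw [hgf] at h3
    have h4 : ip g (opa w f) = (nq f : ℂ) := by rw [adj hg hf1 w, hgf, ip_self]
    have h5 := cs_ip hg.2.1 (hf1.opa w)
    rw [h4, Complex.norm_real, Real.norm_eq_abs, sq_abs] at h5
    have h6 := nq_nonneg f
    have h7 := nq_nonneg (opa w f)
    push_cast
    rcases h6.eq_or_lt with h8 | h8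
    · rw [← h8]; simpa using h7
    · have h9 : 2 * (K + 1) * w * nq g ≤ nq f := by linarith
      have h10 : 2 * (K + 1) * w * nq f * nq f ≤ nq (opa w f) * nq f := by
        calc 2 * (K + 1) * w * nq f * nq f = 2 * (K+1) * w * (nq f) ^ 2 := by ring
          _ ≤ 2 * (K+1) * w * (nq g * nq (opa w f)) := by gcongr
          _ = (2 * (K + 1) * w * nq g) * nq (opa w f) := by ring
          _ ≤ nq f * nq (opa w f) := by gcongr
          _ = _ := by ring
      exact le_of_mul_le_mul_right h10 h8
end SP1b

section SP1c
lemma nq_sub {r h : ℝ → ℂ} (hr : RD r) (hh : RD h) (c : ℂ) :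
    nq (fun x => r x - c * h x) = nq r - 2 * (starRingEnd ℂ c * ip h r).re + ‖c‖ ^ 2 * nq h := by
  have e : ∀ x : ℝ, ‖r x - c * h x‖ ^ 2 = (‖r x‖ ^ 2 + ‖c‖ ^ 2 * ‖h x‖ ^ 2)
      - 2 * (starRingEnd ℂ c * (starRingEnd ℂ (h x) * r x)).re := by
    intro x
    rw [← mul_pow, ← norm_mul]
    simp only [← Complex.normSq_eq_norm_sq, Complex.normSq_apply, Complex.sub_re, Complex.mul_re,
      Complex.sub_im, Complex.mul_im, Complex.conj_re, Complex.conj_im]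
    ring
  have i3 := ((hh.conj.mul hr).const_mul (starRingEnd ℂ c)).integrable
  have i4 : Integrable (fun x => (starRingEnd ℂ c * (starRingEnd ℂ (h x) * r x)).re) := i3.re
  have i5 : Integrable (fun x => ‖r x‖ ^ 2 + ‖c‖ ^ 2 * ‖h x‖ ^ 2) :=
    hr.integrable_sq.add (hh.integrable_sq.const_mul _)
  have h6 : ∫ x, (starRingEnd ℂ c * (starRingEnd ℂ (h x) * r x)).re = (starRingEnd ℂ c * ip h r).re := by
    have h6 : ∫ x, (starRingEnd ℂ c * (starRingEnd ℂ (h x) * r x)).re = (∫ x, starRingEnd ℂ c * (starRingEnd ℂ (h x) * r x)).re := integral_re i3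
    rw [h6, integral_const_mul]; rfl
  unfold nq
  simp_rw [e]
  rw [integral_sub i5 (i4.const_mul _), integral_add hr.integrable_sq (hh.integrable_sq.const_mul _),
    integral_const_mul, integral_const_mul, h6]
  ring

lemma ip_sub {f r h : ℝ → ℂ} (hf : RD f) (hr : RD r) (hh : RD h) (c : ℂ) :
    ip f (fun x => r x - c * h x) = ip f r - c * ip f h := by
  unfold ip
  have e : ∀ x, starRingEnd ℂ (f x) * (r x - c * h x) = starRingEnd ℂ (f x) * r x - c * (starRingEnd ℂ (f x) * h x) := by
    intro x; ring
  simp_rw [e]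
  rw [integral_sub (hf.conj.mul hr).integrable ((hf.conj.mul hh).const_mul c).integrable, integral_const_mul]

lemma sqc (w : ℝ) (k : ℕ) (hw : 0 < w) : (√(2 * w * (k + 1)) : ℂ) ≠ 0 := by
  have : √(2 * w * (k + 1)) ≠ 0 := by positivity
  exact_mod_cast this

lemma hf_orth {w : ℝ} (hw : 0 < w) (j : ℕ) : ∀ k, j < k → ip (hf w j) (hf w k) = 0 := by
  induction j with
  | zero =>
    intro k hk
    obtain ⟨k, rfl⟩ : ∃ m, k = m + 1 := ⟨k - 1, by omega⟩
    have h1 := adj (hf_RD1 hw k) (hf_RD1 hw 0) w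
    rw [opa_hf0, opd_hf hw, ip_const_left] at h1
    have : ip (hf w k) (fun _ => 0) = 0 := by simp [ip]
    rw [this, Complex.conj_ofReal] at h1
    have := (mul_eq_zero.1 h1.symm).resolve_left (sqc w k hw)
    rw [← ip_conj, this, map_zero]
  | succ j ih =>
    intro k hk
    obtain ⟨k, rfl⟩ : ∃ m, k = m + 1 := ⟨k - 1, by omega⟩
    have h1 := adj (hf_RD1 hw j) (hf_RD1 hw (k+1)) w
    rw [opa_hf hw, opd_hf hw, ip_const_left, ip_const_right, ih k (by omega), mul_zero, Complex.conj_ofReal] at h1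
    exact (mul_eq_zero.1 h1.symm).resolve_left (sqc w j hw)

def rem (w : ℝ) (f : ℝ → ℂ) : ℕ → ℝ → ℂ
  | 0 => f
  | (K+1) => fun x => rem w f K x - ip (hf w K) f * hf w K x

lemma rem_RD {w : ℝ} (hw : 0 < w) {f : ℝ → ℂ} (h : RD f) (K : ℕ) : RD (rem w f K) := by
  induction K with
  | zero => exact h
  | succ K ih => exact ih.sub ((hf_RD hw K).const_mul _)

lemma rem_ip {w : ℝ} (hw : 0 < w) {f : ℝ → ℂ} (h : RD f) (K j : ℕ) :
    ip (hf w j) (rem w f K) = if j < K then 0 else ip (hf w j) f := by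
  induction K with
  | zero => simp [rem]
  | succ K ih =>
    have e : ip (hf w j) (rem w f (K+1)) = ip (hf w j) (rem w f K) - ip (hf w K) f * ip (hf w j) (hf w K) :=
      ip_sub (hf_RD hw j) (rem_RD hw h K) (hf_RD hw K) _
    rw [e, ih]
    rcases lt_trichotomy j K with h1 | h1 | h1
    · rw [hf_orth hw j K h1]; simp [h1, Nat.lt_succ_of_lt h1]
    · subst h1; simp [ip_self, hf_norm hw]
    · rw [← ip_conj (hf w K) (hf w j), hf_orth hw K j h1]; simp [show ¬ j < K by omega, show ¬ j < K + 1 by omega]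

lemma rem_nq {w : ℝ} (hw : 0 < w) {f : ℝ → ℂ} (h : RD f) (K : ℕ) :
    nq (rem w f K) = nq f - ∑ k ∈ Finset.range K, ‖ip (hf w k) f‖ ^ 2 := by
  induction K with
  | zero => simp [rem]
  | succ K ih =>
    have e : nq (rem w f (K+1)) = _ := nq_sub (rem_RD hw h K) (hf_RD hw K) (ip (hf w K) f)
    rw [e, rem_ip hw h, hf_norm hw, ih, Finset.sum_range_succ]
    simp only [lt_irrefl, if_false]
    rw [← Complex.normSq_eq_conj_mul_self, Complex.normSq_eq_norm_sq, Complex.ofReal_re]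
    ring

lemma rem_RD1 {w : ℝ} (hw : 0 < w) {f : ℝ → ℂ} (h : RD1 f) (K : ℕ) : RD1 (rem w f K) ∧
    nq (opa w (rem w f K)) = nq (opa w f) - ∑ k ∈ Finset.range K, 2 * w * k * ‖ip (hf w k) f‖ ^ 2 := by
  induction K with
  | zero => simp [rem, h]
  | succ K ih =>
    obtain ⟨ih1, ih2⟩ := ih
    set c := ip (hf w K) f with hc
    have hd : ∀ x, HasDerivAt (rem w f (K+1)) (deriv (rem w f K) x - c * deriv (hf w K) x) x := fun x =>
      (ih1.hasDerivAt x).sub (((hf_RD1 hw K).hasDerivAt x).const_mul c)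
    have hde : deriv (rem w f (K+1)) = fun x => deriv (rem w f K) x - c * deriv (hf w K) x := by
      ext x; exact (hd x).deriv
    have hR : RD (deriv (rem w f (K+1))) := by
      rw [hde]; exact ih1.2.2.sub ((hf_RD1 hw K).2.2.const_mul c)
    refine ⟨⟨?_, rem_RD hw h.2.1 _, hR⟩, ?_⟩
    · rw [contDiff_one_iff_deriv]
      exact ⟨fun x => (hd x).differentiableAt, hR.1⟩
    · have e : opa w (rem w f (K+1)) = fun x => opa w (rem w f K) x - c * opa w (hf w K) x := by
        ext x; simp only [opa, hde]; simp only [rem]; ring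
      rw [e, nq_sub (ih1.opa w) ((hf_RD1 hw K).opa w), ih2, Finset.sum_range_succ]
      rcases K with _ | K
      · simp [opa_hf0, ip, nq]
      · have hs : √(2 * w * (K + 1)) ^ 2 = 2 * w * (K + 1) := Real.sq_sqrt (by positivity)
        have h1 : ip (opa w (hf w (K+1))) (opa w (rem w f (K+1))) = (2 * w * (K+1) : ℝ) * c := by
          rw [opa_hf hw, ip_const_left, adj (hf_RD1 hw K) ih1, opd_hf hw, ip_const_left, rem_ip hw h.2.1]
          simp only [lt_irrefl, if_false, ← hc, Complex.conj_ofReal]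
          have hs' : (√(2 * w * (K + 1)) : ℂ) * (√(2 * w * (K + 1)) : ℂ) = ((2 * w * (K + 1) : ℝ) : ℂ) := by
            rw [← Complex.ofReal_mul, Real.mul_self_sqrt (by positivity)]
          rw [← mul_assoc, hs']
        have h2 : nq (opa w (hf w (K+1))) = 2 * w * (K + 1) := by
          have : nq (opa w (hf w (K+1))) = √(2 * w * (K + 1)) ^ 2 * nq (hf w K) := by
            rw [opa_hf hw]; unfold nq; rw [← integral_const_mul]; congr 1; ext x
            rw [norm_mul, mul_pow, Complex.norm_real]; simp
          rw [this, hf_norm hw, hs, mul_one]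
        rw [h1, h2]
        have h3 : (starRingEnd ℂ c * ((2 * w * (K+1) : ℝ) * c)).re = 2 * w * (K+1) * ‖c‖ ^ 2 := by
          rw [mul_left_comm, ← Complex.normSq_eq_conj_mul_self, Complex.normSq_eq_norm_sq, ← Complex.ofReal_mul, Complex.ofReal_re]
        rw [h3]; push_cast; ring

lemma osc0 {w : ℝ} (hw : 0 < w) {f : ℝ → ℂ} (h : RD1 f) (K : ℕ) {L : ℝ} (hL : L ≤ (2 * K + 1) * w) :
    L * nq f - (∫ x, (‖deriv f x‖ ^ 2 + w ^ 2 * x ^ 2 * ‖f x‖ ^ 2)) ≤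
      ∑ k ∈ Finset.range K, max (L - (2 * k + 1) * w) 0 * ‖ip (hf w k) f‖ ^ 2 := by
  obtain ⟨h1, h2⟩ := rem_RD1 hw h K
  have h3 := rem_nq hw h.2.1 K
  have h4 := gap hw K _ h1 (fun k hk => by rw [rem_ip hw h.2.1]; simp [hk])
  have h5 := opa_sq h w
  have h6 : ∑ k ∈ Finset.range K, (L - (2 * k + 1) * w) * ‖ip (hf w k) f‖ ^ 2 ≤ ∑ k ∈ Finset.range K, max (L - (2 * k + 1) * w) 0 * ‖ip (hf w k) f‖ ^ 2 := by
    gcongr; exact le_max_left _ _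
  have h7 : ∑ k ∈ Finset.range K, (L - (2 * k + 1) * w) * ‖ip (hf w k) f‖ ^ 2 =
     (L - w) * ∑ k ∈ Finset.range K, ‖ip (hf w k) f‖ ^ 2 - ∑ k ∈ Finset.range K, 2 * w * k * ‖ip (hf w k) f‖ ^ 2 := by
    rw [Finset.mul_sum, ← Finset.sum_sub_distrib]
    refine Finset.sum_congr rfl fun k _ => by ring
  have h8 := nq_nonneg (rem w f K)
  have h9 : L * nq (rem w f K) ≤ (2 * K + 1) * w * nq (rem w f K) := by gcongr
  rw [h2, h5] at h4
  have h10 : nq f = nq (rem w f K) + ∑ k ∈ Finset.range K, ‖ip (hf w k) f‖ ^ 2 := by linarith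
  have h11 : L * nq f = L * nq (rem w f K) + L * ∑ k ∈ Finset.range K, ‖ip (hf w k) f‖ ^ 2 := by rw [h10]; ring
  have h12 : w * nq f = w * nq (rem w f K) + w * ∑ k ∈ Finset.range K, ‖ip (hf w k) f‖ ^ 2 := by rw [h10]; ring
  rw [sub_mul] at h7
  linarith

lemma ip_shift (w : ℝ) (k : ℕ) (f : ℝ → ℂ) (c : ℝ) :
    ip (hf w k) (fun x => f (x + c)) = ∫ x, (hr w k (x - c) : ℂ) * f x := by
  unfold ip
  rw [← integral_add_right_eq_self (fun x => (hr w k (x - c) : ℂ) * f x) c]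
  simp [hf]

lemma RD1_of_compact {f : ℝ → ℂ} (h1 : ContDiff ℝ 1 f) (h2 : HasCompactSupport f) : RD1 f :=
  ⟨h1, RD_of_compact h1.continuous h2, RD_of_compact (h1.continuous_deriv le_rfl) h2.deriv⟩

lemma osc_main {w : ℝ} (hw : 0 < w) {f : ℝ → ℂ} (h1 : ContDiff ℝ 1 f) (h2 : HasCompactSupport f) (c : ℝ)
    (K : ℕ) {L : ℝ} (hL : L ≤ (2 * K + 1) * w) :
    L * (∫ x, ‖f x‖ ^ 2) - (∫ x, (‖deriv f x‖ ^ 2 + w ^ 2 * (x - c) ^ 2 * ‖f x‖ ^ 2)) ≤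
      ∑ k ∈ Finset.range K, max (L - (2 * k + 1) * w) 0 * ‖∫ x, (hr w k (x - c) : ℂ) * f x‖ ^ 2 := by
  have hg : RD1 (fun x => f (x + c)) := by
    refine RD1_of_compact (h1.comp (by fun_prop)) ?_
    exact h2.comp_homeomorph (Homeomorph.addRight c)
  have := osc0 hw hg K hL
  simp_rw [ip_shift] at this
  refine le_trans (le_of_eq ?_) this
  congr 1
  · unfold nq; rw [integral_add_right_eq_self (fun x => ‖f x‖ ^ 2) c]
  · rw [← integral_add_right_eq_self (fun x => ‖deriv f x‖ ^ 2 + w ^ 2 * (x - c) ^ 2 * ‖f x‖ ^ 2) c]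
    congr 1; ext x
    rw [deriv_comp_add_const]; simp

lemma osc_bessel {w : ℝ} (hw : 0 < w) {f : ℝ → ℂ} (h1 : Continuous f) (h2 : HasCompactSupport f) (c : ℝ) (K : ℕ) :
    ∑ k ∈ Finset.range K, ‖∫ x, (hr w k (x - c) : ℂ) * f x‖ ^ 2 ≤ ∫ x, ‖f x‖ ^ 2 := by
  have hg : RD (fun x => f (x + c)) := by
    refine RD_of_compact (h1.comp (by fun_prop)) ?_
    exact h2.comp_homeomorph (Homeomorph.addRight c)
  have h3 := rem_nq hw hg K
  have h4 := nq_nonneg (rem w (fun x => f (x + c)) K)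
  simp_rw [ip_shift] at h3
  have : nq (fun x => f (x + c)) = ∫ x, ‖f x‖ ^ 2 := by
    unfold nq; rw [integral_add_right_eq_self (fun x => ‖f x‖ ^ 2) c]
  linarith

lemma hr_sq_int {w : ℝ} (hw : 0 < w) (k : ℕ) : ∫ x, hr w k x ^ 2 = 1 := by
  have := hf_norm hw k
  unfold nq at this
  rw [← this]; congr 1; ext x; simp [hf]

lemma hr_sq_integrable {w : ℝ} (hw : 0 < w) (k : ℕ) : Integrable (fun x => hr w k x ^ 2) := by
  refine (hf_RD hw k).integrable_sq.congr (Eventually.of_forall fun x => ?_)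
  simp [hf]
lemma hr_cont (w : ℝ) (k : ℕ) : Continuous (hr w k) := (HP w k).continuous.mul (gs_cont w)
end SP1c

section SP2
def ee (t : ℝ) : ℂ := Complex.exp ((t : ℂ) * Complex.I)
lemma ee_norm (t : ℝ) : ‖ee t‖ = 1 := Complex.norm_exp_ofReal_mul_I t
lemma ee_cont : Continuous ee := by unfold ee; fun_prop
lemma ee_deriv (t : ℝ) : HasDerivAt ee (Complex.I * ee t) t := by
  have : HasDerivAt (fun t : ℝ => (t : ℂ) * Complex.I) Complex.I t := by
    simpa using (Complex.ofRealCLM.hasDerivAt (x := t)).mul_const Complex.I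
  refine this.cexp.congr_deriv ?_
  unfold ee; ring

def Ft (f : ℝ → ℂ) (ξ : ℝ) : ℂ := ∫ x, ee (-(2 * π * ξ * x)) * f x

open scoped FourierTransform ContDiff in
lemma Ft_eq (f : ℝ → ℂ) : Ft f = 𝓕 f := by
  ext ξ
  rw [Real.fourier_real_eq]
  unfold Ft
  congr 1; ext x
  rw [Circle.smul_def, Real.fourierChar_apply]
  simp only [ee, smul_eq_mul]
  congr 3; push_cast; ring

open scoped FourierTransform ContDiff in
lemma Ft_cont {f : ℝ → ℂ} (hf : Integrable f) : Continuous (Ft f) := by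
  rw [Ft_eq]
  exact VectorFourier.fourierIntegral_continuous Real.continuous_fourierChar (by simp; fun_prop) hf

open scoped FourierTransform ContDiff SchwartzMap in
lemma plancherel {f : ℝ → ℂ} (hc : Continuous f) (hs : HasCompactSupport f) :
    Integrable (fun ξ => ‖Ft f ξ‖ ^ 2) ∧ ∫ ξ, ‖Ft f ξ‖ ^ 2 = ∫ x, ‖f x‖ ^ 2 := by
  have hm : MemLp f 2 := hc.memLp_of_hasCompactSupport hs
  have hi : Integrable f := hc.integrable_of_hasCompactSupport hs
  set F := hm.toLp f with hF
  have hae : ∀ᵐ ξ, (𝓕 F : Lp ℂ 2 (volume : Measure ℝ)) ξ = Ft f ξ := by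
    apply ae_eq_of_integral_contDiff_smul_eq
    · exact (Lp.memLp (𝓕 F : Lp ℂ 2 (volume : Measure ℝ))).locallyIntegrable (by norm_num)
    · exact (Ft_cont hi).locallyIntegrable
    · intro g g_smooth g_cpt
      have hg₁ : HasCompactSupport (Complex.ofRealCLM ∘ g) := g_cpt.comp_left rfl
      have hg₂ : ContDiff ℝ ∞ (Complex.ofRealCLM ∘ g) := by fun_prop
      set φ : 𝓢(ℝ, ℂ) := hg₁.toSchwartzMap hg₂ with hφ
      have h1 : ∫ x, g x • (𝓕 F : Lp ℂ 2 (volume : Measure ℝ)) x = Lp.toTemperedDistribution (𝓕 F : Lp ℂ 2 (volume : Measure ℝ)) φ := by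
        simp [hφ]
      have h2 : Lp.toTemperedDistribution (𝓕 F : Lp ℂ 2 (volume : Measure ℝ)) φ = ∫ x, (𝓕 φ) x • f x := by
        rw [← Lp.fourier_toTemperedDistribution_eq, TemperedDistribution.fourier_apply, Lp.toTemperedDistribution_apply]
        apply integral_congr_ae
        filter_upwards [hm.coeFn_toLp] with x hx
        rw [hx]
      rw [h1, h2]
      have h3 := VectorFourier.integral_fourierIntegral_smul_eq_flip (μ := volume) (ν := volume) (L := innerₗ ℝ) (f := φ) (g := f) Real.continuous_fourierChar (by simp; fun_prop) φ.integrable hi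
      rw [flip_innerₗ] at h3
      rw [Ft_eq]
      refine h3.trans ?_
      simp [hφ]
      rfl
  have h1 : ‖(𝓕 F : Lp ℂ 2 (volume : Measure ℝ))‖ = ‖F‖ := Lp.norm_fourier_eq F
  have h2 : MemLp (Ft f) 2 := (memLp_congr_ae hae).1 (Lp.memLp (𝓕 F : Lp ℂ 2 (volume : Measure ℝ)))
  refine ⟨h2.integrable_norm_pow (by norm_num), ?_⟩
  have h3 : ‖(𝓕 F : Lp ℂ 2 (volume : Measure ℝ))‖ ^ 2 = ∫ ξ, ‖Ft f ξ‖ ^ 2 := by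
    rw [← @inner_self_eq_norm_sq ℂ, L2.inner_def]
    simp only [inner_self_eq_norm_sq_to_K]
    rw [← integral_re]
    · apply integral_congr_ae
      filter_upwards [hae] with x hx
      rw [hx]; norm_cast
    · refine (h2.integrable_norm_pow (by norm_num)).ofReal.congr ?_
      filter_upwards [hae] with x hx
      rw [hx]; simp
  have h4 : ‖F‖ ^ 2 = ∫ x, ‖f x‖ ^ 2 := by
    rw [← @inner_self_eq_norm_sq ℂ, L2.inner_def]
    simp only [inner_self_eq_norm_sq_to_K]
    rw [← integral_re]
    · apply integral_congr_ae
      filter_upwards [hm.coeFn_toLp] with x hx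
      rw [hx]; norm_cast
    · refine (hm.integrable_norm_pow (by norm_num)).ofReal.congr ?_
      filter_upwards [hm.coeFn_toLp] with x hx
      rw [hx]; simp
  rw [← h3, ← h4, h1]
end SP2

section SP3
def C1c (v : R2 → ℂ) : Prop := ContDiff ℝ 1 v ∧ HasCompactSupport v

lemma cont_param {X Y E : Type*} [TopologicalSpace X] [TopologicalSpace Y] [MeasurableSpace Y] [OpensMeasurableSpace Y]
    [NormedAddCommGroup E] [NormedSpace ℝ E] {μ : Measure Y} [IsFiniteMeasureOnCompacts μ]
    {f : X → Y → E} (hf : Continuous (Function.uncurry f)) {k : Set Y} (hk : IsCompact k)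
    (h : ∀ x, ∀ y ∉ k, f x y = 0) : Continuous (fun x => ∫ y, f x y ∂μ) := by
  rw [← continuousOn_univ]
  exact continuousOn_integral_of_compact_support hk hf.continuousOn (fun p x _ hx => h p x hx)

lemma slice1_cpt {v : R2 → ℂ} (h : HasCompactSupport v) (y : ℝ) : HasCompactSupport (fun x => v (x, y)) := by
  refine HasCompactSupport.intro (h.image continuous_fst) (fun x hx => ?_)
  by_contra h0
  exact hx ⟨(x, y), subset_tsupport v h0, rfl⟩

lemma dX_cont {v : R2 → ℂ} (h : C1c v) : Continuous (dX v) := by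
  unfold dX; exact (h.1.continuous_fderiv (by norm_num)).clm_apply continuous_const
lemma dY_cont {v : R2 → ℂ} (h : C1c v) : Continuous (dY v) := by
  unfold dY; exact (h.1.continuous_fderiv (by norm_num)).clm_apply continuous_const
lemma dX_cpt {v : R2 → ℂ} (h : C1c v) : HasCompactSupport (dX v) := by
  unfold dX; exact h.2.fderiv_apply (𝕜 := ℝ) _
lemma dY_cpt {v : R2 → ℂ} (h : C1c v) : HasCompactSupport (dY v) := by
  unfold dY; exact h.2.fderiv_apply (𝕜 := ℝ) _

lemma hasDerivAt_x {v : R2 → ℂ} {p : R2} (h : DifferentiableAt ℝ v p) :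
    HasDerivAt (fun x => v (x, p.2)) (dX v p) p.1 := by
  have h1 : HasDerivAt (fun x : ℝ => (x, p.2)) ((1 : ℝ), (0:ℝ)) p.1 := (hasDerivAt_id p.1).prodMk (hasDerivAt_const p.1 p.2)
  exact h.hasFDerivAt.comp_hasDerivAt p.1 h1
lemma hasDerivAt_y {v : R2 → ℂ} {p : R2} (h : DifferentiableAt ℝ v p) :
    HasDerivAt (fun y => v (p.1, y)) (dY v p) p.2 := by
  have h1 : HasDerivAt (fun y : ℝ => (p.1, y)) ((0 : ℝ), (1:ℝ)) p.2 := (hasDerivAt_const p.2 p.1).prodMk (hasDerivAt_id p.2)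
  exact h.hasFDerivAt.comp_hasDerivAt p.2 h1

def vh (v : R2 → ℂ) (ξ y : ℝ) : ℂ := Ft (fun x => v (x, y)) ξ

lemma vh_cont {v : R2 → ℂ} (hc : Continuous v) (hs : HasCompactSupport v) :
    Continuous (fun q : R2 => vh v q.1 q.2) := by
  unfold vh Ft
  refine cont_param (f := fun (q : R2) (x : ℝ) => ee (-(2 * π * q.1 * x)) * v (x, q.2)) ?_ (hs.image continuous_fst) ?_
  · refine (ee_cont.comp (by fun_prop)).mul (hc.comp (by fun_prop))
  · intro q x hx
    by_contra h0
    exact hx ⟨(x, q.2), subset_tsupport v (fun h => h0 (by simp [h])), rfl⟩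

lemma vh_int {v : R2 → ℂ} (hc : Continuous v) (hs : HasCompactSupport v) :
    Integrable (fun q : R2 => ‖vh v q.1 q.2‖ ^ 2) ∧ ∫ q : R2, ‖vh v q.1 q.2‖ ^ 2 = ∫ p, ‖v p‖ ^ 2 := by
  have hp : ∀ y, _ := fun y => plancherel (f := fun x => v (x, y)) (by fun_prop) (slice1_cpt hs y)
  have hi : Integrable (fun p => ‖v p‖ ^ 2) := by
    refine Continuous.integrable_of_hasCompactSupport (by fun_prop) ?_
    exact hs.comp_left (g := fun z : ℂ => ‖z‖ ^ 2) (by simp)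
  rw [Measure.volume_eq_prod] at hi ⊢
  have h1 : Integrable (fun q : R2 => ‖vh v q.1 q.2‖ ^ 2) (volume.prod volume) := by
    have hm : AEStronglyMeasurable (fun q : R2 => ‖vh v q.1 q.2‖ ^ 2) (volume.prod volume) :=
      ((vh_cont hc hs).norm.pow 2).aestronglyMeasurable
    rw [integrable_prod_iff' hm]
    refine ⟨Eventually.of_forall fun y => (hp y).1, ?_⟩
    have : (fun y => ∫ x, ‖‖vh v (x, y).1 (x, y).2‖ ^ 2‖) = fun y => ∫ x, ‖v (x, y)‖ ^ 2 := by
      ext y; rw [← (hp y).2]; simp [vh]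
    rw [this]
    exact hi.integral_prod_right
  refine ⟨h1, ?_⟩
  rw [integral_prod_symm _ h1, integral_prod_symm _ hi]
  congr 1; ext y; exact (hp y).2

lemma vh_D1 {v : R2 → ℂ} (h : C1c v) (B ξ y : ℝ) :
    vh (fun p => -Complex.I * dX v p + (B * p.2 : ℝ) * v p) ξ y = ((2 * π * ξ + B * y : ℝ) : ℂ) * vh v ξ y := by
  unfold vh Ft
  have hv := h.1.continuous
  have hd : ∀ x, HasDerivAt (fun x => v (x, y)) (dX v (x, y)) x := fun x =>
    hasDerivAt_x (p := (x, y)) (h.1.differentiable (by norm_num) _)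
  have he : ∀ x : ℝ, HasDerivAt (fun x : ℝ => ee (-(2 * π * ξ * x))) (-(2 * π * ξ : ℝ) * Complex.I * ee (-(2 * π * ξ * x))) x := by
    intro x
    have h1 : HasDerivAt (fun x : ℝ => -(2 * π * ξ * x)) (-(2 * π * ξ)) x := by
      exact (((hasDerivAt_id x).const_mul (2 * π * ξ)).neg).congr_deriv (by simp)
    refine ((ee_deriv _).scomp x h1).congr_deriv ?_
    simp; ring
  have hec : Continuous (fun x : ℝ => ee (-(2 * π * ξ * x))) := ee_cont.comp (by fun_prop)
  have c1 := slice1_cpt h.2 y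
  have c2 := slice1_cpt (dX_cpt h) y
  have i1 : Integrable (fun x => ee (-(2 * π * ξ * x)) * dX v (x, y)) :=
    (hec.mul ((dX_cont h).comp (by fun_prop))).integrable_of_hasCompactSupport c2.mul_left
  have i2 : Integrable (fun x => ee (-(2 * π * ξ * x)) * v (x, y)) :=
    (hec.mul (hv.comp (by fun_prop))).integrable_of_hasCompactSupport c1.mul_left
  have i3 : Integrable (fun x : ℝ => -(2 * π * ξ : ℝ) * Complex.I * ee (-(2 * π * ξ * x)) * v (x, y)) := by
    refine (i2.const_mul (-(2 * π * ξ : ℝ) * Complex.I)).congr (Eventually.of_forall fun x => ?_)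
    simp only; ring
  have ibp := integral_mul_deriv_eq_deriv_mul_of_integrable (fun x _ => he x) (fun x _ => hd x) i1 i3 i2
  have e1 : ∀ x : ℝ, ee (-(2 * π * ξ * x)) * (-Complex.I * dX v (x, y) + (B * (x, y).2 : ℝ) * v (x, y))
      = -Complex.I * (ee (-(2 * π * ξ * x)) * dX v (x, y)) + (B * y : ℝ) * (ee (-(2 * π * ξ * x)) * v (x, y)) := by
    intro x; ring
  simp_rw [e1]
  rw [integral_add (i1.const_mul _) (i2.const_mul _), integral_const_mul, integral_const_mul, ibp]
  have e2 : ∫ x : ℝ, -(2 * π * ξ : ℝ) * Complex.I * ee (-(2 * π * ξ * x)) * v (x, y) =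
      -(2 * π * ξ : ℝ) * Complex.I * ∫ x : ℝ, ee (-(2 * π * ξ * x)) * v (x, y) := by
    rw [← integral_const_mul]; congr 1; ext x; ring
  rw [e2]
  push_cast
  linear_combination (-(2 * π * ξ : ℂ) * ∫ x : ℝ, ee (-(2 * π * ξ * x)) * v (x, y)) * Complex.I_mul_I

lemma vh_deriv {v : R2 → ℂ} (h : C1c v) (ξ y : ℝ) :
    HasDerivAt (fun y => vh v ξ y) (vh (dY v) ξ y) y := by
  unfold vh Ft
  have hv := h.1.continuous
  have hdy := dY_cont h
  have hec : Continuous (fun x : ℝ => ee (-(2 * π * ξ * x))) := ee_cont.comp (by fun_prop)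
  obtain ⟨C, hC⟩ := (dY_cpt h).exists_bound_of_continuous hdy
  have hk : IsCompact (Prod.fst '' tsupport (dY v)) := (dY_cpt h).image continuous_fst
  refine (hasDerivAt_integral_of_dominated_loc_of_deriv_le (F := fun y x => ee (-(2 * π * ξ * x)) * v (x, y))
    (F' := fun y x => ee (-(2 * π * ξ * x)) * dY v (x, y))
    (bound := (Prod.fst '' tsupport (dY v)).indicator fun _ => C) (s := Set.univ) univ_mem ?_ ?_ ?_ ?_ ?_ ?_).2
  · exact Eventually.of_forall fun y => (hec.mul (hv.comp (by fun_prop))).aestronglyMeasurable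
  · exact (hec.mul (hv.comp (by fun_prop))).integrable_of_hasCompactSupport (slice1_cpt h.2 y).mul_left
  · exact (hec.mul (hdy.comp (by fun_prop))).aestronglyMeasurable
  · refine Eventually.of_forall fun x y _ => ?_
    rw [norm_mul, ee_norm, one_mul]
    by_cases hx : x ∈ Prod.fst '' tsupport (dY v)
    · rw [Set.indicator_of_mem hx]; exact hC _
    · rw [Set.indicator_of_notMem hx]
      have : dY v (x, y) = 0 := by
        by_contra h0
        exact hx ⟨(x, y), subset_tsupport _ h0, rfl⟩
      simp [this]
  · exact (integrable_indicator_iff hk.measurableSet).2 (integrableOn_const hk.measure_ne_top)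
  · refine Eventually.of_forall fun x y _ => ?_
    exact (hasDerivAt_y (p := (x, y)) (h.1.differentiable (by norm_num) _)).const_mul _

lemma vh_cpt {v : R2 → ℂ} (h : HasCompactSupport v) (ξ : ℝ) : HasCompactSupport (fun y => vh v ξ y) := by
  refine HasCompactSupport.intro (h.image continuous_snd) (fun y hy => ?_)
  have : ∀ x, v (x, y) = 0 := by
    intro x; by_contra h0
    exact hy ⟨(x, y), subset_tsupport v h0, rfl⟩
  simp [vh, Ft, this]

def q0 (B : ℝ) (v : R2 → ℂ) : ℝ :=
  ∫ p, (‖-Complex.I * dX v p + (B * p.2 : ℝ) * v p‖ ^ 2 + ‖dY v p‖ ^ 2)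

def cf (B : ℝ) (k : ℕ) (ξ : ℝ) (v : R2 → ℂ) : ℂ :=
  ∫ p : R2, ee (-(2 * π * ξ * p.1)) * (hr |B| k (p.2 + 2 * π * ξ / B) : ℂ) * v p

lemma cf_eq {v : R2 → ℂ} (hc : Continuous v) (hs : HasCompactSupport v) (B : ℝ) (k : ℕ) (ξ : ℝ) :
    cf B k ξ v = ∫ y, (hr |B| k (y - (-(2 * π * ξ / B))) : ℂ) * vh v ξ y := by
  unfold cf vh Ft
  have hr' := hr_cont |B| k
  have hi : Integrable (fun p : R2 => ee (-(2 * π * ξ * p.1)) * (hr |B| k (p.2 + 2 * π * ξ / B) : ℂ) * v p) := by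
    refine Continuous.integrable_of_hasCompactSupport ?_ hs.mul_left
    exact ((ee_cont.comp (by fun_prop)).mul (Complex.continuous_ofReal.comp (by fun_prop))).mul hc
  rw [Measure.volume_eq_prod] at hi ⊢
  rw [integral_prod_symm _ hi]
  congr 1; ext y
  rw [← integral_const_mul]
  congr 1; ext x; simp only [sub_neg_eq_add]; ring

lemma sq_int {v : R2 → ℂ} (hc : Continuous v) (hs : HasCompactSupport v) : Integrable (fun p => ‖v p‖ ^ 2) := by
  refine Continuous.integrable_of_hasCompactSupport (by fun_prop) ?_
  exact hs.comp_left (g := fun z : ℂ => ‖z‖ ^ 2) (by simp)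

lemma D1_cont {v : R2 → ℂ} (h : C1c v) (B : ℝ) : Continuous (fun p : R2 => -Complex.I * dX v p + (B * p.2 : ℝ) * v p) :=
  (continuous_const.mul (dX_cont h)).add ((Complex.continuous_ofReal.comp (by fun_prop)).mul h.1.continuous)
lemma D1_cpt {v : R2 → ℂ} (h : C1c v) (B : ℝ) : HasCompactSupport (fun p : R2 => -Complex.I * dX v p + (B * p.2 : ℝ) * v p) :=
  (dX_cpt h).mul_left.add h.2.mul_left

lemma flat_one {v : R2 → ℂ} (h : C1c v) {B : ℝ} (hB : B ≠ 0) (K : ℕ) {L : ℝ} (hL : L ≤ (2 * K + 1) * |B|) :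
    ∃ G : ℝ → ℝ, Integrable G ∧ L * (∫ p, ‖v p‖ ^ 2) - q0 B v = ∫ ξ, G ξ ∧
      ∀ ξ, G ξ ≤ ∑ k ∈ Finset.range K, max (L - (2 * k + 1) * |B|) 0 * ‖cf B k ξ v‖ ^ 2 := by
  have hv := h.1.continuous
  obtain ⟨a1, a2⟩ := vh_int hv h.2
  obtain ⟨b1, b2⟩ := vh_int (dY_cont h) (dY_cpt h)
  obtain ⟨c1, c2⟩ := vh_int (D1_cont h B) (D1_cpt h B)
  simp only [vh_D1 h B] at c1 c2
  rw [Measure.volume_eq_prod ℝ ℝ] at a1 b1 c1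
  refine ⟨fun ξ => L * (∫ y, ‖vh v ξ y‖ ^ 2) - ((∫ y, ‖((2 * π * ξ + B * y : ℝ) : ℂ) * vh v ξ y‖ ^ 2) + ∫ y, ‖vh (dY v) ξ y‖ ^ 2), ?_, ?_, ?_⟩
  · exact (a1.integral_prod_left.const_mul L).sub (c1.integral_prod_left.add b1.integral_prod_left)
  · have j1 : Integrable (fun ξ => L * (∫ y, ‖vh v ξ y‖ ^ 2)) := a1.integral_prod_left.const_mul L
    have j2 : Integrable (fun ξ => (∫ y, ‖((2 * π * ξ + B * y : ℝ) : ℂ) * vh v ξ y‖ ^ 2) + ∫ y, ‖vh (dY v) ξ y‖ ^ 2) :=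
      c1.integral_prod_left.add b1.integral_prod_left
    rw [integral_sub j1 j2]
    rw [integral_const_mul, integral_add c1.integral_prod_left b1.integral_prod_left]
    unfold q0
    rw [integral_add (sq_int (D1_cont h B) (D1_cpt h B)) (sq_int (dY_cont h) (dY_cpt h))]
    rw [← a2, ← b2, ← c2]
    rw [Measure.volume_eq_prod ℝ ℝ, integral_prod _ a1, integral_prod _ b1, integral_prod _ c1]
  · intro ξ
    have hB' : 0 < |B| := abs_pos.2 hB
    have hder : deriv (fun y => vh v ξ y) = fun y => vh (dY v) ξ y := by ext y; exact (vh_deriv h ξ y).deriv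
    have hcd : Continuous (fun y => vh (dY v) ξ y) := (vh_cont (dY_cont h) (dY_cpt h)).comp (by fun_prop : Continuous fun y : ℝ => (ξ, y))
    have hcv : Continuous (fun y => vh v ξ y) := (vh_cont hv h.2).comp (by fun_prop : Continuous fun y : ℝ => (ξ, y))
    have h1 : ContDiff ℝ 1 (fun y => vh v ξ y) := by
      rw [contDiff_one_iff_deriv]
      refine ⟨fun y => (vh_deriv h ξ y).differentiableAt, ?_⟩
      rw [hder]; exact hcd
    have := osc_main hB' h1 (vh_cpt h.2 ξ) (-(2 * π * ξ / B)) K hL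
    simp_rw [← cf_eq hv h.2] at this
    refine le_trans (le_of_eq ?_) this
    simp only
    congr 1
    rw [hder, add_comm]
    have i1 : Integrable (fun y => ‖vh (dY v) ξ y‖ ^ 2) := (RD_of_compact hcd (vh_cpt (dY_cpt h) ξ)).integrable_sq
    have e : ∀ y, ‖((2 * π * ξ + B * y : ℝ) : ℂ) * vh v ξ y‖ ^ 2 = |B| ^ 2 * (y - (-(2 * π * ξ / B))) ^ 2 * ‖vh v ξ y‖ ^ 2 := by
      intro y
      rw [norm_mul, mul_pow, Complex.norm_real, Real.norm_eq_abs, sq_abs, sq_abs]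
      congr 1; field_simp; ring
    have i2 : Integrable (fun y => |B| ^ 2 * (y - (-(2 * π * ξ / B))) ^ 2 * ‖vh v ξ y‖ ^ 2) := by
      simp_rw [← e]
      refine (RD_of_compact (f := fun y => ((2 * π * ξ + B * y : ℝ) : ℂ) * vh v ξ y) ?_ (vh_cpt h.2 ξ).mul_left).integrable_sq
      exact (Complex.continuous_ofReal.comp (by fun_prop)).mul hcv
    rw [integral_add i1 i2]
    simp_rw [e]

lemma fub {W : R2 → ℝ} (hW : Integrable W) {B : ℝ} (hB : B ≠ 0) (k : ℕ) :
    Integrable (fun ξ => ∫ p : R2, W p * hr |B| k (p.2 + 2 * π * ξ / B) ^ 2) ∧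
    ∫ ξ, (∫ p : R2, W p * hr |B| k (p.2 + 2 * π * ξ / B) ^ 2) = |B| / (2 * π) * ∫ p, W p := by
  have hB' : 0 < |B| := abs_pos.2 hB
  have hin : ∀ y : ℝ, Integrable (fun ξ => hr |B| k (y + 2 * π * ξ / B) ^ 2) ∧ ∫ ξ, hr |B| k (y + 2 * π * ξ / B) ^ 2 = |B| / (2 * π) := by
    intro y
    have hne : 2 * π / B ≠ 0 := by positivity
    have e : (fun ξ => hr |B| k (y + 2 * π * ξ / B) ^ 2) = fun ξ => (fun t => hr |B| k (y + t) ^ 2) ((2 * π / B) * ξ) := by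
      ext ξ; simp only; congr 3; ring
    rw [e]
    refine ⟨((hr_sq_integrable hB' k).comp_add_left y).comp_mul_left' hne, ?_⟩
    refine (Measure.integral_comp_mul_left (fun t => hr |B| k (y + t) ^ 2) (2*π/B)).trans ?_
    rw [integral_add_left_eq_self (fun t => hr |B| k t ^ 2), hr_sq_int hB']
    simp [abs_div, abs_of_pos Real.pi_pos]
  have hI : Integrable (fun q : ℝ × (R2) => W q.2 * hr |B| k (q.2.2 + 2 * π * q.1 / B) ^ 2) (volume.prod volume) := by
    have hm : AEStronglyMeasurable (fun q : ℝ × (R2) => W q.2 * hr |B| k (q.2.2 + 2 * π * q.1 / B) ^ 2) (volume.prod volume) := by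
      refine hW.1.comp_snd.mul ?_
      have := hr_cont |B| k
      exact Continuous.aestronglyMeasurable (by fun_prop)
    rw [integrable_prod_iff' hm]
    refine ⟨Eventually.of_forall fun p => ((hin p.2).1.const_mul (W p)), ?_⟩
    have : (fun p : R2 => ∫ ξ, ‖W p * hr |B| k (p.2 + 2 * π * ξ / B) ^ 2‖) = fun p => ‖W p‖ * (|B| / (2 * π)) := by
      ext p
      rw [← (hin p.2).2, ← integral_const_mul]
      congr 1; ext ξ; rw [norm_mul]; simp
    rw [this]
    exact hW.norm.mul_const _
  refine ⟨hI.integral_prod_left, ?_⟩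
  rw [integral_integral_swap hI]
  simp_rw [integral_const_mul, (hin _).2]
  rw [integral_mul_const]; ring

lemma flat_upper {ι : Type*} (s : Finset ι) (v : ι → R2 → ℂ) (hv : ∀ i ∈ s, C1c (v i)) {W : R2 → ℝ} (hW : Integrable W)
    {B : ℝ} (hB : B ≠ 0) (K : ℕ) {L : ℝ} (hL : L ≤ (2 * K + 1) * |B|)
    (hb : ∀ φ : R2 → ℂ, Continuous φ → ∑ i ∈ s, ‖∫ p, φ p * v i p‖ ^ 2 ≤ ∫ p, W p * ‖φ p‖ ^ 2) :
    ∑ i ∈ s, (L * (∫ p, ‖v i p‖ ^ 2) - q0 B (v i)) ≤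
      (∑ k ∈ Finset.range K, max (L - (2 * k + 1) * |B|) 0) * (|B| / (2 * π) * ∫ p, W p) := by
  choose! G hG1 hG2 hG3 using fun i (hi : i ∈ s) => flat_one (hv i hi) hB K hL
  rw [Finset.sum_congr rfl hG2, ← integral_finsetSum _ hG1]
  have hf := fun k => fub hW hB k
  calc ∫ ξ, ∑ i ∈ s, G i ξ ≤ ∫ ξ, ∑ k ∈ Finset.range K, max (L - (2 * k + 1) * |B|) 0 * ∫ p : R2, W p * hr |B| k (p.2 + 2 * π * ξ / B) ^ 2 := by
        refine integral_mono (integrable_finsetSum _ hG1) (integrable_finsetSum _ fun k _ => (hf k).1.const_mul _) ?_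
        intro ξ
        calc ∑ i ∈ s, G i ξ ≤ ∑ i ∈ s, ∑ k ∈ Finset.range K, max (L - (2 * k + 1) * |B|) 0 * ‖cf B k ξ (v i)‖ ^ 2 :=
              Finset.sum_le_sum fun i hi => hG3 i hi ξ
          _ = ∑ k ∈ Finset.range K, max (L - (2 * k + 1) * |B|) 0 * ∑ i ∈ s, ‖cf B k ξ (v i)‖ ^ 2 := by
              rw [Finset.sum_comm]; simp_rw [Finset.mul_sum]
          _ ≤ _ := by
              refine Finset.sum_le_sum fun k _ => mul_le_mul_of_nonneg_left ?_ (le_max_right _ _)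
              have hr' := hr_cont |B| k
              refine (hb (fun p => ee (-(2 * π * ξ * p.1)) * (hr |B| k (p.2 + 2 * π * ξ / B) : ℂ)) ?_).trans (le_of_eq ?_)
              · exact (ee_cont.comp (by fun_prop)).mul (Complex.continuous_ofReal.comp (by fun_prop))
              · congr 1; ext p; rw [norm_mul, ee_norm, Complex.norm_real]; simp
    _ = _ := by
        rw [integral_finsetSum _ fun k _ => (hf k).1.const_mul _, Finset.sum_mul]
        refine Finset.sum_congr rfl fun k _ => ?_
        rw [integral_const_mul, (hf k).2]

lemma cf_cont {w : R2 → ℂ} (hc : Continuous w) (hs : HasCompactSupport w) (B : ℝ) (k : ℕ) : Continuous (fun ξ => cf B k ξ w) := by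
  have hr' := hr_cont |B| k
  refine cont_param (f := fun (ξ : ℝ) (p : R2) => ee (-(2 * π * ξ * p.1)) * (hr |B| k (p.2 + 2 * π * ξ / B) : ℂ) * w p) ?_ hs ?_
  · exact ((ee_cont.comp (by fun_prop)).mul (Complex.continuous_ofReal.comp (by fun_prop))).mul (hc.comp (by fun_prop))
  · intro ξ p hp
    rw [image_eq_zero_of_notMem_tsupport hp, mul_zero]

lemma flat_bessel {w : R2 → ℂ} (hc : Continuous w) (hs : HasCompactSupport w) {B : ℝ} (hB : B ≠ 0) (K : ℕ) :
    (∀ k, Integrable (fun ξ => ‖cf B k ξ w‖ ^ 2)) ∧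
    ∑ k ∈ Finset.range K, ∫ ξ, ‖cf B k ξ w‖ ^ 2 ≤ ∫ p, ‖w p‖ ^ 2 := by
  obtain ⟨a1, a2⟩ := vh_int hc hs
  rw [Measure.volume_eq_prod ℝ ℝ] at a1
  have hB' : 0 < |B| := abs_pos.2 hB
  have key : ∀ K ξ, ∑ k ∈ Finset.range K, ‖cf B k ξ w‖ ^ 2 ≤ ∫ y, ‖vh w ξ y‖ ^ 2 := by
    intro K ξ
    have hcv : Continuous (fun y => vh w ξ y) := (vh_cont hc hs).comp (by fun_prop : Continuous fun y : ℝ => (ξ, y))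
    have := osc_bessel hB' hcv (vh_cpt hs ξ) (-(2 * π * ξ / B)) K
    simp_rw [← cf_eq hc hs] at this
    exact this
  have hi : ∀ k, Integrable (fun ξ => ‖cf B k ξ w‖ ^ 2) := by
    intro k
    refine a1.integral_prod_left.mono' ((cf_cont hc hs B k).norm.pow 2).aestronglyMeasurable (Eventually.of_forall fun ξ => ?_)
    rw [Real.norm_of_nonneg (by positivity)]
    refine le_trans ?_ (key (k+1) ξ)
    exact Finset.single_le_sum (f := fun k => ‖cf B k ξ w‖ ^ 2) (fun i _ => by positivity) (Finset.mem_range.2 (Nat.lt_succ_self k))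
  refine ⟨hi, ?_⟩
  rw [← integral_finsetSum _ fun k _ => hi k, ← a2, Measure.volume_eq_prod ℝ ℝ, integral_prod _ a1]
  exact integral_mono (integrable_finsetSum _ fun k _ => hi k) a1.integral_prod_left (key K)
end SP3

section SP3b
def wv (B : ℝ) (k : ℕ) (ξ : ℝ) (p : R2) : ℂ := ee (2 * π * ξ * p.1) * (hr |B| k (p.2 + 2 * π * ξ / B) : ℂ)

lemma wv_norm (B : ℝ) (k : ℕ) (ξ : ℝ) (p : R2) : ‖wv B k ξ p‖ ^ 2 = hr |B| k (p.2 + 2 * π * ξ / B) ^ 2 := by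
  unfold wv; rw [norm_mul, ee_norm, Complex.norm_real]; simp

lemma ee_cd : ContDiff ℝ 1 ee := by
  unfold ee
  exact Complex.contDiff_exp.comp (Complex.ofRealCLM.contDiff.mul contDiff_const)

lemma hr_cd1 {w : ℝ} (hw : 0 < w) (k : ℕ) : ContDiff ℝ 1 (hr w k) ∧ ∀ x, HasDerivAt (hr w k) (deriv (hr w k) x) x := by
  have h : Differentiable ℝ (hr w k) := fun x => (hr_deriv w k x).differentiableAt
  refine ⟨contDiff_one_iff_deriv.2 ⟨h, ?_⟩, fun x => (h x).hasDerivAt⟩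
  exact Differentiable.continuous (𝕜 := ℝ) fun x => (hr_deriv2 hw k x).differentiableAt

lemma wv_cd {B : ℝ} (hB : B ≠ 0) (k : ℕ) (ξ : ℝ) : ContDiff ℝ 1 (wv B k ξ) := by
  have h1 := (hr_cd1 (abs_pos.2 hB) k).1
  unfold wv
  refine (ee_cd.comp (by fun_prop)).mul (Complex.ofRealCLM.contDiff.comp (h1.comp (by fun_prop)))

lemma hasDerivAt_xr {v : R2 → ℝ} {p : R2} (h : DifferentiableAt ℝ v p) :
    HasDerivAt (fun x => v (x, p.2)) (dXr v p) p.1 := by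
  have h1 : HasDerivAt (fun x : ℝ => (x, p.2)) ((1 : ℝ), (0:ℝ)) p.1 := (hasDerivAt_id p.1).prodMk (hasDerivAt_const p.1 p.2)
  exact h.hasFDerivAt.comp_hasDerivAt p.1 h1
lemma hasDerivAt_yr {v : R2 → ℝ} {p : R2} (h : DifferentiableAt ℝ v p) :
    HasDerivAt (fun y => v (p.1, y)) (dYr v p) p.2 := by
  have h1 : HasDerivAt (fun y : ℝ => (p.1, y)) ((0 : ℝ), (1:ℝ)) p.2 := (hasDerivAt_const p.2 p.1).prodMk (hasDerivAt_id p.2)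
  exact h.hasFDerivAt.comp_hasDerivAt p.2 h1

lemma int_dy_zero {f g : R2 → ℝ} (hfc : Continuous f) (hgc : Continuous g) (hf : HasCompactSupport f) (hg : HasCompactSupport g)
    (h : ∀ p : R2, HasDerivAt (fun y => f (p.1, y)) (g p) p.2) : ∫ p, g p = 0 := by
  have hi : Integrable g := hgc.integrable_of_hasCompactSupport hg
  have sl : ∀ {u : R2 → ℝ}, HasCompactSupport u → ∀ x, HasCompactSupport fun y => u (x, y) := by
    intro u hu x
    refine HasCompactSupport.intro (hu.image continuous_snd) (fun y hy => ?_)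
    by_contra h0
    exact hy ⟨(x, y), subset_tsupport u h0, rfl⟩
  rw [Measure.volume_eq_prod] at hi ⊢
  rw [integral_prod _ hi]
  refine integral_eq_zero_of_ae (Eventually.of_forall fun x => ?_)
  refine integral_eq_zero_of_hasDerivAt_of_integrable (f := fun y => f (x, y)) (fun y => h (x, y)) ?_ ?_
  · exact (by fun_prop : Continuous fun y => g (x, y)).integrable_of_hasCompactSupport (sl hg x)
  · exact (by fun_prop : Continuous fun y => f (x, y)).integrable_of_hasCompactSupport (sl hf x)

lemma dXr_cont {χ : R2 → ℝ} (h : ContDiff ℝ 1 χ) : Continuous (dXr χ) := by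
  unfold dXr; exact (h.continuous_fderiv (by norm_num)).clm_apply continuous_const
lemma dYr_cont {χ : R2 → ℝ} (h : ContDiff ℝ 1 χ) : Continuous (dYr χ) := by
  unfold dYr; exact (h.continuous_fderiv (by norm_num)).clm_apply continuous_const
lemma dXr_cpt {χ : R2 → ℝ} (h : HasCompactSupport χ) : HasCompactSupport (dXr χ) := by
  unfold dXr; exact h.fderiv_apply (𝕜 := ℝ) _
lemma dYr_cpt {χ : R2 → ℝ} (h : HasCompactSupport χ) : HasCompactSupport (dYr χ) := by
  unfold dYr; exact h.fderiv_apply (𝕜 := ℝ) _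

set_option maxHeartbeats 1000000 in
lemma q0_wv {B : ℝ} (hB : B ≠ 0) (k : ℕ) (ξ : ℝ) {χ : R2 → ℝ} (hχ : ContDiff ℝ 1 χ) (hs : HasCompactSupport χ) :
    q0 B (fun p => (χ p : ℂ) * wv B k ξ p) =
      ∫ p, (dXr χ p ^ 2 + dYr χ p ^ 2 + (2 * k + 1) * |B| * χ p ^ 2) * hr |B| k (p.2 + 2 * π * ξ / B) ^ 2 := by
  have hB' := abs_pos.2 hB
  obtain ⟨hh1, hh2⟩ := hr_cd1 hB' k
  have hh3 := hr_deriv2 hB' k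
  have hc1 := hh1.continuous
  have hc2 : Continuous (deriv (hr |B| k)) := Differentiable.continuous (𝕜 := ℝ) fun x => (hh3 x).differentiableAt
  set c := 2 * π * ξ / B with hc
  have hcB : B * c = 2 * π * ξ := by rw [hc]; field_simp
  set v : R2 → ℂ := fun p => (χ p : ℂ) * wv B k ξ p with hv
  have hvd : Differentiable ℝ v := by
    have h2 : ContDiff ℝ 1 v := (Complex.ofRealCLM.contDiff.comp hχ).mul (wv_cd hB k ξ)
    exact h2.differentiable (by norm_num)
  have hχd := hχ.differentiable (by norm_num)
  have kx := dXr_cont hχ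
  have ky := dYr_cont hχ
  have kk := hχ.continuous
  have ex : ∀ p, dX v p = ((dXr χ p : ℂ) + χ p * (2 * π * ξ : ℝ) * Complex.I) * wv B k ξ p := by
    intro p
    refine (hasDerivAt_x (hvd p)).unique ?_
    have h1 := (hasDerivAt_xr (hχd p)).ofReal_comp
    have h2 : HasDerivAt (fun x : ℝ => 2 * π * ξ * x) (2 * π * ξ) p.1 := by
      simpa using (hasDerivAt_id p.1).const_mul (2 * π * ξ)
    have h3 := (ee_deriv _).scomp p.1 h2
    have h4 := (h1.mul (h3.mul_const (hr |B| k (p.2 + c) : ℂ)))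
    refine h4.congr_deriv ?_
    simp [wv, ← hc]; ring
  have ey : ∀ p, dY v p = ee (2 * π * ξ * p.1) * ((dYr χ p * hr |B| k (p.2 + c) + χ p * deriv (hr |B| k) (p.2 + c) : ℝ) : ℂ) := by
    intro p
    refine (hasDerivAt_y (hvd p)).unique ?_
    have h1 := (hasDerivAt_yr (hχd p)).ofReal_comp
    have h2 := ((hh2 (p.2 + c)).comp_add_const p.2 c).ofReal_comp
    have h4 := h1.mul (h2.const_mul (ee (2 * π * ξ * p.1)))
    refine h4.congr_deriv ?_
    push_cast; ring
  have n1 : ∀ p, ‖-Complex.I * dX v p + (B * p.2 : ℝ) * v p‖ ^ 2 =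
      (dXr χ p ^ 2 + χ p ^ 2 * (B * (p.2 + c)) ^ 2) * hr |B| k (p.2 + c) ^ 2 := by
    intro p
    have : -Complex.I * dX v p + (B * p.2 : ℝ) * v p = (((χ p * (B * (p.2 + c)) : ℝ) : ℂ) + ((-dXr χ p : ℝ) : ℂ) * Complex.I) * wv B k ξ p := by
      rw [ex, mul_add B, hcB, hv]; push_cast
      linear_combination (-(χ p : ℂ) * (2 * π * ξ) * wv B k ξ p) * Complex.I_mul_I
    rw [this, norm_mul, mul_pow, wv_norm, ← Complex.normSq_eq_norm_sq, Complex.normSq_add_mul_I]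
    ring
  have n2 : ∀ p, ‖dY v p‖ ^ 2 = (dYr χ p * hr |B| k (p.2 + c) + χ p * deriv (hr |B| k) (p.2 + c)) ^ 2 := by
    intro p; rw [ey, norm_mul, ee_norm, Complex.norm_real, one_mul, Real.norm_eq_abs, sq_abs]
  set g : R2 → ℝ := fun p => 2 * χ p * dYr χ p * (hr |B| k (p.2 + c) * deriv (hr |B| k) (p.2 + c)) +
    χ p ^ 2 * (deriv (hr |B| k) (p.2 + c) ^ 2 + hr |B| k (p.2 + c) * ((|B| ^ 2 * (p.2 + c) ^ 2 - (2 * k + 1) * |B|) * hr |B| k (p.2 + c))) with hg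
  have gc : Continuous g := by rw [hg]; fun_prop
  have gs' : HasCompactSupport g := by
    refine HasCompactSupport.intro hs (fun p hp => ?_)
    simp [hg, image_eq_zero_of_notMem_tsupport hp]
  have hz : ∫ p, g p = 0 := by
    have fc : Continuous (fun p : R2 => χ p ^ 2 * (hr |B| k (p.2 + c) * deriv (hr |B| k) (p.2 + c))) := by fun_prop
    have fs : HasCompactSupport (fun p : R2 => χ p ^ 2 * (hr |B| k (p.2 + c) * deriv (hr |B| k) (p.2 + c))) := by
      refine HasCompactSupport.intro hs (fun p hp => ?_)
      simp [image_eq_zero_of_notMem_tsupport hp]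
    refine int_dy_zero fc gc fs gs' ?_
    intro p
    have h1 := (hasDerivAt_yr (hχd p))
    have h2 := ((hh2 (p.2 + c)).comp_add_const p.2 c)
    have h3 := ((hh3 (p.2 + c)).comp_add_const p.2 c)
    refine ((h1.pow 2).mul (h2.mul h3)).congr_deriv ?_
    rw [hg]; simp only [Pi.mul_apply, Pi.pow_apply]; push_cast; ring
  unfold q0
  have ir : Integrable (fun p => (dXr χ p ^ 2 + dYr χ p ^ 2 + (2 * k + 1) * |B| * χ p ^ 2) * hr |B| k (p.2 + c) ^ 2) := by
    refine Continuous.integrable_of_hasCompactSupport (by fun_prop) ?_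
    refine HasCompactSupport.intro ((hs.union (dXr_cpt hs)).union (dYr_cpt hs)) (fun p hp => ?_)
    simp only [Set.mem_union, not_or] at hp
    simp [image_eq_zero_of_notMem_tsupport hp.1.1, image_eq_zero_of_notMem_tsupport hp.1.2, image_eq_zero_of_notMem_tsupport hp.2]
  rw [← add_zero (∫ p, (dXr χ p ^ 2 + dYr χ p ^ 2 + (2 * k + 1) * |B| * χ p ^ 2) * hr |B| k (p.2 + c) ^ 2), ← hz,
    ← integral_add ir (gc.integrable_of_hasCompactSupport gs')]
  congr 1; ext p
  rw [n1, n2, hg]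
  simp only
  rw [sq_abs]; ring
end SP3b

section SPA
section abstractPart
variable {E H H' : Type*} [AddCommGroup E] [Module ℂ E] [NormedAddCommGroup H] [InnerProductSpace ℂ H]
  [NormedAddCommGroup H'] [InnerProductSpace ℂ H']

def FF (J : E →ₗ[ℂ] H) (T : E →ₗ[ℂ] H') (l : ℝ) (u : E) : ℝ := l * ‖J u‖ ^ 2 - ‖T u‖ ^ 2

lemma diag (J : E →ₗ[ℂ] H) (T : E →ₗ[ℂ] H') (hJ : Function.Injective J) (U : Submodule ℂ E) [FiniteDimensional ℂ U] :
    ∃ f : Fin (Module.finrank ℂ U) → E, Orthonormal ℂ (J ∘ f) ∧ (∀ i j, i ≠ j → inner ℂ (T (f i)) (T (f j)) = 0) ∧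
      ∀ u ∈ U, u = ∑ j, inner ℂ (J (f j)) (J u) • f j := by
  classical
  set Jr : U →ₗ[ℂ] H := J ∘ₗ U.subtype
  have hJr : Function.Injective Jr := hJ.comp Subtype.val_injective
  set eJ := LinearEquiv.ofInjective Jr hJr
  have heJ : ∀ u : U, ((eJ u : LinearMap.range Jr) : H) = J u := fun u => rfl
  set T' : LinearMap.range Jr →ₗ[ℂ] H' := T ∘ₗ U.subtype ∘ₗ eJ.symm.toLinearMap
  set T'' := T'.rangeRestrict
  have hT'' : ∀ u, ((T'' u : LinearMap.range T') : H') = T (eJ.symm u) := fun u => rfl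
  have hS : LinearMap.IsSymmetric (LinearMap.adjoint T'' ∘ₗ T'') := by
    intro x y
    simp [LinearMap.adjoint_inner_left, LinearMap.adjoint_inner_right]
  have hn : Module.finrank ℂ (LinearMap.range Jr) = Module.finrank ℂ U := eJ.finrank_eq.symm
  set b := hS.eigenvectorBasis hn
  have hJb : ∀ j, J (eJ.symm (b j)) = b j := by
    intro j; rw [← heJ]; simp
  refine ⟨fun j => eJ.symm (b j), ?_, ?_, ?_⟩
  · have : (J ∘ fun j => ((eJ.symm (b j) : U) : E)) = fun j => ((b j : LinearMap.range Jr) : H) := by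
      ext j; exact hJb j
    rw [this]
    exact b.orthonormal.comp_linearIsometry (LinearMap.range Jr).subtypeₗᵢ
  · intro i j hij
    rw [← hT'', ← hT'', ← Submodule.coe_inner, ← LinearMap.adjoint_inner_right]
    have : (LinearMap.adjoint T'') (T'' (b j)) = (hS.eigenvalues hn j : ℂ) • b j := hS.apply_eigenvectorBasis hn j
    rw [this, inner_smul_right, b.orthonormal.2 hij, mul_zero]
  · intro u hu
    have h1 := b.sum_repr' (eJ ⟨u, hu⟩)
    have h2 := congrArg (fun x => ((eJ.symm x : U) : E)) h1
    simp only [map_sum, map_smul, LinearEquiv.symm_apply_apply] at h2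
    rw [Submodule.coe_sum] at h2
    refine h2.symm.trans (Finset.sum_congr rfl fun j _ => ?_)
    rw [hJb, Submodule.coe_smul, Submodule.coe_inner]; rfl

variable {J : E →ₗ[ℂ] H} {T : E →ₗ[ℂ] H'}

lemma norm_sum_orth {ι : Type*} [Fintype ι] {g : ι → H'} (h : ∀ i j, i ≠ j → inner ℂ (g i) (g j) = 0) (c : ι → ℂ) :
    ‖∑ i, c i • g i‖ ^ 2 = ∑ i, ‖c i‖ ^ 2 * ‖g i‖ ^ 2 := by
  classical
  rw [← inner_self_eq_norm_sq (𝕜 := ℂ), sum_inner]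
  simp_rw [inner_sum]
  rw [map_sum]
  refine Finset.sum_congr rfl fun i _ => ?_
  rw [Finset.sum_eq_single i]
  · rw [inner_self_eq_norm_sq (𝕜 := ℂ), norm_smul, mul_pow]
  · intro j _ hj
    rw [inner_smul_left, inner_smul_right, h i j hj.symm]; simp
  · simp

lemma FF_sum {ι : Type*} [Fintype ι] {f : ι → E} (h1 : Orthonormal ℂ (J ∘ f))
    (h2 : ∀ i j, i ≠ j → inner ℂ (T (f i)) (T (f j)) = 0) (l : ℝ) (c : ι → ℂ) :
    FF J T l (∑ i, c i • f i) = ∑ i, FF J T l (f i) * ‖c i‖ ^ 2 := by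
  unfold FF
  rw [map_sum, map_sum]
  simp_rw [map_smul]
  rw [norm_sum_orth h2, norm_sum_orth (g := fun i => J (f i)) (fun i j hij => h1.2 hij), Finset.mul_sum, ← Finset.sum_sub_distrib]
  refine Finset.sum_congr rfl fun i _ => by ring

lemma sum_le_pos {ι κ : Type*} [Fintype ι] [Fintype κ] {f : ι → E} (h1 : Orthonormal ℂ (J ∘ f))
    (h2 : ∀ i j, i ≠ j → inner ℂ (T (f i)) (T (f j)) = 0) (l : ℝ) {e : κ → E} (he : Orthonormal ℂ (J ∘ e))
    (hs : ∀ k, e k = ∑ j, inner ℂ (J (f j)) (J (e k)) • f j) :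
    ∑ k, FF J T l (e k) ≤ ∑ j, max (FF J T l (f j)) 0 := by
  have : ∀ k, FF J T l (e k) = ∑ j, FF J T l (f j) * ‖(inner ℂ (J (f j)) (J (e k)) : ℂ)‖ ^ 2 := by
    intro k; conv_lhs => rw [hs k]
    exact FF_sum h1 h2 l _
  simp_rw [this]
  rw [Finset.sum_comm]
  refine Finset.sum_le_sum fun j _ => ?_
  rw [← Finset.mul_sum]
  have hb : ∑ k, ‖(inner ℂ (J (f j)) (J (e k)) : ℂ)‖ ^ 2 ≤ 1 := by
    have := he.sum_inner_products_le (J (f j)) (s := Finset.univ)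
    have h3 : ‖J (f j)‖ = 1 := h1.1 j
    rw [h3] at this
    simp_rw [Function.comp_apply, norm_inner_symm] at this
    rw [one_pow] at this
    refine le_trans (le_of_eq ?_) this
    exact Finset.sum_congr rfl fun k _ => by rw [norm_inner_symm]
  have hb0 : 0 ≤ ∑ k, ‖(inner ℂ (J (f j)) (J (e k)) : ℂ)‖ ^ 2 := by positivity
  nlinarith [le_max_left (FF J T l (f j)) 0, le_max_right (FF J T l (f j)) 0, mul_le_mul_of_nonneg_right (le_max_left (FF J T l (f j)) 0) hb0]

def SB (J : E →ₗ[ℂ] H) (T : E →ₗ[ℂ] H') (l S : ℝ) : Prop :=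
  ∀ (n : ℕ) (e : Fin n → E), Orthonormal ℂ (J ∘ e) → ∑ k, FF J T l (e k) ≤ S

lemma SB.app {l S : ℝ} (h : SB J T l S) {ι : Type*} [Fintype ι] {e : ι → E} (he : Orthonormal ℂ (J ∘ e)) :
    ∑ k, FF J T l (e k) ≤ S := by
  have := h _ (e ∘ (Fintype.equivFin ι).symm) (he.comp _ (Fintype.equivFin ι).symm.injective)
  refine le_trans (le_of_eq ?_) this
  exact ((Fintype.equivFin ι).symm.sum_comp (fun k => FF J T l (e k))).symm

lemma FF_add (l h : ℝ) {f : E} (hf : ‖J f‖ = 1) : FF J T (l + h) f = FF J T l f + h := by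
  unfold FF; rw [hf]; ring

lemma sum_max_subtype {ι : Type*} [Fintype ι] (F : ι → ℝ) :
    ∑ j, max (F j) 0 = ∑ j : {j // 0 < F j}, F j := by
  classical
  rw [← Finset.sum_subtype (Finset.univ.filter fun j => 0 < F j) (by simp) F, Finset.sum_filter]
  refine Finset.sum_congr rfl fun j _ => ?_
  split_ifs with h
  · exact max_eq_left h.le
  · exact max_eq_right (not_lt.1 h)

lemma N_upper (hJ : Function.Injective J) {l h S S' : ℝ} (hh : 0 ≤ h) (hS : SB J T (l + h) S) {n : ℕ} {e : Fin n → E} (he : Orthonormal ℂ (J ∘ e))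
    (heS : S' ≤ ∑ k, FF J T l (e k)) (V : Submodule ℂ E) [FiniteDimensional ℂ V] (hV : ∀ u ∈ V, u ≠ 0 → 0 < FF J T l u) :
    h * Module.finrank ℂ V ≤ S - S' := by
  classical
  set W := Submodule.span ℂ (Set.range e)
  have : FiniteDimensional ℂ W := FiniteDimensional.span_of_finite ℂ (Set.finite_range e)
  obtain ⟨f, f1, f2, f3⟩ := diag J T hJ (V ⊔ W)
  have h1 := sum_le_pos f1 f2 l he (fun k => f3 _ (Submodule.mem_sup_right (Submodule.subset_span ⟨k, rfl⟩)))
  rw [sum_max_subtype] at h1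
  set P := {j // 0 < FF J T l (f j)}
  have h2 := hS.app (ι := P) (e := fun j => f j.1) (f1.comp _ Subtype.val_injective)
  have h3 : ∀ j : P, FF J T (l + h) (f j.1) = FF J T l (f j.1) + h := fun j => FF_add l h (f1.1 j.1)
  simp_rw [h3] at h2
  rw [Finset.sum_add_distrib, Finset.sum_const, nsmul_eq_mul, Finset.card_univ] at h2
  have h4 : Module.finrank ℂ V ≤ Fintype.card P := by
    let L : V →ₗ[ℂ] (P → ℂ) := LinearMap.pi fun j => (innerSL ℂ (J (f j.1))).toLinearMap ∘ₗ J ∘ₗ V.subtype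
    have hL : Function.Injective L := by
      rw [← LinearMap.ker_eq_bot, LinearMap.ker_eq_bot']
      intro u hu
      by_contra hne
      have h5 := hV u u.2 (fun h => hne (Subtype.ext h))
      rw [f3 u (Submodule.mem_sup_left u.2), FF_sum f1 f2] at h5
      have : ∑ j, FF J T l (f j) * ‖(inner ℂ (J (f j)) (J u) : ℂ)‖ ^ 2 ≤ 0 := by
        refine Finset.sum_nonpos fun j _ => ?_
        by_cases hj : 0 < FF J T l (f j)
        · have : (inner ℂ (J (f j)) (J u) : ℂ) = 0 := congrFun hu ⟨j, hj⟩
          rw [this]; simp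
        · exact mul_nonpos_of_nonpos_of_nonneg (not_lt.1 hj) (by positivity)
      linarith
    have := LinearMap.finrank_le_finrank_of_injective hL
    simpa using this
  have h6 : h * Module.finrank ℂ V ≤ h * Fintype.card P := by gcongr
  linarith

lemma N_lower (hJ : Function.Injective J) {l h S S' : ℝ} (hS : SB J T (l - h) S) {n : ℕ} {e : Fin n → E} (he : Orthonormal ℂ (J ∘ e))
    (heS : S' ≤ ∑ k, FF J T l (e k)) : ∃ (m : ℕ) (f : Fin m → E), Orthonormal ℂ (J ∘ f) ∧
      (∀ i j, i ≠ j → inner ℂ (T (f i)) (T (f j)) = 0) ∧ (∀ j, 0 < FF J T l (f j)) ∧ S' - S ≤ h * m := by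
  classical
  set W := Submodule.span ℂ (Set.range e)
  have : FiniteDimensional ℂ W := FiniteDimensional.span_of_finite ℂ (Set.finite_range e)
  obtain ⟨f, f1, f2, f3⟩ := diag J T hJ W
  have h1 := sum_le_pos f1 f2 l he (fun k => f3 _ (Submodule.subset_span ⟨k, rfl⟩))
  rw [sum_max_subtype] at h1
  set P := {j // 0 < FF J T l (f j)}
  let g := (Fintype.equivFin P).symm
  refine ⟨Fintype.card P, fun j => f (g j).1, f1.comp _ (Subtype.val_injective.comp g.injective),
    fun i j hij => f2 _ _ (fun h => hij (g.injective (Subtype.ext h))), fun j => (g j).2, ?_⟩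
  have h2 := hS.app (ι := P) (e := fun j => f j.1) (f1.comp _ Subtype.val_injective)
  have h3 : ∀ j : P, FF J T (l - h) (f j.1) = FF J T l (f j.1) - h := fun j => by
    rw [sub_eq_add_neg, FF_add l (-h) (f1.1 j.1)]; ring
  simp_rw [h3] at h2
  rw [Finset.sum_sub_distrib, Finset.sum_const, nsmul_eq_mul, Finset.card_univ] at h2
  linarith

lemma FF_add_expand (l : ℝ) (u w : E) :
    FF J T l (u + w) = FF J T l u + FF J T l w + 2 * (l * (inner ℂ (J u) (J w)).re - (inner ℂ (T u) (T w)).re) := by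
  unfold FF
  rw [map_add, map_add, @norm_add_sq ℂ, @norm_add_sq ℂ]
  simp only [RCLike.re_to_complex]; ring

lemma FF_smul (l : ℝ) (c : ℂ) (u : E) : FF J T l (c • u) = ‖c‖ ^ 2 * FF J T l u := by
  unfold FF; rw [map_smul, map_smul, norm_smul, norm_smul]; ring

set_option maxHeartbeats 1600000 in
lemma nearmax (hJ : Function.Injective J) {l S S1 : ℝ} (hl : 0 ≤ l) (hS : SB J T l S) (hS1 : SB J T (l + 1) S1) {d : ℝ} (hd : 0 < d) :
    ∃ (m : ℕ) (f : Fin m → E), Orthonormal ℂ (J ∘ f) ∧ (∀ j, 0 < FF J T l (f j)) ∧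
      ∀ ψ, FF J T l ψ ≤ ∑ j, FF J T l (f j) * ‖(inner ℂ (J (f j)) (J ψ) : ℂ)‖ ^ 2 + d * (‖J ψ‖ ^ 2 + ‖T ψ‖ ^ 2) := by
  classical
  set X : Set ℝ := {x | ∃ (n : ℕ) (e : Fin n → E), Orthonormal ℂ (J ∘ e) ∧ x = ∑ k, FF J T l (e k)} with hX
  have hXb : BddAbove X := ⟨S, by rintro x ⟨n, e, he, rfl⟩; exact hS n e he⟩
  have hSB : SB J T l (sSup X) := fun n e he => le_csSup hXb ⟨n, e, he, rfl⟩
  have hXn : X.Nonempty := ⟨0, 0, Fin.elim0, by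
    refine ⟨⟨fun i => i.elim0, fun i => i.elim0⟩, by simp⟩⟩
  set M : ℝ := max S1 0 with hM
  obtain ⟨r, hr0, hr1, hr2⟩ : ∃ r : ℝ, 0 < r ∧ r ≤ 1 ∧ r * (M * (3 * l + 4) + 1) ≤ d := by
    have hp : 0 < M * (3 * l + 4) + 1 := by positivity
    refine ⟨min 1 (d / (M * (3 * l + 4) + 1)), by positivity, min_le_left _ _, ?_⟩
    calc _ ≤ d / (M * (3 * l + 4) + 1) * (M * (3 * l + 4) + 1) := by gcongr; exact min_le_right _ _
      _ = d := by field_simp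
  obtain ⟨x, ⟨n, e, he, rfl⟩, hxs⟩ := exists_lt_of_lt_csSup hXn (show sSup X - r ^ 2 < sSup X by linarith [pow_pos hr0 2])
  set W := Submodule.span ℂ (Set.range e)
  have : FiniteDimensional ℂ W := FiniteDimensional.span_of_finite ℂ (Set.finite_range e)
  obtain ⟨f0, f1, f2, f3⟩ := diag J T hJ W
  have h1 := sum_le_pos f1 f2 l he (fun k => f3 _ (Submodule.subset_span ⟨k, rfl⟩))
  rw [sum_max_subtype] at h1
  let g := (Fintype.equivFin {j // 0 < FF J T l (f0 j)}).symm
  obtain ⟨m, f, hf1, hf2, hf3, hf4⟩ : ∃ (m : ℕ) (f : Fin m → E), Orthonormal ℂ (J ∘ f) ∧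
      (∀ i j, i ≠ j → inner ℂ (T (f i)) (T (f j)) = 0) ∧ (∀ j, 0 < FF J T l (f j)) ∧ sSup X - r ^ 2 < ∑ j, FF J T l (f j) := by
    refine ⟨_, fun j => f0 (g j).1, f1.comp _ (Subtype.val_injective.comp g.injective),
      fun i j hij => f2 _ _ (fun h => hij (g.injective (Subtype.ext h))), fun j => (g j).2, ?_⟩
    rw [g.sum_comp (fun j => FF J T l (f0 j.1))]
    exact lt_of_lt_of_le hxs h1
  refine ⟨m, f, hf1, hf3, ?_⟩
  have hn1 : ∀ j, ‖J (f j)‖ = 1 := hf1.1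
  have hmM : (m : ℝ) ≤ M := by
    have h2 := hS1 m f hf1
    have : ∀ j, FF J T (l + 1) (f j) = FF J T l (f j) + 1 := fun j => FF_add l 1 (hn1 j)
    simp_rw [this, Finset.sum_add_distrib] at h2
    have h3 : 0 ≤ ∑ j, FF J T l (f j) := Finset.sum_nonneg fun j _ => (hf3 j).le
    simp at h2
    exact le_trans (by linarith) (le_max_left _ _)
  have hadd : ∀ w, (∀ j, inner ℂ (J (f j)) (J w) = 0) → FF J T l w ≤ r ^ 2 * ‖J w‖ ^ 2 := by
    intro w hw
    by_cases h0 : J w = 0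
    · have : w = 0 := hJ (by rw [h0, map_zero])
      subst this; simp [FF]
    have hnw : 0 < ‖J w‖ := norm_pos_iff.2 h0
    have hw' : ∀ j, inner ℂ (J w) (J (f j)) = 0 := fun j => by rw [← inner_conj_symm, hw j, map_zero]
    let e' : Option (Fin m) → E := fun o => o.elim (((‖J w‖ : ℂ)⁻¹) • w) f
    have he' : Orthonormal ℂ (J ∘ e') := by
      refine ⟨?_, ?_⟩
      · rintro (_ | j)
        · simp [e', norm_smul, hnw.ne']
        · exact hn1 j
      · rintro (_ | i) (_ | j) hij
        · exact absurd rfl hij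
        · simp [e', inner_smul_left, hw' j]
        · simp [e', inner_smul_right, hw i]
        · exact hf1.2 (fun h => hij (by rw [h]))
    have h2 := hSB.app he'
    rw [Fintype.sum_option] at h2
    simp only [e', Option.elim] at h2
    rw [FF_smul, norm_inv, Complex.norm_real, norm_norm] at h2
    have h3 : (‖J w‖⁻¹) ^ 2 * FF J T l w ≤ r ^ 2 := by linarith
    rw [inv_pow, inv_mul_le_iff₀ (by positivity)] at h3
    linarith
  have hrep : ∀ j w, (∀ i, i ≠ j → inner ℂ (J (f i)) (J w) = 0) → FF J T l w ≤ (FF J T l (f j) + r ^ 2) * ‖J w‖ ^ 2 := by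
    intro j w hw
    by_cases h0 : J w = 0
    · have : w = 0 := hJ (by rw [h0, map_zero])
      subst this; simp [FF]
    have hnw : 0 < ‖J w‖ := norm_pos_iff.2 h0
    have hw' : ∀ i, i ≠ j → inner ℂ (J w) (J (f i)) = 0 := fun i hi => by rw [← inner_conj_symm, hw i hi, map_zero]
    let e' : Fin m → E := Function.update f j (((‖J w‖ : ℂ)⁻¹) • w)
    have he' : Orthonormal ℂ (J ∘ e') := by
      refine ⟨fun i => ?_, fun i k hik => ?_⟩
      · by_cases hi : i = j
        · subst hi; simp [e', norm_smul, hnw.ne']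
        · simp [e', hi, hn1]
      · by_cases hi : i = j
        · subst hi
          simp [e', inner_smul_left, Ne.symm hik, hw' k (Ne.symm hik)]
        · by_cases hk : k = j
          · subst hk; simp [e', hi, inner_smul_right, hw i hi]
          · simpa [e', hi, hk] using hf1.2 hik
    have h2 := hSB.app he'
    rw [← Finset.add_sum_erase _ _ (Finset.mem_univ j)] at h2 hf4
    have h4 : ∑ k ∈ Finset.univ.erase j, FF J T l (e' k) = ∑ k ∈ Finset.univ.erase j, FF J T l (f k) := by
      refine Finset.sum_congr rfl fun k hk => ?_
      simp [e', Finset.ne_of_mem_erase hk]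
    rw [h4] at h2
    simp only [e', Function.update_self] at h2
    rw [FF_smul, norm_inv, Complex.norm_real, norm_norm] at h2
    have h3 : (‖J w‖⁻¹) ^ 2 * FF J T l w ≤ FF J T l (f j) + r ^ 2 := by linarith
    rw [inv_pow, inv_mul_le_iff₀ (by positivity)] at h3
    linarith
  intro ψ
  set c : Fin m → ℂ := fun j => inner ℂ (J (f j)) (J ψ) with hc
  set u := ∑ j, c j • f j with hu
  set w := ψ - u with hw
  have hψ : ψ = u + w := by rw [hw]; abel
  have hperp : ∀ j, inner ℂ (J (f j)) (J w) = 0 := by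
    intro j
    rw [hw, map_sub, inner_sub_right, hu, map_sum]
    simp_rw [map_smul]
    have := hf1.inner_right_fintype c j
    simp only [Function.comp_apply] at this
    rw [this]; simp [hc]
  have hFu : FF J T l u = ∑ j, FF J T l (f j) * ‖c j‖ ^ 2 := FF_sum hf1 hf2 l c
  have hnu : ‖J u‖ ^ 2 = ∑ j, ‖c j‖ ^ 2 := by
    rw [hu, map_sum]; simp_rw [map_smul]
    rw [norm_sum_orth (g := fun i => J (f i)) (fun i j hij => hf1.2 hij)]
    simp [hn1]
  have hJuw : inner ℂ (J u) (J w) = 0 := by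
    rw [hu, map_sum, sum_inner]
    refine Finset.sum_eq_zero fun j _ => ?_
    rw [map_smul, inner_smul_left, hperp j, mul_zero]
  have hpyth : ‖J ψ‖ ^ 2 = ‖J u‖ ^ 2 + ‖J w‖ ^ 2 := by
    rw [hψ, map_add, @norm_add_sq ℂ, hJuw]; simp
  have hFu0 : 0 ≤ FF J T l u := by rw [hFu]; exact Finset.sum_nonneg fun j _ => mul_nonneg (hf3 j).le (by positivity)
  have hTu : ‖T u‖ ^ 2 ≤ l * ‖J u‖ ^ 2 := by unfold FF at hFu0; linarith
  have hTw : ‖T w‖ ^ 2 ≤ 2 * ‖T ψ‖ ^ 2 + 2 * ‖T u‖ ^ 2 := by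
    rw [hw, map_sub]
    have := norm_sub_le (T ψ) (T u)
    linarith [pow_le_pow_left₀ (norm_nonneg _) this 2, sq_nonneg (‖T ψ‖ - ‖T u‖)]
  have hcross : ∀ j, -2 * (inner ℂ (T (c j • f j)) (T w)).re ≤ r * (‖c j‖ ^ 2 + (l + 1) * ‖J w‖ ^ 2 + ‖T w‖ ^ 2) := by
    intro j
    have h2 := hrep j (c j • f j + (r : ℂ) • w) (fun i hi => by
      rw [map_add, map_smul, map_smul, inner_add_right, inner_smul_right, inner_smul_right, hperp i, show inner ℂ (J (f i)) (J (f j)) = 0 from hf1.2 hi]; simp)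
    have h3 : inner ℂ (J (c j • f j)) (J ((r : ℂ) • w)) = 0 := by
      rw [map_smul, map_smul, inner_smul_left, inner_smul_right, hperp j]; simp
    have h4 : ‖J (c j • f j + (r : ℂ) • w)‖ ^ 2 = ‖c j‖ ^ 2 + r ^ 2 * ‖J w‖ ^ 2 := by
      rw [map_add, @norm_add_sq ℂ, h3, map_smul, map_smul, norm_smul, norm_smul, hn1]
      simp [mul_pow]
    rw [FF_add_expand, FF_smul, FF_smul, h3, h4] at h2
    have h5 : (inner ℂ (T (c j • f j)) (T ((r : ℂ) • w))).re = r * (inner ℂ (T (c j • f j)) (T w)).re := by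
      rw [map_smul T (r : ℂ), inner_smul_right, Complex.re_ofReal_mul]
    rw [h5] at h2
    simp only [Complex.norm_real, Complex.zero_re, Real.norm_eq_abs, sq_abs] at h2
    have hfl : FF J T l (f j) ≤ l := by unfold FF; rw [hn1]; linarith [sq_nonneg ‖T (f j)‖]
    have hFw : -‖T w‖ ^ 2 ≤ FF J T l w := by unfold FF; linarith [mul_nonneg hl (sq_nonneg ‖J w‖)]
    have h6 : r * (-2 * (inner ℂ (T (c j • f j)) (T w)).re) ≤ r * (r * (‖c j‖ ^ 2 + (l + 1) * ‖J w‖ ^ 2 + ‖T w‖ ^ 2)) := by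
      have h7 : (FF J T l (f j) + r ^ 2) * (r ^ 2 * ‖J w‖ ^ 2) ≤ (l + 1) * (r ^ 2 * ‖J w‖ ^ 2) := by
        gcongr; linarith [pow_le_one₀ hr0.le hr1 (n := 2)]
      have h8 : r ^ 2 * (-‖T w‖ ^ 2) ≤ r ^ 2 * FF J T l w := by gcongr
      linarith
    exact le_of_mul_le_mul_left h6 hr0
  have hTsum : (inner ℂ (T u) (T w)).re = ∑ j, (inner ℂ (T (c j • f j)) (T w)).re := by
    rw [hu, map_sum, sum_inner, Complex.re_sum]
  have hsum := Finset.sum_le_sum (s := Finset.univ) fun j _ => hcross j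
  rw [← Finset.mul_sum, ← hTsum, ← Finset.mul_sum, Finset.sum_add_distrib, Finset.sum_add_distrib, ← hnu] at hsum
  simp only [Finset.sum_const, Finset.card_univ, Fintype.card_fin, nsmul_eq_mul] at hsum
  rw [hψ, FF_add_expand, hFu, hJuw, ← hψ]
  have hw2 := hadd w hperp
  simp only [Complex.zero_re]
  have hJu0 := sq_nonneg ‖J u‖
  have hJw0 := sq_nonneg ‖J w‖
  have hTw0 := sq_nonneg ‖T w‖
  have hT0 := sq_nonneg ‖T ψ‖
  have k1 : (l + 1) * ‖J w‖ ^ 2 + ‖T w‖ ^ 2 ≤ (3 * l + 3) * (‖J ψ‖ ^ 2 + ‖T ψ‖ ^ 2) := by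
    rw [hpyth]; linarith [mul_nonneg hl hJu0, mul_nonneg hl hJw0, mul_nonneg hl hT0]
  have hM0 : 0 ≤ M := le_max_right _ _
  set Q := ‖J ψ‖ ^ 2 + ‖T ψ‖ ^ 2 with hQ
  have hQ0 : 0 ≤ Q := by positivity
  by_cases hm : m = 0
  · subst hm
    have hu0 : u = 0 := by rw [hu]; simp
    have : r ^ 2 * ‖J w‖ ^ 2 ≤ d * Q := by
      have : r ^ 2 ≤ d := by nlinarith [mul_nonneg hM0 (by positivity : 0 ≤ 3 * l + 4)]
      have : ‖J w‖ ^ 2 ≤ Q := by rw [hQ, hpyth]; linarith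
      gcongr
    rw [hu0]; simp; linarith
  have hm1 : (1 : ℝ) ≤ m := by exact_mod_cast Nat.one_le_iff_ne_zero.2 hm
  have k2 : ‖J u‖ ^ 2 + (m * ((l + 1) * ‖J w‖ ^ 2) + m * ‖T w‖ ^ 2) ≤ M * (3 * l + 4) * Q := by
    have : ‖J u‖ ^ 2 ≤ Q := by rw [hQ, hpyth]; linarith
    have a1 : ‖J u‖ ^ 2 ≤ m * Q := by nlinarith
    have a2 : m * ((l + 1) * ‖J w‖ ^ 2 + ‖T w‖ ^ 2) ≤ m * ((3 * l + 3) * Q) := by gcongr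
    have a3 : m * ((3 * l + 4) * Q) ≤ M * ((3 * l + 4) * Q) := by gcongr
    linarith
  have k3 : r ^ 2 * ‖J w‖ ^ 2 ≤ r * Q := by
    have : r ^ 2 ≤ r := by nlinarith
    have : ‖J w‖ ^ 2 ≤ Q := by rw [hQ, hpyth]; linarith
    gcongr
  have k4 : r * (M * (3 * l + 4) + 1) * Q ≤ d * Q := by gcongr
  have k5 : r * (‖J u‖ ^ 2 + (m * ((l + 1) * ‖J w‖ ^ 2) + m * ‖T w‖ ^ 2)) ≤ r * (M * (3 * l + 4) * Q) := by gcongr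
  linarith

lemma dense_family {l : ℝ} (hl : 0 ≤ l) {m : ℕ} {f : Fin m → E} (hf1 : Orthonormal ℂ (J ∘ f))
    (hf2 : ∀ i j, i ≠ j → inner ℂ (T (f i)) (T (f j)) = 0) (hf3 : ∀ j, 0 < FF J T l (f j))
    (D : Submodule ℂ E) (hD : ∀ (f : E) (ε : ℝ), 0 < ε → ∃ g ∈ D, ‖J (g - f)‖ ≤ ε ∧ ‖T (g - f)‖ ≤ ε) :
    ∃ V : Submodule ℂ E, V ≤ D ∧ Module.finrank ℂ V = m ∧ ∀ u ∈ V, u ≠ 0 → 0 < FF J T l u := by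
  classical
  obtain ⟨F0, hF0, hF⟩ : ∃ F0 : ℝ, 0 < F0 ∧ ∀ j, F0 ≤ FF J T l (f j) := by
    cases isEmpty_or_nonempty (Fin m) with
    | inl h => exact ⟨1, one_pos, fun j => h.elim j⟩
    | inr h =>
      obtain ⟨j0, hj⟩ := Finite.exists_min (fun j => FF J T l (f j))
      exact ⟨_, hf3 j0, hj⟩
  set ε : ℝ := min 1 (F0 / ((m + 1) * (4 * l + 4))) with hε
  have hε0 : 0 < ε := by positivity
  have hε1 : ε ≤ 1 := min_le_left _ _
  have hε2 : (m + 1) * (ε * (4 * l + 4)) ≤ F0 := by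
    calc _ = ε * ((m + 1) * (4 * l + 4)) := by ring
      _ ≤ F0 / ((m + 1) * (4 * l + 4)) * ((m + 1) * (4 * l + 4)) := by gcongr; exact min_le_right _ _
      _ = F0 := by field_simp
  choose g hg1 hg2 hg3 using fun j => hD (f j) ε hε0
  have key : ∀ c : Fin m → ℂ, c ≠ 0 → 0 < FF J T l (∑ j, c j • g j) := by
    intro c hc
    set u0 := ∑ j, c j • f j with hu0
    set d := ∑ j, c j • (g j - f j) with hd
    have e : ∑ j, c j • g j = u0 + d := by
      rw [hu0, hd, ← Finset.sum_add_distrib]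
      refine Finset.sum_congr rfl fun j _ => ?_
      rw [← smul_add]; congr 1; abel
    set N := ∑ j, ‖c j‖ with hN
    have hN0 : 0 < N := by
      obtain ⟨j, hj⟩ := Function.ne_iff.1 hc
      exact Finset.sum_pos' (fun i _ => norm_nonneg _) ⟨j, Finset.mem_univ _, norm_pos_iff.2 hj⟩
    have hN2 : N ^ 2 ≤ m * ∑ j, ‖c j‖ ^ 2 := by
      have := sq_sum_le_card_mul_sum_sq (s := (Finset.univ : Finset (Fin m))) (f := fun j => ‖c j‖)
      simpa using this
    have hJd : ‖J d‖ ≤ ε * N := by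
      rw [hd, map_sum, hN, Finset.mul_sum]
      refine norm_sum_le_of_le _ fun j _ => ?_
      rw [map_smul, norm_smul, mul_comm]; gcongr; exact hg2 j
    have hTd : ‖T d‖ ≤ ε * N := by
      rw [hd, map_sum, hN, Finset.mul_sum]
      refine norm_sum_le_of_le _ fun j _ => ?_
      rw [map_smul, norm_smul, mul_comm]; gcongr; exact hg3 j
    have hJu : ‖J u0‖ ≤ N := by
      rw [hu0, map_sum, hN]
      refine norm_sum_le_of_le _ fun j _ => ?_
      rw [map_smul, norm_smul, show ‖J (f j)‖ = 1 from hf1.1 j, mul_one]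
    have hTf : ∀ j, ‖T (f j)‖ ≤ l + 1 := by
      intro j
      have h1 := hf3 j
      unfold FF at h1
      rw [show ‖J (f j)‖ = 1 from hf1.1 j] at h1
      nlinarith [norm_nonneg (T (f j))]
    have hTu : ‖T u0‖ ≤ (l + 1) * N := by
      rw [hu0, map_sum, hN, Finset.mul_sum]
      refine norm_sum_le_of_le _ fun j _ => ?_
      rw [map_smul, norm_smul, mul_comm]; gcongr; exact hTf j
    have hFu : F0 * (∑ j, ‖c j‖ ^ 2) ≤ FF J T l u0 := by
      rw [hu0, FF_sum hf1 hf2, Finset.mul_sum]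
      refine Finset.sum_le_sum fun j _ => ?_
      gcongr; exact hF j
    rw [e, FF_add_expand]
    have c1 : |(inner ℂ (J u0) (J d)).re| ≤ N * (ε * N) := (Complex.abs_re_le_norm _).trans ((norm_inner_le_norm _ _).trans (by gcongr))
    have c2 : |(inner ℂ (T u0) (T d)).re| ≤ (l + 1) * N * (ε * N) := (Complex.abs_re_le_norm _).trans ((norm_inner_le_norm _ _).trans (by gcongr))
    have c3 : -(ε * N) ^ 2 ≤ FF J T l d := by
      unfold FF
      have : ‖T d‖ ^ 2 ≤ (ε * N) ^ 2 := by gcongr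
      linarith [mul_nonneg hl (sq_nonneg ‖J d‖)]
    have c1' := (abs_le.1 c1).1
    have c2' := (abs_le.1 c2).2
    have c4 : (ε * N) ^ 2 ≤ ε * N ^ 2 := by nlinarith [mul_pos hε0 (pow_pos hN0 2)]
    have c5 : l * (-(N * (ε * N))) ≤ l * (inner ℂ (J u0) (J d)).re := by gcongr
    set s := ∑ j, ‖c j‖ ^ 2 with hs
    have hs0 : 0 < s := by
      by_contra h
      have : s ≤ 0 := not_lt.1 h
      have : (m : ℝ) * s ≤ 0 := mul_nonpos_of_nonneg_of_nonpos (by positivity) this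
      linarith [pow_pos hN0 2]
    have c6 : ε * (4 * l + 4) * N ^ 2 ≤ ε * (4 * l + 4) * (m * s) := by gcongr
    have c7 : (m + 1) * (ε * (4 * l + 4)) * s ≤ F0 * s := by gcongr
    have c8 : 0 < ε * (4 * l + 4) * s := by positivity
    linarith [mul_pos hε0 (pow_pos hN0 2)]
  have hli : LinearIndependent ℂ g := by
    rw [Fintype.linearIndependent_iff]
    intro c hc
    by_contra h
    have hc0 : c ≠ 0 := fun h0 => h (fun i => by rw [h0]; rfl)
    have := key c hc0
    rw [hc] at this
    simp [FF] at this
  refine ⟨Submodule.span ℂ (Set.range g), ?_, ?_, ?_⟩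
  · rw [Submodule.span_le]; rintro _ ⟨j, rfl⟩; exact hg1 j
  · rw [finrank_span_eq_card hli, Fintype.card_fin]
  · intro u hu hne
    obtain ⟨c, rfl⟩ := (Submodule.mem_span_range_iff_exists_fun ℂ).1 hu
    refine key c (fun h => hne ?_)
    simp [h]

end abstractPart
end SPA

section SP4
lemma UHP_open : IsOpen UHP := isOpen_lt continuous_const continuous_snd

lemma UHP_fd {n : WithTop ℕ∞} {a : R2 → ℝ} (ha : ContDiffOn ℝ n a UHP) (hn : 1 ≤ n) {p : R2} (hp : p ∈ UHP) :
    DifferentiableAt ℝ a p :=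
  (ha.differentiableOn (by rintro rfl; simp at hn)).differentiableAt (UHP_open.mem_nhds hp)

lemma dXr_con {a : R2 → ℝ} (ha : ContDiffOn ℝ 1 a UHP) : ContinuousOn (dXr a) UHP := by
  unfold dXr; exact (ha.continuousOn_fderiv_of_isOpen UHP_open le_rfl).clm_apply continuousOn_const
lemma dYr_con {a : R2 → ℝ} (ha : ContDiffOn ℝ 1 a UHP) : ContinuousOn (dYr a) UHP := by
  unfold dYr; exact (ha.continuousOn_fderiv_of_isOpen UHP_open le_rfl).clm_apply continuousOn_const

lemma clampc {a : R2 → ℝ} (ha : ContinuousOn a UHP) {δ : ℝ} (hδ : 0 < δ) :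
    Continuous (fun p : R2 => a (p.1, max p.2 δ)) := by
  refine ha.comp_continuous (by fun_prop) (fun p => ?_)
  exact lt_of_lt_of_le hδ (le_max_right _ _)

lemma slice_con {a : R2 → ℝ} (ha : ContinuousOn a UHP) {y : ℝ} (hy : 0 < y) :
    Continuous (fun x : ℝ => a (x, y)) :=
  ha.comp_continuous (by fun_prop) (fun _ => hy)

lemma c1_of_partials {f f1 f2 : R2 → ℝ} (h1 : ∀ p ∈ UHP, HasDerivAt (fun x => f (x, p.2)) (f1 p) p.1)
    (h2 : ∀ p ∈ UHP, HasDerivAt (fun y => f (p.1, y)) (f2 p) p.2) (c1 : ContinuousOn f1 UHP) (c2 : ContinuousOn f2 UHP) :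
    ContDiffOn ℝ 1 f UHP ∧ ∀ p ∈ UHP, dXr f p = f1 p ∧ dYr f p = f2 p := by
  have key : ∀ p ∈ UHP, HasFDerivAt f ((ContinuousLinearMap.toSpanSingleton ℝ (f1 p)).coprod
      (ContinuousLinearMap.toSpanSingleton ℝ (f2 p))) p := by
    intro p hp
    have hn := UHP_open.mem_nhds hp
    have := hasStrictFDerivAt_uncurry_coprod (𝕜 := ℝ) (u := p) (f := fun x y => f (x, y))
      (f₁ := fun x y => ContinuousLinearMap.toSpanSingleton ℝ (f1 (x, y)))
      (f₂ := fun x y => ContinuousLinearMap.toSpanSingleton ℝ (f2 (x, y)))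
      (by filter_upwards [hn] with v hv using (h1 v hv).hasFDerivAt)
      (by filter_upwards [hn] with v hv using (h2 v hv).hasFDerivAt)
      (by
        have := c1.continuousAt hn
        exact (ContinuousLinearMap.toSpanSingletonCLE (𝕜 := ℝ) (E := ℝ)).continuous.continuousAt.comp this)
      (by
        have := c2.continuousAt hn
        exact (ContinuousLinearMap.toSpanSingletonCLE (𝕜 := ℝ) (E := ℝ)).continuous.continuousAt.comp this)
    exact this.hasFDerivAt
  constructor
  · have h0 : ContDiffOn ℝ (0 + 1) f UHP := by
      rw [contDiffOn_succ_iff_fderiv_of_isOpen UHP_open]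
      refine ⟨fun p hp => (key p hp).differentiableAt.differentiableWithinAt, by simp, ?_⟩
      rw [contDiffOn_zero]
      have : ContinuousOn (fun p => (ContinuousLinearMap.toSpanSingleton ℝ (f1 p)).coprod
        (ContinuousLinearMap.toSpanSingleton ℝ (f2 p))) UHP := by
        have e : (fun p => (ContinuousLinearMap.toSpanSingleton ℝ (f1 p)).coprod
          (ContinuousLinearMap.toSpanSingleton ℝ (f2 p))) =
          fun p => f1 p • ContinuousLinearMap.fst ℝ ℝ ℝ + f2 p • ContinuousLinearMap.snd ℝ ℝ ℝ := by
          ext p <;> simp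
        rw [e]; fun_prop
      exact this.congr (fun p hp => (key p hp).fderiv)
    simpa using h0
  · intro p hp
    unfold dXr dYr
    rw [(key p hp).fderiv]; simp

lemma pot {a : R2 → ℝ} (ha : ContDiffOn ℝ 1 a UHP) (s : ℝ) {p : R2} (hp : p ∈ UHP) :
    HasDerivAt (fun y => ∫ x in s..p.1, a (x, y)) (∫ x in s..p.1, dYr a (x, p.2)) p.2 := by
  have hp' : 0 < p.2 := hp
  have hc := dYr_con ha
  have hK : IsCompact (Set.uIcc s p.1 ×ˢ Metric.closedBall p.2 (p.2/2)) :=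
    isCompact_uIcc.prod (isCompact_closedBall _ _)
  have hpos : ∀ y ∈ Metric.closedBall p.2 (p.2/2), 0 < y := by
    intro y hy
    rw [Metric.mem_closedBall, Real.dist_eq, abs_le] at hy
    linarith [hy.1]
  obtain ⟨M, hM⟩ := hK.exists_bound_of_continuousOn (hc.mono (fun q hq => hpos _ hq.2))
  refine (intervalIntegral.hasDerivAt_integral_of_dominated_loc_of_deriv_le (bound := fun _ => M)
    (F := fun y x => a (x, y)) (F' := fun y x => dYr a (x, y))
    (Metric.closedBall_mem_nhds p.2 (half_pos hp')) ?_ ?_ ?_ ?_ ?_ ?_).2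
  · filter_upwards [lt_mem_nhds hp'] with y hy
    exact (slice_con ha.continuousOn hy).aestronglyMeasurable
  · exact (slice_con ha.continuousOn hp').intervalIntegrable _ _
  · exact (slice_con hc hp').aestronglyMeasurable
  · exact Eventually.of_forall fun x hx y hy => hM (x, y) ⟨Set.uIoc_subset_uIcc hx, hy⟩
  · exact intervalIntegrable_const
  · exact Eventually.of_forall fun x hx y hy => hasDerivAt_yr (p := (x, y)) (UHP_fd ha le_rfl (hpos y hy))

lemma gauge_ex {A1 A2 : R2 → ℝ} (h1 : ContDiffOn ℝ 2 A1 UHP) (h2 : ContDiffOn ℝ 2 A2 UHP) (s : ℝ) (B : ℝ) :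
    ∃ φ : R2 → ℝ, ContDiffOn ℝ 1 φ UHP ∧ ∀ p ∈ UHP, dXr φ p = A1 p + B * p.2 ∧
      ∀ M, (∀ x ∈ Set.uIcc s p.1, |dXr A2 (x, p.2) - dYr A1 (x, p.2) - B| ≤ M) →
        |A2 p - dYr φ p| ≤ M * |p.1 - s| := by
  have h1' : ContDiffOn ℝ 1 A1 UHP := h1.of_le (by norm_num)
  have h2' : ContDiffOn ℝ 1 A2 UHP := h2.of_le (by norm_num)
  have ha : ContDiffOn ℝ 1 (fun p : R2 => A1 p + B * p.2) UHP := h1'.add (by fun_prop)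
  set a : R2 → ℝ := fun p => A1 p + B * p.2 with had
  have hay : ∀ p ∈ UHP, dYr a p = dYr A1 p + B := by
    intro p hp
    have e1 := hasDerivAt_yr (UHP_fd ha le_rfl hp)
    have e2 := (hasDerivAt_yr (UHP_fd h1' le_rfl hp)).add ((hasDerivAt_id p.2).const_mul B)
    have := e1.unique e2
    simpa using this
  have key := c1_of_partials (f := fun p => (∫ y in (1:ℝ)..p.2, A2 (s, y)) + ∫ x in s..p.1, a (x, p.2))
    (f1 := a) (f2 := fun p => A2 (s, p.2) + ∫ x in s..p.1, dYr a (x, p.2)) ?_ ?_ ha.continuousOn ?_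
  · refine ⟨_, key.1, fun p hp => ⟨(key.2 p hp).1, fun M hM => ?_⟩⟩
    rw [(key.2 p hp).2]
    have hp' : 0 < p.2 := hp
    have e3 : ∫ x in s..p.1, dXr A2 (x, p.2) = A2 p - A2 (s, p.2) := by
      have := intervalIntegral.integral_eq_sub_of_hasDerivAt (f := fun x => A2 (x, p.2)) (f' := fun x => dXr A2 (x, p.2))
        (a := s) (b := p.1) (fun x _ => hasDerivAt_xr (p := (x, p.2)) (UHP_fd h2' le_rfl hp'))
        ((slice_con (dXr_con h2') hp').intervalIntegrable _ _)
      exact this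
    have e4 : A2 p - (A2 (s, p.2) + ∫ x in s..p.1, dYr a (x, p.2)) =
        ∫ x in s..p.1, (dXr A2 (x, p.2) - dYr a (x, p.2)) := by
      rw [intervalIntegral.integral_sub ((slice_con (dXr_con h2') hp').intervalIntegrable _ _)
        ((slice_con (dYr_con ha) hp').intervalIntegrable _ _), e3]; ring
    rw [e4]
    rw [← Real.norm_eq_abs]
    refine intervalIntegral.norm_integral_le_of_norm_le_const (fun x hx => ?_)
    have := hM x (Set.uIoc_subset_uIcc hx)
    rw [hay _ (show (x, p.2) ∈ UHP from hp'), Real.norm_eq_abs, ← sub_sub]; exact this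
  · intro p hp
    have hp' : 0 < p.2 := hp
    have := ((slice_con ha.continuousOn hp').integral_hasStrictDerivAt s p.1).hasDerivAt
    exact this.const_add (∫ y in (1:ℝ)..p.2, A2 (s, y))
  · intro p hp
    refine HasDerivAt.add ?_ (pot ha s hp)
    have hp' : 0 < p.2 := hp
    have hpos : ∀ y ∈ Set.uIcc 1 p.2, 0 < y := fun y hy => lt_of_lt_of_le (lt_min one_pos hp') hy.1
    have hc : ContinuousOn (fun y => A2 (s, y)) (Set.Ioi 0) :=
      h2.continuousOn.comp (by fun_prop) (fun y hy => hy)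
    refine intervalIntegral.integral_hasDerivAt_right ?_ ?_ ?_
    · exact (hc.mono (fun y hy => hpos y hy)).intervalIntegrable
    · exact hc.stronglyMeasurableAtFilter isOpen_Ioi _ hp'
    · exact hc.continuousAt (Ioi_mem_nhds hp')
  · have hc : ContinuousOn (fun p : R2 => A2 (s, p.2)) UHP :=
      h2.continuousOn.comp (by fun_prop) (fun y hy => hy)
    refine hc.add ?_
    intro p hp
    have hp' : 0 < p.2 := hp
    have hcc := clampc (dYr_con ha) (half_pos hp')
    have := intervalIntegral.continuous_parametric_intervalIntegral_of_continuous (a₀ := s) (μ := volume)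
      (f := fun (q : R2) x => dYr a (x, max q.2 (p.2/2)))
      (by exact hcc.comp (g := fun p : R2 => dYr a (p.1, max p.2 _)) (f := fun r : (R2) × ℝ => (r.2, r.1.2)) (by fun_prop)) continuous_fst
    refine (this.continuousAt.congr ?_).continuousWithinAt
    have : ∀ᶠ q : R2 in nhds p, p.2 / 2 < q.2 := continuous_snd.continuousAt.eventually (lt_mem_nhds (half_lt_self hp'))
    filter_upwards [this] with q hq
    simp only [max_eq_left hq.le]
end SP4

section SP4b
def bx (s t ε : ℝ) : Set (R2) := Set.Icc (s - ε * t) (s + ε * t) ×ˢ Set.Icc (t * exp (-ε)) (t * exp ε)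

lemma bx_sub {s t ε : ℝ} (ht : 0 < t) : bx s t ε ⊆ UHP := fun _ hp => lt_of_lt_of_le (by positivity) hp.2.1

lemma bx_mem {s t ε : ℝ} (ht : 0 < t) (hε : 0 ≤ ε) : (s, t) ∈ bx s t ε := by
  have h1 : exp (-ε) ≤ 1 := by rw [exp_le_one_iff]; linarith
  have h2 : 1 ≤ exp ε := one_le_exp hε
  exact ⟨⟨by dsimp; nlinarith, by dsimp; nlinarith⟩, ⟨by dsimp; nlinarith, by dsimp; nlinarith⟩⟩

lemma fieldB_cd {A1 A2 : R2 → ℝ} (h1 : ContDiffOn ℝ 2 A1 UHP) (h2 : ContDiffOn ℝ 2 A2 UHP) :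
    ContDiffOn ℝ 1 (fieldB A1 A2) UHP := by
  have e1 := (h1.fderiv_of_isOpen (m := 1) UHP_open (by norm_num)).clm_apply (contDiffOn_const (c := ((0:ℝ), (1:ℝ))))
  have e2 := (h2.fderiv_of_isOpen (m := 1) UHP_open (by norm_num)).clm_apply (contDiffOn_const (c := ((1:ℝ), (0:ℝ))))
  unfold fieldB dXr dYr
  exact ContDiffOn.mul (by fun_prop) (e2.sub e1)

lemma exp_sub_one_le {x : ℝ} (h0 : 0 ≤ x) (h1 : x ≤ 1) : exp x - 1 ≤ 2 * x := by
  have := abs_exp_sub_one_le (x := x) (by rw [abs_of_nonneg h0]; exact h1)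
  rw [abs_of_nonneg h0] at this
  exact (le_abs_self _).trans this

lemma sinh_lip {a c D : ℝ} (hD0 : 0 ≤ D) (hD : D ≤ 1) (h : |c - a| ≤ D) : |sinh c - sinh a| ≤ 2 * D * (|sinh a| + 1) := by
  have e : sinh c = sinh a * cosh (c - a) + cosh a * sinh (c - a) := by
    rw [← sinh_add]; congr 1; ring
  have h1 : cosh (c - a) ≤ cosh D := by
    rw [cosh_le_cosh, abs_of_nonneg hD0]; exact h
  have h2 : |sinh (c - a)| ≤ sinh D := by
    rw [abs_sinh]; exact sinh_le_sinh.2 h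
  have h3 : cosh a ≤ |sinh a| + 1 := by
    refine (pow_le_pow_iff_left₀ (cosh_pos a).le (by positivity) two_ne_zero).1 ?_
    rw [cosh_sq]; nlinarith [abs_nonneg (sinh a), sq_abs (sinh a)]
  have h4 : cosh D + sinh D = exp D := cosh_add_sinh D
  have h5 := exp_sub_one_le hD0 hD
  have h6 := one_le_cosh (c - a)
  have h7 : |sinh c - sinh a| ≤ |sinh a| * (cosh (c - a) - 1) + cosh a * |sinh (c - a)| := by
    have : sinh c - sinh a = sinh a * (cosh (c - a) - 1) + cosh a * sinh (c - a) := by rw [e]; ring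
    rw [this]
    refine (abs_add_le _ _).trans ?_
    rw [abs_mul, abs_mul, abs_of_nonneg (sub_nonneg.2 h6), abs_of_pos (cosh_pos a)]
  have h8 := abs_nonneg (sinh a)
  have h9 : cosh a * |sinh (c - a)| ≤ (|sinh a| + 1) * sinh D := by gcongr
  have h10 : |sinh a| * (cosh (c - a) - 1) ≤ (|sinh a| + 1) * (cosh D - 1) := by gcongr; linarith
  nlinarith

def beta (A1 A2 : R2 → ℝ) (p : R2) : ℝ := max (intenB A1 A2 p) 1

lemma one_le_beta (A1 A2 : R2 → ℝ) (p : R2) : 1 ≤ beta A1 A2 p := le_max_right _ _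

lemma opnorm_le (L : R2 →L[ℝ] ℝ) : ‖L‖ ≤ |L (1, 0)| + |L (0, 1)| := by
  refine L.opNorm_le_bound (by positivity) (fun v => ?_)
  have : L v = v.1 * L (1, 0) + v.2 * L (0, 1) := by
    have : v = v.1 • ((1:ℝ), (0:ℝ)) + v.2 • ((0:ℝ), (1:ℝ)) := by ext <;> simp
    conv_lhs => rw [this]
    rw [map_add, map_smul, map_smul]; simp
  rw [this, Real.norm_eq_abs]
  refine (abs_add_le _ _).trans ?_
  rw [abs_mul, abs_mul]
  have h1 : |v.1| ≤ ‖v‖ := norm_fst_le v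
  have h2 : |v.2| ≤ ‖v‖ := norm_snd_le v
  nlinarith [abs_nonneg (L (1,0)), abs_nonneg (L (0,1))]

lemma locB {A1 A2 : R2 → ℝ} (h1 : ContDiffOn ℝ 2 A1 UHP) (h2 : ContDiffOn ℝ 2 A2 UHP) {C₀ : ℝ} (hC : 0 < C₀)
    (hH : H2 C₀ A1 A2) {s t ε : ℝ} (ht : 0 < t) (hε : 0 < ε) (hε1 : ε ≤ 1) (hεC : 24 * C₀ * ε ≤ 1) {p : R2} (hp : p ∈ bx s t ε) :
    |fieldB A1 A2 p - fieldB A1 A2 (s, t)| ≤ 96 * C₀ * ε * beta A1 A2 (s, t) := by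
  have hcd := fieldB_cd h1 h2
  set f := fieldB A1 A2 with hf
  have he : exp ε ≤ 3 := by linarith [exp_sub_one_le hε.le hε1]
  have key : ‖arsinh (f p) - arsinh (f (s, t))‖ ≤ (12 * C₀ / t) * ‖p - (s, t)‖ := by
    refine Convex.norm_image_sub_le_of_norm_hasFDerivWithin_le (s := bx s t ε) (f := fun q => arsinh (f q))
      (f' := fun q => (√(1 + f q ^ 2))⁻¹ • fderiv ℝ f q) ?_ ?_ ?_ (bx_mem ht hε.le) hp
    · intro q hq
      exact (UHP_fd hcd le_rfl (bx_sub ht hq)).hasFDerivAt.arsinh.hasFDerivWithinAt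
    · intro q hq
      have hq0 : 0 < q.2 := bx_sub ht hq
      have hH' := hH q hq0
      rw [norm_smul, Real.norm_eq_abs, abs_of_pos (by positivity)]
      have e1 := opnorm_le (fderiv ℝ f q)
      set S := √(dXr f q ^ 2 + dYr f q ^ 2)
      have e2 : |dXr f q| ≤ S := Real.abs_le_sqrt (by nlinarith [sq_nonneg (dYr f q)])
      have e3 : |dYr f q| ≤ S := Real.abs_le_sqrt (by nlinarith [sq_nonneg (dXr f q)])
      unfold dXr at e2; unfold dYr at e3
      have e4 : t / q.2 ≤ 3 := by
        rw [div_le_iff₀ hq0]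
        have := hq.2.1
        have e5 : t = t * exp (-ε) * exp ε := by rw [mul_assoc, ← exp_add]; simp
        nlinarith [exp_pos ε]
      have e6 : intenB A1 A2 q + 1 ≤ 2 * √(1 + f q ^ 2) := by
        have : |f q| ≤ √(1 + f q ^ 2) := Real.abs_le_sqrt (by linarith)
        have : 1 ≤ √(1 + f q ^ 2) := Real.one_le_sqrt.2 (by nlinarith [sq_nonneg (f q)])
        unfold intenB; linarith
      have e7 : S ≤ C₀ * (2 * √(1 + f q ^ 2)) / q.2 := by
        rw [le_div_iff₀ hq0, mul_comm]
        exact hH'.trans (by gcongr)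
      have hs : 0 < √(1 + f q ^ 2) := by positivity
      rw [inv_mul_le_iff₀ hs]
      calc ‖fderiv ℝ f q‖ ≤ 2 * S := by linarith
        _ ≤ 2 * (C₀ * (2 * √(1 + f q ^ 2)) / q.2) := by linarith
        _ = 4 * C₀ * √(1 + f q ^ 2) / t * (t / q.2) := by field_simp; ring
        _ ≤ 4 * C₀ * √(1 + f q ^ 2) / t * 3 := by gcongr
        _ = _ := by ring
    · exact (convex_Icc _ _).prod (convex_Icc _ _)
  have hn : ‖p - (s, t)‖ ≤ 2 * ε * t := by
    have q1 := hp.1.1; have q2 := hp.1.2; have q3 := hp.2.1; have q4 := hp.2.2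
    rw [Prod.norm_def]
    refine max_le ?_ ?_
    · rw [Real.norm_eq_abs, abs_le]; constructor <;> simp <;> nlinarith
    · have q5 := exp_sub_one_le hε.le hε1
      have q6 : 1 - ε ≤ exp (-ε) := by have := add_one_le_exp (-ε); linarith
      rw [Real.norm_eq_abs, abs_le]; constructor <;> simp <;> nlinarith
  have hD : |arsinh (f p) - arsinh (f (s, t))| ≤ 24 * C₀ * ε := by
    refine key.trans ?_
    calc _ ≤ (12 * C₀ / t) * (2 * ε * t) := by gcongr
      _ = _ := by field_simp; norm_num
  have := sinh_lip (by positivity) hεC hD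
  rw [sinh_arsinh, sinh_arsinh] at this
  refine this.trans ?_
  have hb : |f (s, t)| + 1 ≤ 2 * beta A1 A2 (s, t) := by
    have q1 : |f (s, t)| ≤ beta A1 A2 (s, t) := le_max_left _ _
    linarith [one_le_beta A1 A2 (s, t)]
  nlinarith [mul_pos hC hε]

def Bz (A1 A2 : R2 → ℝ) (z : R2) : ℝ := if 1 ≤ |fieldB A1 A2 z| then fieldB A1 A2 z else 1

lemma Bz_abs (A1 A2 : R2 → ℝ) (z : R2) : |Bz A1 A2 z| = beta A1 A2 z := by
  unfold Bz beta intenB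
  split_ifs with h
  · rw [max_eq_left h]
  · rw [max_eq_right (le_of_not_ge h)]; simp

lemma Bz_sub (A1 A2 : R2 → ℝ) (z : R2) : |fieldB A1 A2 z - Bz A1 A2 z| ≤ 2 := by
  unfold Bz
  split_ifs with h
  · simp
  · rw [not_le, abs_lt] at h
    rw [abs_le]; constructor <;> linarith

lemma y_ratio {s t ε : ℝ} (ht : 0 < t) (hε : 0 < ε) (hε1 : ε ≤ 1/2) {p : R2} (hp : p ∈ bx s t ε) :
    t ^ 2 / p.2 ^ 2 ≤ exp (2 * ε) ∧ exp (-(2 * ε)) ≤ t ^ 2 / p.2 ^ 2 ∧ |t ^ 2 / p.2 ^ 2 - 1| ≤ 4 * ε ∧ exp (2 * ε) ≤ 3 := by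
  have hp0 : 0 < p.2 := bx_sub ht hp
  have a1 : t / p.2 ≤ exp ε := by
    rw [div_le_iff₀ hp0]
    calc t = exp ε * (t * exp (-ε)) := by rw [mul_left_comm, ← exp_add]; simp
      _ ≤ _ := by gcongr; exact hp.2.1
  have a2 : exp (-ε) ≤ t / p.2 := by
    rw [le_div_iff₀ hp0]
    calc exp (-ε) * p.2 ≤ exp (-ε) * (t * exp ε) := by gcongr; exact hp.2.2
      _ = t := by rw [mul_left_comm, ← exp_add]; simp
  have b1 : (t / p.2) ^ 2 ≤ exp (2 * ε) := by rw [two_mul, exp_add, ← pow_two]; gcongr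
  have b2 : exp (-(2 * ε)) ≤ (t / p.2) ^ 2 := by
    rw [show -(2 * ε) = -ε + -ε by ring, exp_add, ← pow_two]; gcongr
  rw [div_pow] at b1 b2
  have c1 := exp_sub_one_le (x := 2 * ε) (by linarith) (by linarith)
  refine ⟨b1, b2, ?_, by linarith⟩
  rw [abs_le]; constructor
  · have := add_one_le_exp (-(2 * ε)); linarith
  · linarith

lemma locCurl {A1 A2 : R2 → ℝ} (h1 : ContDiffOn ℝ 2 A1 UHP) (h2 : ContDiffOn ℝ 2 A2 UHP) {C₀ : ℝ} (hC : 0 < C₀)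
    (hH : H2 C₀ A1 A2) {s t ε : ℝ} (ht : 0 < t) (hε : 0 < ε) (hε1 : ε ≤ 1/2) (hεC : 24 * C₀ * ε ≤ 1) {p : R2} (hp : p ∈ bx s t ε) :
    |dXr A2 p - dYr A1 p - Bz A1 A2 (s, t) / t ^ 2| ≤ (288 * C₀ + 6) * (ε * beta A1 A2 (s, t) + 1) / t ^ 2 := by
  have hp0 : 0 < p.2 := bx_sub ht hp
  obtain ⟨r1, -, r3, r4⟩ := y_ratio ht hε hε1 hp
  have hl := locB h1 h2 hC hH ht hε (by linarith) hεC hp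
  have hs := Bz_sub A1 A2 (s, t)
  have ha := Bz_abs A1 A2 (s, t)
  set B := Bz A1 A2 (s, t)
  set b := beta A1 A2 (s, t)
  have e : dXr A2 p - dYr A1 p - B / t ^ 2 = ((fieldB A1 A2 p - fieldB A1 A2 (s, t)) * (t ^ 2 / p.2 ^ 2) +
      (fieldB A1 A2 (s, t) - B) * (t ^ 2 / p.2 ^ 2) + B * (t ^ 2 / p.2 ^ 2 - 1)) / t ^ 2 := by
    have : fieldB A1 A2 p = p.2 ^ 2 * (dXr A2 p - dYr A1 p) := rfl
    field_simp
    rw [this]; ring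
  rw [e, abs_div, abs_of_pos (pow_pos ht 2)]
  gcongr
  refine (abs_add_three _ _ _).trans ?_
  rw [abs_mul, abs_mul, abs_mul, ha]
  have r0 : 0 ≤ t ^ 2 / p.2 ^ 2 := by positivity
  rw [abs_of_nonneg r0]
  have r5 := r1.trans r4
  have hb : 0 ≤ b := le_trans zero_le_one (one_le_beta _ _ _)
  calc _ ≤ (96 * C₀ * ε * b) * 3 + 2 * 3 + b * (4 * ε) := by gcongr
    _ ≤ _ := by nlinarith [mul_nonneg hε.le hb]
end SP4b

section SP5
def EU (u : R2 → ℂ) : Prop := C1c u ∧ tsupport u ⊆ UHP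
def E1 (A : R2 → ℝ) (u : R2 → ℂ) (p : R2) : ℂ := -Complex.I * dX u p - (A p : ℂ) * u p
def E2 (A : R2 → ℝ) (u : R2 → ℂ) (p : R2) : ℂ := -Complex.I * dY u p - (A p : ℂ) * u p
def qf (A1 A2 : R2 → ℝ) (u : R2 → ℂ) : ℝ := ∫ p, (‖E1 A1 u p‖ ^ 2 + ‖E2 A2 u p‖ ^ 2)
def nf (u : R2 → ℂ) : ℝ := ∫ p : R2, ‖u p‖ ^ 2 / p.2 ^ 2

lemma mulc {a : R2 → ℝ} (ha : ContinuousOn a UHP) {u : R2 → ℂ} (hu : Continuous u) (hs : tsupport u ⊆ UHP) :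
    Continuous (fun p => (a p : ℂ) * u p) := by
  refine ContinuousOn.continuous_of_tsupport_subset (s := UHP) ?_ UHP_open ((tsupport_mul_subset_right).trans hs)
  exact (Complex.continuous_ofReal.comp_continuousOn ha).mul hu.continuousOn

lemma E1_cont {A : R2 → ℝ} (hA : ContinuousOn A UHP) {u : R2 → ℂ} (hu : EU u) : Continuous (E1 A u) :=
  (continuous_const.mul (dX_cont hu.1)).sub (mulc hA hu.1.1.continuous hu.2)
lemma E2_cont {A : R2 → ℝ} (hA : ContinuousOn A UHP) {u : R2 → ℂ} (hu : EU u) : Continuous (E2 A u) :=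
  (continuous_const.mul (dY_cont hu.1)).sub (mulc hA hu.1.1.continuous hu.2)

lemma E1_zero {A : R2 → ℝ} {u : R2 → ℂ} {p : R2} (hp : p ∉ tsupport u) : E1 A u p = 0 := by
  unfold E1 dX
  rw [fderiv_of_notMem_tsupport ℝ hp, image_eq_zero_of_notMem_tsupport hp]; simp
lemma E2_zero {A : R2 → ℝ} {u : R2 → ℂ} {p : R2} (hp : p ∉ tsupport u) : E2 A u p = 0 := by
  unfold E2 dY
  rw [fderiv_of_notMem_tsupport ℝ hp, image_eq_zero_of_notMem_tsupport hp]; simp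
lemma ts_le {f : R2 → ℂ} {u : R2 → ℂ} (h : ∀ p, p ∉ tsupport u → f p = 0) : tsupport f ⊆ tsupport u :=
  closure_minimal (fun p hp => by by_contra h0; exact hp (h p h0)) (isClosed_tsupport _)
lemma E1_ts (A : R2 → ℝ) (u : R2 → ℂ) : tsupport (E1 A u) ⊆ tsupport u := ts_le fun _ => E1_zero
lemma E2_ts (A : R2 → ℝ) (u : R2 → ℂ) : tsupport (E2 A u) ⊆ tsupport u := ts_le fun _ => E2_zero
lemma E1_cpt {A : R2 → ℝ} {u : R2 → ℂ} (hu : EU u) : HasCompactSupport (E1 A u) :=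
  hu.1.2.of_isClosed_subset (isClosed_tsupport _) (E1_ts A u)
lemma E2_cpt {A : R2 → ℝ} {u : R2 → ℂ} (hu : EU u) : HasCompactSupport (E2 A u) :=
  hu.1.2.of_isClosed_subset (isClosed_tsupport _) (E2_ts A u)

lemma inv_con : ContinuousOn (fun p : R2 => (p.2)⁻¹) UHP :=
  ContinuousOn.inv₀ (by fun_prop) (fun _ hp => ne_of_gt hp)

lemma qf_int {A1 A2 : R2 → ℝ} (h1 : ContinuousOn A1 UHP) (h2 : ContinuousOn A2 UHP) {u : R2 → ℂ} (hu : EU u) :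
    Integrable (fun p => ‖E1 A1 u p‖ ^ 2 + ‖E2 A2 u p‖ ^ 2) :=
  (sq_int (E1_cont h1 hu) (E1_cpt hu)).add (sq_int (E2_cont h2 hu) (E2_cpt hu))

def Jf (u : R2 → ℂ) (p : R2) : ℂ := ((p.2)⁻¹ : ℝ) * u p
lemma Jf_cont {u : R2 → ℂ} (hu : EU u) : Continuous (Jf u) := mulc inv_con hu.1.1.continuous hu.2
lemma Jf_cpt {u : R2 → ℂ} (hu : EU u) : HasCompactSupport (Jf u) := hu.1.2.mul_left
lemma Jf_norm (u : R2 → ℂ) (p : R2) : ‖Jf u p‖ ^ 2 = ‖u p‖ ^ 2 / p.2 ^ 2 := by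
  unfold Jf; rw [norm_mul, mul_pow, Complex.norm_real, Real.norm_eq_abs, sq_abs, inv_pow]; field_simp
lemma nf_int {u : R2 → ℂ} (hu : EU u) : Integrable (fun p : R2 => ‖u p‖ ^ 2 / p.2 ^ 2) := by
  have := sq_int (Jf_cont hu) (Jf_cpt hu)
  simpa only [Jf_norm] using this
lemma nf_nonneg (u : R2 → ℂ) : 0 ≤ nf u := integral_nonneg fun p => by positivity

lemma volH_int {E : Type*} [NormedAddCommGroup E] [NormedSpace ℝ E] (F : R2 → E) (hF : ∀ p ∉ UHP, F p = 0) : ∫ p, F p ∂volH = ∫ p : R2, (p.2 ^ 2)⁻¹ • F p := by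
  unfold volH
  rw [integral_withDensity_eq_integral_toReal_smul (by fun_prop) (by simp)]
  rw [setIntegral_eq_integral_of_forall_compl_eq_zero (fun p hp => by rw [hF p hp, smul_zero])]
  congr 1; ext p
  rw [ENNReal.toReal_ofReal (by positivity)]

lemma EU_zero {u : R2 → ℂ} (hu : EU u) {p : R2} (hp : p ∉ UHP) : u p = 0 :=
  image_eq_zero_of_notMem_tsupport fun h => hp (hu.2 h)

lemma nf_eq {u : R2 → ℂ} (hu : EU u) : ∫ p, ‖u p‖ ^ 2 ∂volH = nf u := by
  rw [volH_int _ (fun p hp => by simp [EU_zero hu hp])]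
  unfold nf; congr 1; ext p; rw [smul_eq_mul]; field_simp

lemma qf_eq {A1 A2 : R2 → ℝ} {u : R2 → ℂ} (hu : EU u) : qA A1 A2 u = qf A1 A2 u := by
  have hz : ∀ p ∉ UHP, ‖E1 A1 u p‖ ^ 2 + ‖E2 A2 u p‖ ^ 2 = 0 := by
    intro p hp
    have : p ∉ tsupport u := fun h => hp (hu.2 h)
    rw [E1_zero this, E2_zero this]; simp
  have : qA A1 A2 u = ∫ p, p.2 ^ 2 * (‖E1 A1 u p‖ ^ 2 + ‖E2 A2 u p‖ ^ 2) ∂volH := rfl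
  rw [this, volH_int _ (fun p hp => by rw [hz p hp, mul_zero])]
  unfold qf; congr 1; ext p
  by_cases hp : p ∈ UHP
  · have : p.2 ≠ 0 := ne_of_gt hp
    rw [smul_eq_mul]; field_simp
  · rw [hz p hp]; simp

lemma young {E : Type*} [NormedAddCommGroup E] (a b : E) {η : ℝ} (hη : 0 < η) :
    ‖a + b‖ ^ 2 ≤ (1 + η) * ‖a‖ ^ 2 + (1 + 1 / η) * ‖b‖ ^ 2 := by
  have h := norm_add_le a b
  have h1 : ‖a + b‖ ^ 2 ≤ (‖a‖ + ‖b‖) ^ 2 := by gcongr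
  have h2 : 2 * ‖a‖ * ‖b‖ ≤ η * ‖a‖ ^ 2 + 1 / η * ‖b‖ ^ 2 := by
    have : η * ‖a‖ ^ 2 + 1 / η * ‖b‖ ^ 2 - 2 * ‖a‖ * ‖b‖ = (η * ‖a‖ - ‖b‖) ^ 2 / η := by field_simp; ring
    have h3 : 0 ≤ (η * ‖a‖ - ‖b‖) ^ 2 / η := by positivity
    linarith
  nlinarith

lemma c1_ext {F : Type*} [NormedAddCommGroup F] [NormedSpace ℝ F] {f : R2 → F} (h : ContDiffOn ℝ 1 f UHP) {K : Set (R2)}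
    (hK : IsClosed K) (hKU : K ⊆ UHP) (hz : ∀ p ∉ K, f p = 0) : ContDiff ℝ 1 f ∧ tsupport f ⊆ K := by
  have ht : tsupport f ⊆ K := closure_minimal (fun p hp => by by_contra h0; exact hp (hz p h0)) hK
  refine ⟨contDiff_iff_contDiffAt.2 fun p => ?_, ht⟩
  by_cases hp : p ∈ UHP
  · exact h.contDiffAt (UHP_open.mem_nhds hp)
  · have : f =ᶠ[nhds p] fun _ => 0 := by
      have : p ∉ K := fun h => hp (hKU h)
      filter_upwards [hK.isOpen_compl.mem_nhds this] with q hq using hz q hq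
    exact contDiffAt_const.congr_of_eventuallyEq this

lemma gm_EU {φ : R2 → ℝ} (hφ : ContDiffOn ℝ 1 φ UHP) {u : R2 → ℂ} (hu : EU u) : EU (fun p => ee (φ p) * u p) := by
  have := c1_ext (f := fun p => ee (φ p) * u p) ((ee_cd.comp_contDiffOn hφ).mul hu.1.1.contDiffOn) (isClosed_tsupport u) hu.2
    (fun p hp => by rw [image_eq_zero_of_notMem_tsupport hp, mul_zero])
  exact ⟨⟨this.1, hu.1.2.of_isClosed_subset (isClosed_tsupport _) this.2⟩, this.2.trans hu.2⟩

lemma gm_dX {φ : R2 → ℝ} (hφ : ContDiffOn ℝ 1 φ UHP) {u : R2 → ℂ} (hu : EU u) {p : R2} (hp : p ∈ UHP) :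
    dX (fun p => ee (φ p) * u p) p = ee (φ p) * (dX u p + Complex.I * (dXr φ p : ℂ) * u p) ∧
    dY (fun p => ee (φ p) * u p) p = ee (φ p) * (dY u p + Complex.I * (dYr φ p : ℂ) * u p) := by
  have hv := (gm_EU hφ hu).1.1.differentiable (by norm_num) p
  have hud := hu.1.1.differentiable (by norm_num) p
  have hφd := UHP_fd hφ le_rfl hp
  constructor
  · have e1 := hasDerivAt_x hv
    have e2 := ((ee_deriv _).scomp p.1 (hasDerivAt_xr hφd)).mul (hasDerivAt_x hud)
    rw [e1.unique e2]; simp; ring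
  · have e1 := hasDerivAt_y hv
    have e2 := ((ee_deriv _).scomp p.2 (hasDerivAt_yr hφd)).mul (hasDerivAt_y hud)
    rw [e1.unique e2]; simp; ring

lemma Loc {A1 A2 : R2 → ℝ} (h1 : ContDiffOn ℝ 2 A1 UHP) (h2 : ContDiffOn ℝ 2 A2 UHP) {C₀ : ℝ} (hC : 0 < C₀)
    (hH : H2 C₀ A1 A2) {s t ε : ℝ} (ht : 0 < t) (hε : 0 < ε) (hε1 : ε ≤ 1/2) (hεC : 24 * C₀ * ε ≤ 1) :
    ∃ φ : R2 → ℝ, ContDiffOn ℝ 1 φ UHP ∧ ∀ v, EU v → tsupport v ⊆ bx s t ε → ∀ η > 0,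
      q0 (Bz A1 A2 (s, t) / t ^ 2) v ≤ (1 + η) * qf A1 A2 (fun p => ee (φ p) * v p) +
        (1 + 1 / η) * (3 * ((288 * C₀ + 6) * (ε * beta A1 A2 (s, t) + 1) * ε) ^ 2) * nf v ∧
      qf A1 A2 (fun p => ee (φ p) * v p) ≤ (1 + η) * q0 (Bz A1 A2 (s, t) / t ^ 2) v +
        (1 + 1 / η) * (3 * ((288 * C₀ + 6) * (ε * beta A1 A2 (s, t) + 1) * ε) ^ 2) * nf v := by
  set B := Bz A1 A2 (s, t) / t ^ 2 with hB
  obtain ⟨φ, hφ, hφ2⟩ := gauge_ex h1 h2 s B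
  refine ⟨φ, hφ, fun v hv hvs η hη => ?_⟩
  set Q := (288 * C₀ + 6) * (ε * beta A1 A2 (s, t) + 1) * ε with hQ
  have hQ0 : 0 ≤ Q := by have := one_le_beta A1 A2 (s, t); positivity
  have hu := gm_EU hφ hv
  set u := fun p => ee (φ p) * v p with hud
  have hm : ∀ p ∈ bx s t ε, |A2 p - dYr φ p| ≤ Q / t := by
    intro p hp
    refine ((hφ2 p (bx_sub ht hp)).2 ((288 * C₀ + 6) * (ε * beta A1 A2 (s, t) + 1) / t ^ 2) (fun x hx => ?_)).trans ?_
    · refine locCurl h1 h2 hC hH ht hε hε1 hεC ⟨?_, hp.2⟩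
      have hs := (bx_mem (s := s) ht hε.le).1
      exact (Set.uIcc_subset_Icc hs hp.1) hx
    · have e1 : |p.1 - s| ≤ ε * t := by
        have q1 := hp.1.1; have q2 := hp.1.2
        rw [abs_le]; constructor <;> linarith
      have : 0 ≤ (288 * C₀ + 6) * (ε * beta A1 A2 (s, t) + 1) / t ^ 2 := by
        have := one_le_beta A1 A2 (s, t); positivity
      calc _ ≤ (288 * C₀ + 6) * (ε * beta A1 A2 (s, t) + 1) / t ^ 2 * (ε * t) := by gcongr
        _ = _ := by rw [hQ]; field_simp
  have i0 : Integrable (fun p => ‖-Complex.I * dX v p + (B * p.2 : ℝ) * v p‖ ^ 2 + ‖dY v p‖ ^ 2) :=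
    (sq_int (D1_cont hv.1 B) (D1_cpt hv.1 B)).add (sq_int (dY_cont hv.1) (dY_cpt hv.1))
  have i1 := qf_int h1.continuousOn h2.continuousOn hu
  have i2 := nf_int hv
  have pw : ∀ p, ‖E1 A1 u p‖ = ‖-Complex.I * dX v p + (B * p.2 : ℝ) * v p‖ ∧ ∃ m : ℂ, ‖m‖ ^ 2 ≤ 3 * Q ^ 2 * (‖v p‖ ^ 2 / p.2 ^ 2) ∧
      ‖E2 A2 u p‖ = ‖-Complex.I * dY v p - m‖ := by
    intro p
    by_cases hp : p ∈ tsupport v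
    · have hpb := hvs hp
      have hpU := bx_sub ht hpb
      obtain ⟨d1, d2⟩ := gm_dX hφ hv hpU
      constructor
      · have : E1 A1 u p = ee (φ p) * (-Complex.I * dX v p + (B * p.2 : ℝ) * v p) := by
          unfold E1; rw [d1, (hφ2 p hpU).1]; push_cast
          linear_combination (-(ee (φ p) * (A1 p + B * p.2) * v p)) * Complex.I_sq
        rw [this, norm_mul, ee_norm, one_mul]
      · refine ⟨((A2 p - dYr φ p : ℝ) : ℂ) * v p, ?_, ?_⟩
        · rw [norm_mul, mul_pow, Complex.norm_real, Real.norm_eq_abs]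
          have r := y_ratio ht hε hε1 hpb
          have p0 : 0 < p.2 := hpU
          have e2 : (Q / t) ^ 2 ≤ 3 * Q ^ 2 / p.2 ^ 2 := by
            have : (Q / t) ^ 2 = Q ^ 2 / p.2 ^ 2 / (t ^ 2 / p.2 ^ 2) := by field_simp
            have r5 : 1 / 3 ≤ t ^ 2 / p.2 ^ 2 := by
              refine le_trans ?_ r.2.1
              rw [exp_neg, one_div]; exact inv_anti₀ (exp_pos _) r.2.2.2
            rw [this, div_le_iff₀ (by positivity)]
            calc Q ^ 2 / p.2 ^ 2 = 3 * Q ^ 2 / p.2 ^ 2 * (1/3) := by ring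
              _ ≤ _ := by gcongr
          calc |A2 p - dYr φ p| ^ 2 * ‖v p‖ ^ 2 ≤ (Q / t) ^ 2 * ‖v p‖ ^ 2 := by gcongr; exact hm p hpb
            _ ≤ 3 * Q ^ 2 / p.2 ^ 2 * ‖v p‖ ^ 2 := by gcongr
            _ = _ := by ring
        · have : E2 A2 u p = ee (φ p) * (-Complex.I * dY v p - ((A2 p - dYr φ p : ℝ) : ℂ) * v p) := by
            unfold E2; rw [d2]; push_cast
            linear_combination (-(ee (φ p) * (dYr φ p) * v p)) * Complex.I_sq
          rw [this, norm_mul, ee_norm, one_mul]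
    · have hpu : p ∉ tsupport u := fun h => hp (ts_le (f := u) (u := v) (fun q hq => by
        rw [hud]; simp only; rw [image_eq_zero_of_notMem_tsupport hq, mul_zero]) h)
      rw [E1_zero hpu, E2_zero hpu]
      have z1 : v p = 0 := image_eq_zero_of_notMem_tsupport hp
      have z2 : fderiv ℝ v p = 0 := fderiv_of_notMem_tsupport ℝ hp
      refine ⟨by simp [dX, z1, z2], 0, by simp [z1], by simp [dY, z2]⟩
  have hy : ∀ a b c : ℝ, a ≤ (1 + η) * b + (1 + 1 / η) * c → ∀ d : ℝ, 0 ≤ d → d + a ≤ (1 + η) * (d + b) + (1 + 1 / η) * c :=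
    fun a b c h d hd => by nlinarith [mul_nonneg hη.le hd]
  have hη' : 0 ≤ 1 + 1 / η := by positivity
  constructor
  · unfold q0 qf nf
    rw [← integral_const_mul, ← integral_const_mul, ← integral_add (i1.const_mul _) (i2.const_mul _)]
    refine integral_mono i0 ((i1.const_mul _).add (i2.const_mul _)) (fun p => ?_)
    obtain ⟨e1, m, hm1, hm2⟩ := pw p
    have y1 := young (-Complex.I * dY v p - m) m hη
    rw [sub_add_cancel, norm_mul, norm_neg, Complex.norm_I, one_mul, ← hm2] at y1
    simp only
    rw [← e1, mul_assoc (1 + 1 / η)]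
    refine hy _ _ _ (y1.trans ?_) _ (by positivity)
    gcongr
  · unfold q0 qf nf
    rw [← integral_const_mul, ← integral_const_mul, ← integral_add (i0.const_mul _) (i2.const_mul _)]
    refine integral_mono i1 ((i0.const_mul _).add (i2.const_mul _)) (fun p => ?_)
    obtain ⟨e1, m, hm1, hm2⟩ := pw p
    have y1 := young (-Complex.I * dY v p) (-m) hη
    rw [norm_mul, norm_neg, norm_neg, Complex.norm_I, one_mul, ← sub_eq_add_neg, ← hm2] at y1
    simp only
    rw [← e1, mul_assoc (1 + 1 / η)]
    refine hy _ _ _ (y1.trans ?_) _ (by positivity)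
    gcongr
end SP5

section SP5b
def Cut (g : ℝ → ℝ) (ε K : ℝ) : Prop :=
  ContDiff ℝ 1 g ∧ (∀ x, ε < |x| → g x = 0) ∧ ∫ x, g x ^ 2 = 1 ∧ ∫ x, deriv g x ^ 2 ≤ K / ε ^ 2

lemma cut_ex : ∃ K > 0, ∀ ε > 0, ∃ g, Cut g ε K := by
  let f : ContDiffBump (0 : ℝ) := ⟨1/2, 1, by norm_num, by norm_num⟩
  have fc : ContDiff ℝ 1 f := f.contDiff
  have fs : ∀ x, 1 < |x| → f x = 0 := fun x hx => f.zero_of_le_dist (by rw [dist_zero_right, Real.norm_eq_abs]; exact hx.le)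
  have f2c : HasCompactSupport (fun x => f x ^ 2) := f.hasCompactSupport.comp_left (g := fun x : ℝ => x ^ 2) (by simp)
  have c2 : 0 < ∫ x, f x ^ 2 := by
    refine Continuous.integral_pos_of_hasCompactSupport_nonneg_nonzero (x := 0) (fc.continuous.pow 2) f2c (fun x => by positivity) ?_
    have : f 0 = 1 := f.one_of_mem_closedBall (by simp [f.rIn_pos.le])
    simp [this]
  set N := ∫ x, f x ^ 2
  refine ⟨1 + (∫ x, deriv f x ^ 2) / N, ?_, fun ε hε => ?_⟩
  · have : 0 ≤ ∫ x, deriv f x ^ 2 := integral_nonneg fun x => by positivity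
    positivity
  have e1 : ∀ x, HasDerivAt (fun x => (√(ε * N))⁻¹ * f (x / ε)) ((√(ε * N))⁻¹ * (deriv f (x / ε) * ε⁻¹)) x := by
    intro x
    have h1 : HasDerivAt (fun x : ℝ => x / ε) ε⁻¹ x := by simpa using (hasDerivAt_id x).div_const ε
    have h2 := (fc.differentiable (by norm_num) (x / ε)).hasDerivAt
    exact (h2.comp x h1).const_mul _
  have sq : (√(ε * N))⁻¹ ^ 2 = (ε * N)⁻¹ := by rw [inv_pow, sq_sqrt (by positivity)]
  refine ⟨fun x => (√(ε * N))⁻¹ * f (x / ε), ?_, ?_, ?_, ?_⟩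
  · exact contDiff_const.mul (fc.comp (by fun_prop))
  · intro x hx
    simp only
    rw [fs, mul_zero]
    rw [abs_div, abs_of_pos hε, lt_div_iff₀ hε]; linarith
  · simp_rw [mul_pow, sq]
    rw [integral_const_mul, Measure.integral_comp_div (fun x => f x ^ 2) ε, abs_of_pos hε, smul_eq_mul]
    field_simp
    rfl
  · have : ∀ x, deriv (fun x => (√(ε * N))⁻¹ * f (x / ε)) x ^ 2 = (ε * N)⁻¹ * (ε⁻¹ ^ 2 * (fun x => deriv f x ^ 2) (x / ε)) := by
      intro x; rw [(e1 x).deriv, mul_pow, mul_pow, sq]; ring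
    simp_rw [this]
    rw [integral_const_mul, integral_const_mul, Measure.integral_comp_div (fun x => deriv f x ^ 2) ε, abs_of_pos hε, smul_eq_mul]
    have : (ε * N)⁻¹ * (ε⁻¹ ^ 2 * (ε * ∫ x, deriv f x ^ 2)) = ((∫ x, deriv f x ^ 2) / N) / ε ^ 2 := by field_simp
    rw [this]; gcongr; linarith

def Wk (G H : ℝ → ℝ) (z p : R2) : ℝ := exp (-z.2) * G ((p.1 - z.1) * exp (-z.2)) * H (log p.2 - z.2)

lemma zint (G H : ℝ → ℝ) (p : R2) (hi : Integrable (fun z => Wk G H z p)) :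
    ∫ z, Wk G H z p = (∫ x, G x) * ∫ x, H x := by
  rw [Measure.volume_eq_prod] at hi ⊢
  rw [integral_prod_symm _ hi]
  have : ∀ τ : ℝ, ∫ s : ℝ, Wk G H (s, τ) p = (∫ x, G x) * H (log p.2 - τ) := by
    intro τ
    unfold Wk
    simp only
    rw [integral_mul_const, integral_const_mul, integral_sub_left_eq_self (fun s => G (s * exp (-τ))),
      Measure.integral_comp_mul_right, abs_of_pos (by positivity), smul_eq_mul]
    field_simp
  simp_rw [this]
  rw [integral_const_mul, integral_sub_left_eq_self]

lemma fubGH {G H : ℝ → ℝ} (hG : Continuous G) (hH : Continuous H) {ε : ℝ} (hGs : ∀ x, ε < |x| → G x = 0)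
    (hHs : ∀ x, ε < |x| → H x = 0) {h : R2 → ℝ} (hh : Continuous h) (hc : HasCompactSupport h) (hs : tsupport h ⊆ UHP) :
    Integrable (fun z => ∫ p, Wk G H z p * h p) ∧
    ∫ z, (∫ p, Wk G H z p * h p) = (∫ x, G x) * (∫ x, H x) * ∫ p, h p := by
  have key : ∀ a, ε < |a| → G a = 0 := hGs
  set m : (R2) × (R2) → R2 := fun q => (q.1.1 - q.2.1 * exp (log q.1.2 - q.2.2), log q.1.2 - q.2.2) with hm
  have hmc : ContinuousOn m (tsupport h ×ˢ (Set.Icc (-ε) ε ×ˢ Set.Icc (-ε) ε)) := by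
    have hl : ContinuousOn (fun q : (R2) × (R2) => log q.1.2) (tsupport h ×ˢ (Set.Icc (-ε) ε ×ˢ Set.Icc (-ε) ε)) :=
      ContinuousOn.log (by fun_prop) (fun q hq => ne_of_gt (hs hq.1))
    rw [hm]
    refine ContinuousOn.prodMk ?_ ?_
    · exact (ContinuousOn.sub (by fun_prop) (ContinuousOn.mul (by fun_prop) (continuous_exp.comp_continuousOn (hl.sub (by fun_prop)))))
    · exact hl.sub (by fun_prop)
  set Kz := m '' (tsupport h ×ˢ (Set.Icc (-ε) ε ×ˢ Set.Icc (-ε) ε)) with hKz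
  have hKc : IsCompact Kz := (hc.isCompact.prod (isCompact_Icc.prod isCompact_Icc)).image_of_continuousOn hmc
  have hzero : ∀ z p, p ∈ tsupport h → z ∉ Kz → Wk G H z p = 0 := by
    intro z p hp hz
    unfold Wk
    by_cases h1 : ε < |(p.1 - z.1) * exp (-z.2)|
    · rw [hGs _ h1]; ring
    by_cases h2 : ε < |log p.2 - z.2|
    · rw [hHs _ h2]; ring
    exfalso; apply hz
    refine ⟨(p, ((p.1 - z.1) * exp (-z.2), log p.2 - z.2)), ⟨hp, abs_le.1 (not_lt.1 h1), abs_le.1 (not_lt.1 h2)⟩, ?_⟩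
    rw [hm]; simp only [sub_sub_cancel]
    rw [mul_assoc, ← exp_add]; simp
  have hWc : ContinuousOn (fun q : (R2) × (R2) => Wk G H q.1 q.2) (Set.univ ×ˢ UHP) := by
    unfold Wk
    refine ContinuousOn.mul (ContinuousOn.mul (by fun_prop) (by fun_prop)) (hH.comp_continuousOn ?_)
    exact ContinuousOn.sub (ContinuousOn.log (by fun_prop) (fun q hq => ne_of_gt hq.2)) (by fun_prop)
  have hF : Continuous (fun q : (R2) × (R2) => Wk G H q.1 q.2 * h q.2) := by
    refine ContinuousOn.continuous_of_tsupport_subset (s := Set.univ ×ˢ UHP) (hWc.mul (by fun_prop)) (isOpen_univ.prod UHP_open) ?_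
    have : tsupport (fun q : (R2) × (R2) => Wk G H q.1 q.2 * h q.2) ⊆ Set.univ ×ˢ tsupport h := by
      refine closure_minimal (fun q hq => ⟨trivial, subset_tsupport h fun h0 => hq ?_⟩) (isClosed_univ.prod (isClosed_tsupport h))
      simp [h0]
    exact this.trans (Set.prod_mono_right hs)
  have hFc : HasCompactSupport (Function.uncurry (fun z p => Wk G H z p * h p)) := by
    refine HasCompactSupport.intro (hKc.prod hc.isCompact) (fun q hq => ?_)
    simp only [Function.uncurry]
    by_cases hp : q.2 ∈ tsupport h
    · rw [hzero q.1 q.2 hp (fun h => hq ⟨h, hp⟩), zero_mul]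
    · rw [image_eq_zero_of_notMem_tsupport hp, mul_zero]
  constructor
  · have c1 : Continuous (fun z => ∫ p, Wk G H z p * h p) :=
      cont_param (f := fun z p => Wk G H z p * h p) hF hc.isCompact (fun z p hp => by rw [image_eq_zero_of_notMem_tsupport hp, mul_zero])
    refine c1.integrable_of_hasCompactSupport (HasCompactSupport.intro hKc fun z hz => ?_)
    rw [← integral_zero (R2) ℝ]
    congr 1; ext p
    by_cases hp : p ∈ tsupport h
    · rw [hzero z p hp hz, zero_mul]
    · rw [image_eq_zero_of_notMem_tsupport hp, mul_zero]
  · rw [integral_integral_swap_of_hasCompactSupport hF hFc, ← integral_const_mul]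
    congr 1; ext p
    by_cases hp : p ∈ tsupport h
    · rw [integral_mul_const, zint]
      have hpU := hs hp
      have c1 : Continuous (fun z => Wk G H z p) := by
        unfold Wk; fun_prop
      exact c1.integrable_of_hasCompactSupport (HasCompactSupport.intro hKc fun z hz => hzero z p hp hz)
    · simp [image_eq_zero_of_notMem_tsupport hp]

def chi (g : ℝ → ℝ) (z p : R2) : ℝ := if 0 < p.2 then g ((p.1 - z.1) * exp (-z.2)) * g (log p.2 - z.2) else 0

lemma bx_iff {z p : R2} {ε : ℝ} (hp : 0 < p.2) : p ∈ bx z.1 (exp z.2) ε ↔ |(p.1 - z.1) * exp (-z.2)| ≤ ε ∧ |log p.2 - z.2| ≤ ε := by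
  have e0 := exp_pos z.2
  unfold bx
  simp only [Set.mem_prod, Set.mem_Icc, abs_le]
  have a1 : (p.1 - z.1) * exp (-z.2) = (p.1 - z.1) / exp z.2 := by rw [exp_neg]; rfl
  rw [a1, le_div_iff₀ e0, div_le_iff₀ e0]
  have b1 : exp z.2 * exp (-ε) ≤ p.2 ↔ -ε ≤ log p.2 - z.2 := by
    rw [← exp_add, ← le_log_iff_exp_le hp]; constructor <;> intro h <;> linarith
  have b2 : p.2 ≤ exp z.2 * exp ε ↔ log p.2 - z.2 ≤ ε := by
    rw [← exp_add, ← log_le_iff_le_exp hp]; constructor <;> intro h <;> linarith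
  rw [b1, b2]
  constructor
  · rintro ⟨⟨h1, h2⟩, h3⟩; exact ⟨⟨by linarith, by linarith⟩, h3⟩
  · rintro ⟨⟨h1, h2⟩, h3⟩; exact ⟨⟨by linarith, by linarith⟩, h3⟩

lemma bx_closed (s t ε : ℝ) : IsClosed (bx s t ε) := isClosed_Icc.prod isClosed_Icc
lemma bx_compact (s t ε : ℝ) : IsCompact (bx s t ε) := isCompact_Icc.prod isCompact_Icc

lemma chi_props {g : ℝ → ℝ} {ε K : ℝ} (hg : Cut g ε K) (z : R2) :
    ContDiff ℝ 1 (chi g z) ∧ tsupport (chi g z) ⊆ bx z.1 (exp z.2) ε ∧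
    ∀ p : R2, 0 < p.2 → dXr (chi g z) p = exp (-z.2) * deriv g ((p.1 - z.1) * exp (-z.2)) * g (log p.2 - z.2) ∧
      dYr (chi g z) p = g ((p.1 - z.1) * exp (-z.2)) * deriv g (log p.2 - z.2) / p.2 := by
  have hcd : ContDiffOn ℝ 1 (chi g z) UHP := by
    have : ContDiffOn ℝ 1 (fun p : R2 => g ((p.1 - z.1) * exp (-z.2)) * g (log p.2 - z.2)) UHP := by
      refine ContDiffOn.mul (hg.1.comp_contDiffOn (by fun_prop)) (hg.1.comp_contDiffOn ?_)
      exact (ContDiffOn.log (by fun_prop) (fun p hp => ne_of_gt hp)).sub contDiffOn_const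
    exact this.congr (fun p hp => if_pos hp)
  have hz : ∀ p ∉ bx z.1 (exp z.2) ε, chi g z p = 0 := by
    intro p hp
    unfold chi
    split_ifs with h
    · rw [bx_iff h, not_and_or, not_le, not_le] at hp
      rcases hp with hp | hp
      · rw [hg.2.1 _ hp, zero_mul]
      · rw [hg.2.1 _ hp, mul_zero]
    · rfl
  obtain ⟨k1, k2⟩ := c1_ext hcd (bx_closed _ _ _) (bx_sub (exp_pos _)) hz
  refine ⟨k1, k2, fun p hp => ?_⟩
  have hd := k1.differentiable (by norm_num) p
  have gd : ∀ x, HasDerivAt g (deriv g x) x := fun x => (hg.1.differentiable (by norm_num) x).hasDerivAt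
  constructor
  · have e1 := hasDerivAt_xr hd
    have e2 : HasDerivAt (fun x : ℝ => (x - z.1) * exp (-z.2)) (exp (-z.2)) p.1 := by
      simpa using ((hasDerivAt_id p.1).sub_const z.1).mul_const (exp (-z.2))
    have e3 := ((gd _).comp p.1 e2).mul_const (g (log p.2 - z.2))
    have e4 : (fun x => chi g z (x, p.2)) = fun x => g ((x - z.1) * exp (-z.2)) * g (log p.2 - z.2) := by
      ext x; exact if_pos hp
    rw [e4] at e1
    rw [e1.unique e3]; ring
  · have e1 := hasDerivAt_yr hd
    have e2 : HasDerivAt (fun y : ℝ => log y - z.2) (p.2)⁻¹ p.2 := (hasDerivAt_log (ne_of_gt hp)).sub_const z.2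
    have e3 := ((gd _).comp p.2 e2).const_mul (g ((p.1 - z.1) * exp (-z.2)))
    have e4 : (fun y => chi g z (p.1, y)) =ᶠ[nhds p.2] fun y => g ((p.1 - z.1) * exp (-z.2)) * g (log y - z.2) := by
      filter_upwards [lt_mem_nhds hp] with y hy
      exact if_pos hy
    rw [e1.unique (e3.congr_of_eventuallyEq e4)]; field_simp
end SP5b

section SP5c
def cm (χ : R2 → ℝ) (e : R2 → ℂ) (p : R2) : ℂ := (χ p : ℂ) * e p

lemma cm_EU {χ : R2 → ℝ} (hχ : ContDiff ℝ 1 χ) {e : R2 → ℂ} (he : EU e) : EU (cm χ e) :=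
  ⟨⟨(Complex.ofRealCLM.contDiff.comp hχ).mul he.1.1, he.1.2.mul_left⟩, (tsupport_mul_subset_right).trans he.2⟩

lemma cm_ts {χ : R2 → ℝ} {e : R2 → ℂ} : tsupport (cm χ e) ⊆ tsupport χ :=
  closure_minimal (fun p hp => subset_tsupport χ fun h0 => hp (by simp [cm, h0])) (isClosed_tsupport _)

lemma cm_E {A1 A2 χ : R2 → ℝ} (hχ : ContDiff ℝ 1 χ) {e : R2 → ℂ} (he : EU e) (p : R2) :
    E1 A1 (cm χ e) p = χ p * E1 A1 e p + -Complex.I * dXr χ p * e p ∧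
    E2 A2 (cm χ e) p = χ p * E2 A2 e p + -Complex.I * dYr χ p * e p := by
  have hd := (cm_EU hχ he).1.1.differentiable (by norm_num) p
  have hχd := hχ.differentiable (by norm_num) p
  have hed := he.1.1.differentiable (by norm_num) p
  constructor
  · have := (hasDerivAt_x hd).unique ((hasDerivAt_xr hχd).ofReal_comp.mul (hasDerivAt_x hed))
    unfold E1; rw [this]; unfold cm; ring
  · have := (hasDerivAt_y hd).unique ((hasDerivAt_yr hχd).ofReal_comp.mul (hasDerivAt_y hed))
    unfold E2; rw [this]; unfold cm; ring

lemma Wk_int {G H : ℝ → ℝ} (hG : Continuous G) (hH : Continuous H) {h : R2 → ℝ} (hh : Continuous h) (hc : HasCompactSupport h)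
    (hs : tsupport h ⊆ UHP) (z : R2) : Integrable (fun p => Wk G H z p * h p) := by
  refine Continuous.integrable_of_hasCompactSupport ?_ hc.mul_left
  refine ContinuousOn.continuous_of_tsupport_subset (s := UHP) (ContinuousOn.mul ?_ hh.continuousOn) UHP_open ((tsupport_mul_subset_right).trans hs)
  unfold Wk
  refine ContinuousOn.mul (ContinuousOn.mul (by fun_prop) (by fun_prop)) (hH.comp_continuousOn ?_)
  exact ContinuousOn.sub (ContinuousOn.log (by fun_prop) (fun q hq => ne_of_gt hq)) (by fun_prop)

lemma sq_good {f : R2 → ℂ} (hf : Continuous f) (hc : HasCompactSupport f) (hs : tsupport f ⊆ UHP) :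
    Continuous (fun p => ‖f p‖ ^ 2) ∧ HasCompactSupport (fun p => ‖f p‖ ^ 2) ∧ tsupport (fun p => ‖f p‖ ^ 2) ⊆ UHP := by
  have : tsupport (fun p => ‖f p‖ ^ 2) ⊆ tsupport f :=
    closure_minimal (fun p hp => subset_tsupport f fun h0 => hp (by simp [h0])) (isClosed_tsupport _)
  exact ⟨by fun_prop, hc.of_isClosed_subset (isClosed_tsupport _) this, this.trans hs⟩

lemma nf_good {e : R2 → ℂ} (he : EU e) : Continuous (fun p : R2 => ‖e p‖ ^ 2 / p.2 ^ 2) ∧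
    HasCompactSupport (fun p : R2 => ‖e p‖ ^ 2 / p.2 ^ 2) ∧ tsupport (fun p : R2 => ‖e p‖ ^ 2 / p.2 ^ 2) ⊆ UHP := by
  have := sq_good (Jf_cont he) (Jf_cpt he) ((tsupport_mul_subset_right).trans he.2)
  simpa only [Jf_norm] using this

lemma qf_good {A1 A2 : R2 → ℝ} (h1 : ContinuousOn A1 UHP) (h2 : ContinuousOn A2 UHP) {e : R2 → ℂ} (he : EU e) :
    Continuous (fun p : R2 => ‖E1 A1 e p‖ ^ 2 + ‖E2 A2 e p‖ ^ 2) ∧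
    HasCompactSupport (fun p : R2 => ‖E1 A1 e p‖ ^ 2 + ‖E2 A2 e p‖ ^ 2) ∧ tsupport (fun p : R2 => ‖E1 A1 e p‖ ^ 2 + ‖E2 A2 e p‖ ^ 2) ⊆ UHP := by
  have a := sq_good (E1_cont h1 he) (E1_cpt he) ((E1_ts A1 e).trans he.2)
  have b := sq_good (E2_cont h2 he) (E2_cpt he) ((E2_ts A2 e).trans he.2)
  refine ⟨a.1.add b.1, a.2.1.add b.2.1, (tsupport_add _ _).trans (Set.union_subset a.2.2 b.2.2)⟩

lemma Wk_chi (g : ℝ → ℝ) {h : R2 → ℝ} (hs : tsupport h ⊆ UHP) (z p : R2) :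
    Wk (fun x => g x ^ 2) (fun x => g x ^ 2) z p * h p = exp (-z.2) * (chi g z p ^ 2 * h p) := by
  by_cases hp : 0 < p.2
  · unfold Wk chi; rw [if_pos hp]; ring
  · have : h p = 0 := image_eq_zero_of_notMem_tsupport (fun h => hp (hs h))
    rw [this]; ring

lemma IMS {A1 A2 : R2 → ℝ} (h1 : ContinuousOn A1 UHP) (h2 : ContinuousOn A2 UHP) {g : ℝ → ℝ} {ε K : ℝ} (hg : Cut g ε K)
    (hε1 : ε ≤ 1/2) (hε0 : 0 < ε) {ι : Type*} (I : Finset ι) (e : ι → R2 → ℂ) (he : ∀ i ∈ I, EU (e i)) {l η : ℝ} (hη : 0 < η)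
    {Γ : R2 → ℝ} (hΓ : Continuous Γ) (hΓc : HasCompactSupport Γ) (hΓs : tsupport Γ ⊆ UHP)
    (hloc : ∀ z, ∑ i ∈ I, (l * nf (cm (chi g z) (e i)) - qf A1 A2 (cm (chi g z) (e i))) ≤ ∫ p, chi g z p ^ 2 * Γ p) :
    ∑ i ∈ I, ((l - (1 + 1 / η) * (4 * K / ε ^ 2)) * nf (e i) - (1 + η) * qf A1 A2 (e i)) ≤ ∫ p, Γ p := by
  have cg : Continuous g := hg.1.continuous
  have cg' : Continuous (deriv g) := hg.1.continuous_deriv le_rfl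
  have gz' : ∀ x, ε < |x| → deriv g x = 0 := by
    intro x hx
    have : g =ᶠ[nhds x] fun _ => 0 := by
      filter_upwards [continuous_abs.continuousAt.eventually (lt_mem_nhds hx)] with y hy using hg.2.1 y hy
    rw [this.deriv_eq]; simp
  set G1 : ℝ → ℝ := fun x => g x ^ 2 with hG1
  set G2 : ℝ → ℝ := fun x => deriv g x ^ 2 with hG2
  set G3 : ℝ → ℝ := fun x => g x ^ 2 * exp (2 * x) with hG3
  have z1 : ∀ x, ε < |x| → G1 x = 0 := fun x hx => by simp [hG1, hg.2.1 x hx]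
  have z2 : ∀ x, ε < |x| → G2 x = 0 := fun x hx => by simp [hG2, gz' x hx]
  have z3 : ∀ x, ε < |x| → G3 x = 0 := fun x hx => by simp [hG3, hg.2.1 x hx]
  have c1 : Continuous G1 := by fun_prop
  have c2 : Continuous G2 := by fun_prop
  have c3 : Continuous G3 := by fun_prop
  have I1 : ∫ x, G1 x = 1 := hg.2.2.1
  have I2 : ∫ x, G2 x ≤ K / ε ^ 2 := hg.2.2.2
  have cpt : ∀ {G : ℝ → ℝ}, (∀ x, ε < |x| → G x = 0) → HasCompactSupport G := fun {G} h =>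
    HasCompactSupport.intro (isCompact_Icc (a := -ε) (b := ε)) (fun x hx => h x (by
      by_contra h0; exact hx (abs_le.1 (not_lt.1 h0))))
  have I3 : ∫ x, G3 x ≤ 3 := by
    have : ∫ x, G3 x ≤ ∫ x, G1 x * 3 := by
      refine integral_mono (c3.integrable_of_hasCompactSupport (cpt z3)) ((c1.integrable_of_hasCompactSupport (cpt z1)).mul_const 3) (fun x => ?_)
      by_cases hx : ε < |x|
      · simp [z1 x hx, z3 x hx]
      · simp only [hG1, hG3]
        gcongr
        have q1 := (abs_le.1 (not_lt.1 hx)).2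
        have q2 := exp_sub_one_le (x := 1) zero_le_one le_rfl
        calc exp (2 * x) ≤ exp 1 := by gcongr; linarith
          _ ≤ 3 := by linarith
    rw [integral_mul_const, I1] at this; linarith
  have I20 : 0 ≤ ∫ x, G2 x := integral_nonneg fun x => by positivity
  have fa : ∀ i ∈ I, _ := fun i hi => fubGH c1 c1 z1 z1 (nf_good (he i hi)).1 (nf_good (he i hi)).2.1 (nf_good (he i hi)).2.2
  have fb : ∀ i ∈ I, _ := fun i hi => fubGH c1 c1 z1 z1 (qf_good h1 h2 (he i hi)).1 (qf_good h1 h2 (he i hi)).2.1 (qf_good h1 h2 (he i hi)).2.2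
  have fc : ∀ i ∈ I, _ := fun i hi => fubGH c2 c3 z2 z3 (nf_good (he i hi)).1 (nf_good (he i hi)).2.1 (nf_good (he i hi)).2.2
  have fd : ∀ i ∈ I, _ := fun i hi => fubGH c1 c2 z1 z2 (nf_good (he i hi)).1 (nf_good (he i hi)).2.1 (nf_good (he i hi)).2.2
  have fe := fubGH c1 c1 z1 z1 hΓ hΓc hΓs
  have hη' : 0 ≤ 1 + 1 / η := by positivity
  have pz : ∀ z, ∀ i ∈ I, exp (-z.2) * qf A1 A2 (cm (chi g z) (e i)) ≤
      (1 + η) * (∫ p, Wk G1 G1 z p * (‖E1 A1 (e i) p‖ ^ 2 + ‖E2 A2 (e i) p‖ ^ 2)) +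
      (1 + 1 / η) * ((∫ p, Wk G2 G3 z p * (‖e i p‖ ^ 2 / p.2 ^ 2)) + ∫ p, Wk G1 G2 z p * (‖e i p‖ ^ 2 / p.2 ^ 2)) := by
    intro z i hi
    obtain ⟨k1, k2, k3⟩ := chi_props hg z
    have gq := qf_good h1 h2 (he i hi)
    have gn := nf_good (he i hi)
    have ib := Wk_int c1 c1 gq.1 gq.2.1 gq.2.2 z
    have ic := Wk_int c2 c3 gn.1 gn.2.1 gn.2.2 z
    have id := Wk_int c1 c2 gn.1 gn.2.1 gn.2.2 z
    have icd : Integrable (fun p => Wk G2 G3 z p * (‖e i p‖ ^ 2 / p.2 ^ 2) + Wk G1 G2 z p * (‖e i p‖ ^ 2 / p.2 ^ 2)) := ic.add id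
    unfold qf
    rw [← integral_add ic id, ← integral_const_mul, ← integral_const_mul, ← integral_const_mul, ← integral_add (ib.const_mul _) (icd.const_mul _)]
    refine integral_mono ((qf_int h1 h2 (cm_EU k1 (he i hi))).const_mul _) ((ib.const_mul _).add (icd.const_mul _)) (fun p => ?_)
    simp only
    obtain ⟨e1, e2⟩ := cm_E (A1 := A1) (A2 := A2) k1 (he i hi) p
    rw [e1, e2]
    by_cases hp : 0 < p.2
    · obtain ⟨d1, d2⟩ := k3 p hp
      have y1 := young ((chi g z p : ℂ) * E1 A1 (e i) p) (-Complex.I * dXr (chi g z) p * e i p) hη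
      have y2 := young ((chi g z p : ℂ) * E2 A2 (e i) p) (-Complex.I * dYr (chi g z) p * e i p) hη
      simp only [norm_mul, norm_neg, Complex.norm_I, one_mul, mul_pow, Complex.norm_real, Real.norm_eq_abs, sq_abs] at y1 y2
      have w1 : Wk G1 G1 z p = exp (-z.2) * chi g z p ^ 2 := by
        unfold Wk chi; rw [if_pos hp]; simp only [hG1]; ring
      have w2 : Wk G2 G3 z p / p.2 ^ 2 = exp (-z.2) * dXr (chi g z) p ^ 2 := by
        rw [d1]; unfold Wk; simp only [hG2, hG3]
        have : exp (2 * (log p.2 - z.2)) = p.2 ^ 2 * exp (-z.2) ^ 2 := by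
          rw [show 2 * (log p.2 - z.2) = log p.2 + log p.2 + (-z.2 + -z.2) by ring, exp_add, exp_add, exp_add, exp_log hp]; ring
        rw [this]; field_simp
      have w3 : Wk G1 G2 z p / p.2 ^ 2 = exp (-z.2) * dYr (chi g z) p ^ 2 := by
        rw [d2]; unfold Wk; simp only [hG1, hG2]; field_simp
      have w4 : Wk G2 G3 z p * (‖e i p‖ ^ 2 / p.2 ^ 2) = exp (-z.2) * dXr (chi g z) p ^ 2 * ‖e i p‖ ^ 2 := by rw [← w2]; ring
      have w5 : Wk G1 G2 z p * (‖e i p‖ ^ 2 / p.2 ^ 2) = exp (-z.2) * dYr (chi g z) p ^ 2 * ‖e i p‖ ^ 2 := by rw [← w3]; ring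
      rw [w1, w4, w5]
      have := mul_le_mul_of_nonneg_left (add_le_add y1 y2) (exp_pos (-z.2)).le
      refine this.trans (le_of_eq ?_); ring
    · have : p ∉ tsupport (e i) := fun h => hp ((he i hi).2 h)
      rw [E1_zero this, E2_zero this, image_eq_zero_of_notMem_tsupport this]; simp
  have pz2 : ∀ z, ∑ i ∈ I, (l * (∫ p, Wk G1 G1 z p * (‖e i p‖ ^ 2 / p.2 ^ 2)) -
      ((1 + η) * (∫ p, Wk G1 G1 z p * (‖E1 A1 (e i) p‖ ^ 2 + ‖E2 A2 (e i) p‖ ^ 2)) +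
      (1 + 1 / η) * ((∫ p, Wk G2 G3 z p * (‖e i p‖ ^ 2 / p.2 ^ 2)) + ∫ p, Wk G1 G2 z p * (‖e i p‖ ^ 2 / p.2 ^ 2)))) ≤
      ∫ p, Wk G1 G1 z p * Γ p := by
    intro z
    have r1 : ∫ p, Wk G1 G1 z p * Γ p = exp (-z.2) * ∫ p, chi g z p ^ 2 * Γ p := by
      rw [← integral_const_mul]; congr 1; ext p; exact Wk_chi g hΓs z p
    rw [r1]
    refine le_trans ?_ (mul_le_mul_of_nonneg_left (hloc z) (exp_pos _).le)
    rw [Finset.mul_sum]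
    refine Finset.sum_le_sum fun i hi => ?_
    have r2 : ∫ p, Wk G1 G1 z p * (‖e i p‖ ^ 2 / p.2 ^ 2) = exp (-z.2) * nf (cm (chi g z) (e i)) := by
      unfold nf
      rw [← integral_const_mul]; congr 1; ext p
      rw [Wk_chi g (nf_good (he i hi)).2.2 z p]
      unfold cm; rw [norm_mul, mul_pow, Complex.norm_real, Real.norm_eq_abs, sq_abs]; ring
    rw [r2]
    have := pz z i hi
    linarith
  have fcd : ∀ i ∈ I, Integrable (fun z => (∫ p, Wk G2 G3 z p * (‖e i p‖ ^ 2 / p.2 ^ 2)) + ∫ p, Wk G1 G2 z p * (‖e i p‖ ^ 2 / p.2 ^ 2)) :=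
    fun i hi => (fc i hi).1.add (fd i hi).1
  have fbcd : ∀ i ∈ I, Integrable (fun z => ((1 + η) * (∫ p, Wk G1 G1 z p * (‖E1 A1 (e i) p‖ ^ 2 + ‖E2 A2 (e i) p‖ ^ 2)) +
      (1 + 1 / η) * ((∫ p, Wk G2 G3 z p * (‖e i p‖ ^ 2 / p.2 ^ 2)) + ∫ p, Wk G1 G2 z p * (‖e i p‖ ^ 2 / p.2 ^ 2)))) :=
    fun i hi => ((fb i hi).1.const_mul (1 + η)).add ((fcd i hi).const_mul (1 + 1 / η))
  have key := integral_mono (integrable_finsetSum I fun i hi => ((fa i hi).1.const_mul l).sub (fbcd i hi)) fe.1 pz2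
  rw [fe.2, I1, one_mul, one_mul] at key
  refine le_trans ?_ key
  rw [integral_finsetSum I fun i hi => ((fa i hi).1.const_mul l).sub (fbcd i hi)]
  refine Finset.sum_le_sum fun i hi => ?_
  simp only [Pi.sub_apply]
  rw [integral_sub ((fa i hi).1.const_mul l) (fbcd i hi), integral_const_mul]
  have s1 : ∫ z, ((1 + η) * (∫ p, Wk G1 G1 z p * (‖E1 A1 (e i) p‖ ^ 2 + ‖E2 A2 (e i) p‖ ^ 2)) +
      (1 + 1 / η) * ((∫ p, Wk G2 G3 z p * (‖e i p‖ ^ 2 / p.2 ^ 2)) + ∫ p, Wk G1 G2 z p * (‖e i p‖ ^ 2 / p.2 ^ 2))) =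
      (1 + η) * qf A1 A2 (e i) + (1 + 1 / η) * (((∫ x, G2 x) * ∫ x, G3 x) * nf (e i) + (∫ x, G2 x) * nf (e i)) := by
    rw [integral_add ((fb i hi).1.const_mul (1 + η)) ((fcd i hi).const_mul (1 + 1 / η)),
      integral_const_mul, integral_const_mul, (fb i hi).2, I1,
      integral_add (fc i hi).1 (fd i hi).1, (fc i hi).2, (fd i hi).2, I1]
    simp only [one_mul]; rfl
  have s2 : ∫ z, (∫ p, Wk G1 G1 z p * (‖e i p‖ ^ 2 / p.2 ^ 2)) = nf (e i) := by rw [(fa i hi).2, I1]; simp [nf]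
  rw [s2, s1]
  have hn := nf_nonneg (e i)
  have t1 : (∫ x, G2 x) * (∫ x, G3 x) * nf (e i) + (∫ x, G2 x) * nf (e i) ≤ (4 * K / ε ^ 2) * nf (e i) := by
    rw [← add_mul]
    gcongr
    have : (∫ x, G2 x) * (∫ x, G3 x) ≤ (K / ε ^ 2) * 3 := by
      refine mul_le_mul I2 I3 (integral_nonneg fun x => by positivity) (I20.trans I2)
    calc _ ≤ (K / ε ^ 2) * 3 + K / ε ^ 2 := by linarith
      _ = _ := by ring
  have := mul_le_mul_of_nonneg_left t1 hη'
  linarith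
end SP5c

section SP6a
lemma par {η δ C₀ K M : ℝ} (hη : 0 < η) (hδ : 0 < δ) (hC : 0 < C₀) (hK : 0 < K) (hM : 0 < M) :
    ∃ L0 > 0, ∀ l ≥ L0, ∃ ε, 0 < ε ∧ ε ≤ δ ∧ (1 + 1 / η) * (3 * ((288 * C₀ + 6) * (ε * (M * l) + 1) * ε) ^ 2) ≤ η * l ∧
      (1 + 1 / η) * (4 * K / ε ^ 2) ≤ η * l := by
  set D := (1 + 1 / η) / η * (3 * ((288 * C₀ + 6) * (M + 1)) ^ 2 + 4 * K) with hD
  have hD0 : 0 < D := by positivity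
  refine ⟨(1 + 1 / δ + D) ^ 3, by positivity, fun l hl => ?_⟩
  have hl0 : 0 < l := lt_of_lt_of_le (by positivity) hl
  obtain ⟨x, hx0, hx3⟩ : ∃ x : ℝ, 0 < x ∧ x ^ 3 = l := ⟨l ^ (1 / 3 : ℝ), by positivity, by
    rw [← Real.rpow_natCast, ← Real.rpow_mul hl0.le]; norm_num⟩
  have hxl : 1 + 1 / δ + D ≤ x := by
    rw [← hx3] at hl
    exact le_of_pow_le_pow_left₀ (by norm_num) hx0.le hl
  have h1δ : 0 < 1 / δ := by positivity
  have hDx : (1 + 1 / η) * (3 * ((288 * C₀ + 6) * (M + 1)) ^ 2 + 4 * K) ≤ η * x := by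
    have : D ≤ x := by linarith
    have := mul_le_mul_of_nonneg_left this hη.le
    refine le_trans (le_of_eq ?_) this
    rw [hD]; field_simp
  have hDx2 := mul_le_mul_of_nonneg_right hDx (sq_nonneg x)
  have hp : 0 < 1 + 1 / η := by positivity
  refine ⟨1 / x, by positivity, ?_, ?_, ?_⟩
  · rw [div_le_iff₀ hx0]
    have : δ * (1 / δ) ≤ δ * x := by gcongr; linarith
    rwa [mul_one_div_cancel hδ.ne'] at this
  · have a : (288 * C₀ + 6) * (1 / x * (M * l) + 1) * (1 / x) ≤ (288 * C₀ + 6) * (M + 1) * x := by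
      have h1 : 1 / x * (M * l) = M * x ^ 2 := by rw [← hx3]; field_simp
      rw [h1, mul_assoc, mul_assoc]
      refine mul_le_mul_of_nonneg_left ?_ (by positivity)
      rw [mul_one_div, div_le_iff₀ hx0]
      have : 1 ≤ x := by linarith
      nlinarith
    calc (1 + 1 / η) * (3 * ((288 * C₀ + 6) * (1 / x * (M * l) + 1) * (1 / x)) ^ 2)
        ≤ (1 + 1 / η) * (3 * ((288 * C₀ + 6) * (M + 1) * x) ^ 2) :=
          mul_le_mul_of_nonneg_left (mul_le_mul_of_nonneg_left (pow_le_pow_left₀ (by positivity) a 2) (by norm_num)) hp.le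
      _ ≤ (1 + 1 / η) * (3 * ((288 * C₀ + 6) * (M + 1)) ^ 2 + 4 * K) * x ^ 2 := by
        have : 0 ≤ (1 + 1 / η) * (4 * K) * x ^ 2 := by positivity
        linear_combination this
      _ ≤ η * x * x ^ 2 := hDx2
      _ = η * l := by rw [← hx3]; ring
  · calc (1 + 1 / η) * (4 * K / (1 / x) ^ 2) = (1 + 1 / η) * (4 * K) * x ^ 2 := by
          rw [one_div x, inv_pow, div_inv_eq_mul]; ring
      _ ≤ (1 + 1 / η) * (3 * ((288 * C₀ + 6) * (M + 1)) ^ 2 + 4 * K) * x ^ 2 := by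
        have : 0 ≤ (1 + 1 / η) * (3 * ((288 * C₀ + 6) * (M + 1)) ^ 2) * x ^ 2 := by positivity
        linear_combination this
      _ ≤ η * x * x ^ 2 := hDx2
      _ = η * l := by rw [← hx3]; ring

lemma beta_cmp {A1 A2 : R2 → ℝ} (h1 : ContDiffOn ℝ 2 A1 UHP) (h2 : ContDiffOn ℝ 2 A2 UHP) {C₀ : ℝ} (hC : 0 < C₀)
    (hH : H2 C₀ A1 A2) {s t ε κ : ℝ} (ht : 0 < t) (hε : 0 < ε) (hε1 : ε ≤ 1) (hκ : κ ≤ 1) (hεC : 192 * C₀ * ε ≤ κ)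
    {p : R2} (hp : p ∈ bx s t ε) :
    beta A1 A2 p ≤ (1 + κ) * beta A1 A2 (s, t) ∧ beta A1 A2 (s, t) ≤ (1 + κ) * beta A1 A2 p := by
  have h := locB h1 h2 hC hH ht hε hε1 (by linarith [mul_pos hC hε]) hp
  have hb := one_le_beta A1 A2 (s, t)
  have hb' := one_le_beta A1 A2 p
  have h0 : |beta A1 A2 p - beta A1 A2 (s, t)| ≤ κ / 2 * beta A1 A2 (s, t) := by
    have q1 : |beta A1 A2 p - beta A1 A2 (s, t)| ≤ |intenB A1 A2 p - intenB A1 A2 (s, t)| := abs_max_sub_max_le_abs _ _ _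
    have q2 : |intenB A1 A2 p - intenB A1 A2 (s, t)| ≤ |fieldB A1 A2 p - fieldB A1 A2 (s, t)| := abs_abs_sub_abs_le_abs_sub _ _
    refine q1.trans (q2.trans (h.trans ?_))
    gcongr; linarith
  have hκ0 : 0 < κ := lt_of_lt_of_le (by positivity) hεC
  obtain ⟨a, b⟩ := abs_le.1 h0
  constructor
  · linarith
  · nlinarith

def GG (β L : ℝ) : ℝ := β / (2 * π) * ∑ k ∈ Finset.range ⌈L⌉₊, max (L - (2 * k + 1) * β) 0

lemma GG_nonneg {β L : ℝ} (hβ : 0 ≤ β) : 0 ≤ GG β L := by unfold GG; positivity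

lemma GG_cmp {β β' κ L L' : ℝ} (hβ : 1 ≤ β) (hβ' : 1 ≤ β') (hκ : 0 ≤ κ) (a : β' ≤ (1 + κ) * β) (b : β ≤ (1 + κ) * β') (hL0 : 0 ≤ L) (hL : (1 + κ) * L ≤ L') :
    GG β' L ≤ GG β L' := by
  have hLL : L ≤ L' := by nlinarith
  unfold GG
  rw [div_mul_eq_mul_div, div_mul_eq_mul_div]
  refine div_le_div_of_nonneg_right ?_ (by positivity)
  rw [Finset.mul_sum, Finset.mul_sum]
  refine (Finset.sum_le_sum fun k _ => ?_).trans (Finset.sum_le_sum_of_subset_of_nonneg (Finset.range_mono (Nat.ceil_le_ceil hLL)) fun k _ _ => ?_)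
  · have hk : (0:ℝ) ≤ 2 * k + 1 := by positivity
    by_cases h : L - (2 * k + 1) * β' ≤ 0
    · rw [max_eq_right h, mul_zero]; positivity
    push Not at h
    rw [max_eq_left h.le]
    refine le_trans ?_ (mul_le_mul_of_nonneg_left (le_max_left _ _) (by linarith))
    have q1 : L' - (2 * k + 1) * β ≥ (1 + κ) * (L - (2 * k + 1) * β') := by nlinarith
    calc β' * (L - (2 * k + 1) * β') ≤ (1 + κ) * β * (L - (2 * k + 1) * β') := by gcongr
      _ = β * ((1 + κ) * (L - (2 * k + 1) * β')) := by ring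
      _ ≤ _ := by gcongr
  · positivity

lemma GG_zero {β L : ℝ} (h : L ≤ β) (hβ : 0 ≤ β) : GG β L = 0 := by
  unfold GG
  rw [Finset.sum_eq_zero, mul_zero]
  intro k _
  refine max_eq_right ?_
  have : (0:ℝ) ≤ k := by positivity
  nlinarith

lemma beta_cont {A1 A2 : R2 → ℝ} (h1 : ContDiffOn ℝ 2 A1 UHP) (h2 : ContDiffOn ℝ 2 A2 UHP) : ContinuousOn (beta A1 A2) UHP :=
  ContinuousOn.sup ((fieldB_cd h1 h2).continuousOn.abs) continuousOn_const

lemma hD_rect (R : ℝ) : ∃ D > 0, ∀ p ∈ UHP, hDist p < R → p ∈ Set.Icc (-D) D ×ˢ Set.Icc (1 / D) D := by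
  set S := sinh (R / 2) with hS
  refine ⟨4 * S ^ 2 + 2, by positivity, fun p hp hd => ?_⟩
  have hp' : 0 < p.2 := hp
  unfold hDist at hd
  have h1 : √(p.1 ^ 2 + (p.2 - 1) ^ 2) / (2 * √p.2) < S := by
    rw [hS, ← sinh_arsinh (√(p.1 ^ 2 + (p.2 - 1) ^ 2) / (2 * √p.2)), sinh_lt_sinh]; linarith
  have hs : 0 < √p.2 := sqrt_pos.2 hp'
  rw [div_lt_iff₀ (by positivity)] at h1
  have h2 : p.1 ^ 2 + (p.2 - 1) ^ 2 ≤ 4 * S ^ 2 * p.2 := by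
    have := pow_le_pow_left₀ (sqrt_nonneg _) h1.le 2
    rw [sq_sqrt (by positivity), mul_pow, mul_pow, sq_sqrt hp'.le] at this
    linarith
  set D := 4 * S ^ 2 + 2
  have hD : 0 < D := by positivity
  have h3 : p.2 ≤ D := by
    have : p.2 ^ 2 ≤ D * p.2 := by linarith [sq_nonneg p.1]
    by_contra h; push Not at h; nlinarith
  have h4 : p.1 ^ 2 ≤ D ^ 2 := by nlinarith [sq_nonneg (p.2 - 1), sq_nonneg S]
  have h5 := abs_le_of_sq_le_sq' h4 hD.le
  refine ⟨⟨h5.1, h5.2⟩, ⟨?_, h3⟩⟩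
  rw [div_le_iff₀ hD]; linarith [sq_nonneg p.1, sq_nonneg p.2]

lemma beta_cpt {A1 A2 : R2 → ℝ} (h1 : ContDiffOn ℝ 2 A1 UHP) (h2 : ContDiffOn ℝ 2 A2 UHP) (hH1 : H1 A1 A2) (L : ℝ) :
    IsCompact {p | p ∈ UHP ∧ beta A1 A2 p ≤ L} := by
  obtain ⟨R, hR⟩ := hH1 (L + 1)
  obtain ⟨D, hD, hrect⟩ := hD_rect R
  have hc : IsCompact (Set.Icc (-D) D ×ˢ Set.Icc (1 / D) D) := isCompact_Icc.prod isCompact_Icc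
  have hsub : Set.Icc (-D) D ×ˢ Set.Icc (1 / D) D ⊆ UHP := fun p hp => lt_of_lt_of_le (by positivity) hp.2.1
  have : {p | p ∈ UHP ∧ beta A1 A2 p ≤ L} = (Set.Icc (-D) D ×ˢ Set.Icc (1 / D) D) ∩ beta A1 A2 ⁻¹' Set.Iic L := by
    ext p; constructor
    · rintro ⟨hp, hb⟩
      refine ⟨hrect p hp ?_, hb⟩
      by_contra h
      have := hR p hp (not_lt.1 h)
      have : intenB A1 A2 p ≤ beta A1 A2 p := le_max_left _ _
      linarith
    · rintro ⟨hp, hb⟩; exact ⟨hsub hp, hb⟩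
  rw [this]
  exact hc.of_isClosed_subset (((beta_cont h1 h2).mono hsub).preimage_isClosed_of_isClosed hc.isClosed isClosed_Iic) Set.inter_subset_left

def Gam (A1 A2 : R2 → ℝ) (L : ℝ) (p : R2) : ℝ := if 0 < p.2 then GG (beta A1 A2 p) L / p.2 ^ 2 else 0

lemma Gam_nonneg (A1 A2 : R2 → ℝ) (L : ℝ) (p : R2) : 0 ≤ Gam A1 A2 L p := by
  unfold Gam; split_ifs
  · exact div_nonneg (GG_nonneg (zero_le_one.trans (one_le_beta _ _ _))) (sq_nonneg _)
  · exact le_rfl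

lemma Gam_good {A1 A2 : R2 → ℝ} (h1 : ContDiffOn ℝ 2 A1 UHP) (h2 : ContDiffOn ℝ 2 A2 UHP) (hH1 : H1 A1 A2) (L : ℝ) :
    Continuous (Gam A1 A2 L) ∧ HasCompactSupport (Gam A1 A2 L) ∧ tsupport (Gam A1 A2 L) ⊆ UHP := by
  have hc := beta_cpt h1 h2 hH1 L
  have hts : tsupport (Gam A1 A2 L) ⊆ {p | p ∈ UHP ∧ beta A1 A2 p ≤ L} := by
    refine closure_minimal (fun p hp => ?_) hc.isClosed
    by_contra h
    refine hp ?_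
    unfold Gam; split_ifs with h0
    · rw [GG_zero, zero_div]
      · by_contra h3; exact h ⟨h0, (not_le.1 h3).le⟩
      · exact zero_le_one.trans (one_le_beta _ _ _)
    · rfl
  refine ⟨?_, hc.of_isClosed_subset (isClosed_tsupport _) hts, hts.trans fun p hp => hp.1⟩
  refine ContinuousOn.continuous_of_tsupport_subset (s := UHP) ?_ UHP_open (hts.trans fun p hp => hp.1)
  have hb := beta_cont h1 h2
  have : ContinuousOn (fun p : R2 => GG (beta A1 A2 p) L / p.2 ^ 2) UHP := by
    unfold GG
    refine ContinuousOn.div (ContinuousOn.mul (hb.div_const _) (continuousOn_finsetSum _ fun k _ => ?_)) (by fun_prop) (fun p hp => (pow_pos hp 2).ne')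
    exact ContinuousOn.sup (continuousOn_const.sub (continuousOn_const.mul hb)) continuousOn_const
  exact this.congr fun p hp => by unfold Gam; exact if_pos hp
end SP6a

section SP6b
lemma ee_neg_mul (a : ℝ) : ee a * ee (-a) = 1 := by
  unfold ee; rw [← Complex.exp_add, Complex.ofReal_neg]; simp

lemma gm_ts (φ : R2 → ℝ) (u : R2 → ℂ) : tsupport (fun p => ee (φ p) * u p) ⊆ tsupport u := tsupport_mul_subset_right

lemma gm_nf (φ : R2 → ℝ) (u : R2 → ℂ) : nf (fun p => ee (φ p) * u p) = nf u ∧ ∫ p, ‖ee (φ p) * u p‖ ^ 2 = ∫ p, ‖u p‖ ^ 2 := by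
  unfold nf; simp only [norm_mul, ee_norm, one_mul, and_self]

lemma nf_box {s t ε : ℝ} (ht : 0 < t) (hε : 0 < ε) (hε1 : ε ≤ 1/2) {u : R2 → ℂ} (hu : EU u) (hs : tsupport u ⊆ bx s t ε) :
    t ^ 2 * nf u ≤ exp (2 * ε) * ∫ p, ‖u p‖ ^ 2 ∧ ∫ p, ‖u p‖ ^ 2 ≤ exp (2 * ε) * (t ^ 2 * nf u) := by
  have i1 := sq_int hu.1.1.continuous hu.1.2
  have i2 := nf_int hu
  unfold nf
  constructor
  · rw [← integral_const_mul, ← integral_const_mul]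
    refine integral_mono (i2.const_mul _) (i1.const_mul _) fun p => ?_
    by_cases hp : p ∈ tsupport u
    · have := (y_ratio ht hε hε1 (hs hp)).1
      have := mul_le_mul_of_nonneg_right this (sq_nonneg ‖u p‖)
      refine le_trans (le_of_eq ?_) this; ring
    · simp [image_eq_zero_of_notMem_tsupport hp]
  · rw [← integral_const_mul, ← integral_const_mul]
    refine integral_mono i1 ((i2.const_mul _).const_mul _) fun p => ?_
    by_cases hp : p ∈ tsupport u
    · have := (y_ratio ht hε hε1 (hs hp)).2.1
      have := mul_le_mul_of_nonneg_right this (mul_nonneg (exp_pos (2 * ε)).le (sq_nonneg ‖u p‖))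
      rw [← mul_assoc, ← exp_add, neg_add_cancel, exp_zero, one_mul] at this
      refine this.trans (le_of_eq ?_); ring
    · simp [image_eq_zero_of_notMem_tsupport hp]

lemma Loc2 {A1 A2 : R2 → ℝ} (h1 : ContDiffOn ℝ 2 A1 UHP) (h2 : ContDiffOn ℝ 2 A2 UHP) {C₀ : ℝ} (hC : 0 < C₀)
    (hH : H2 C₀ A1 A2) {s t ε : ℝ} (ht : 0 < t) (hε : 0 < ε) (hε1 : ε ≤ 1/2) (hεC : 24 * C₀ * ε ≤ 1) :
    ∃ φ : R2 → ℝ, ContDiffOn ℝ 1 φ UHP ∧ ∀ u, EU u → tsupport u ⊆ bx s t ε →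
      EU (fun p => ee (φ p) * u p) ∧ ∀ η > 0, ∀ T ≥ beta A1 A2 (s, t),
      q0 (Bz A1 A2 (s, t) / t ^ 2) (fun p => ee (φ p) * u p) ≤ (1 + η) * qf A1 A2 u +
        (1 + 1 / η) * (3 * ((288 * C₀ + 6) * (ε * T + 1) * ε) ^ 2) * nf u := by
  obtain ⟨φ, hφ, h⟩ := Loc h1 h2 hC hH (s := s) ht hε hε1 hεC
  refine ⟨fun p => -φ p, hφ.neg, fun u hu hs => ⟨gm_EU hφ.neg hu, fun η hη T hT => ?_⟩⟩
  have := (h _ (gm_EU hφ.neg hu) ((gm_ts _ _).trans hs) η hη).1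
  simp only [← mul_assoc, ee_neg_mul, one_mul] at this
  simp only [(gm_nf (fun p => -φ p) u).1] at this
  refine this.trans ?_
  have hb := one_le_beta A1 A2 (s, t)
  have hn := nf_nonneg u
  simp only [mul_assoc]
  gcongr

lemma Big {A1 A2 : R2 → ℝ} (h1 : ContDiffOn ℝ 2 A1 UHP) (h2 : ContDiffOn ℝ 2 A2 UHP) {C₀ : ℝ} (hC : 0 < C₀) (hH : H2 C₀ A1 A2) :
    ∃ M0 > 0, ∀ M ≥ M0, ∀ u, EU u → (∀ p ∈ tsupport u, M ≤ beta A1 A2 p ∧ beta A1 A2 p ≤ 3 * M) → M / 20 * nf u ≤ qf A1 A2 u := by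
  obtain ⟨K, hK, hcut⟩ := cut_ex
  obtain ⟨M0, hM0, hpar⟩ := par (η := 1/10) (δ := min (1/2) (1 / (1920 * C₀))) (M := 4) (by norm_num) (by positivity) hC hK (by norm_num)
  refine ⟨M0, hM0, fun M hM u hu hb => ?_⟩
  obtain ⟨ε, hε, hεδ, p1, p2⟩ := hpar M hM
  obtain ⟨g, hg⟩ := hcut ε hε
  have hM' : 0 < M := lt_of_lt_of_le hM0 hM
  have hε1 : ε ≤ 1/2 := hεδ.trans (min_le_left _ _)
  have hεC : 192 * C₀ * ε ≤ 1 / 10 := by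
    have := mul_le_mul_of_nonneg_left (hεδ.trans (min_le_right _ _)) (by positivity : 0 ≤ 192 * C₀)
    refine this.trans (le_of_eq ?_); field_simp; norm_num
  have c1 := h1.continuousOn
  have c2 := h2.continuousOn
  have key := IMS c1 c2 hg hε1 hε ({()} : Finset Unit) (fun _ => u) (fun _ _ => hu) (l := M / 6) (η := 1/10) (by norm_num)
    (Γ := fun _ => 0) continuous_const HasCompactSupport.zero (by simp [tsupport]) ?_
  · simp only [Finset.sum_singleton, integral_zero] at key
    have := mul_le_mul_of_nonneg_right p2 (nf_nonneg u)
    nlinarith [nf_nonneg u]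
  · intro z
    simp only [Finset.sum_singleton, mul_zero, integral_zero]
    obtain ⟨k1, k2, -⟩ := chi_props hg z
    have hE := cm_EU k1 hu
    have hts : tsupport (cm (chi g z) u) ⊆ bx z.1 (exp z.2) ε := cm_ts.trans k2
    have hts2 : tsupport (cm (chi g z) u) ⊆ tsupport u := tsupport_mul_subset_right
    set w := cm (chi g z) u with hw
    have hn := nf_nonneg w
    have hq : 0 ≤ qf A1 A2 w := integral_nonneg fun p => by positivity
    by_cases hem : (tsupport w).Nonempty
    · obtain ⟨p, hp⟩ := hem
      have ht := exp_pos z.2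
      obtain ⟨b1, b2⟩ := beta_cmp h1 h2 hC hH ht hε (by linarith) (by norm_num) hεC (hts hp)
      obtain ⟨b3, b4⟩ := hb p (hts2 hp)
      obtain ⟨φ, hφ, hl⟩ := Loc2 h1 h2 hC hH (s := z.1) ht hε hε1 (by linarith [mul_pos hC hε])
      obtain ⟨hv, hl⟩ := hl w hE hts
      have hl := hl (1/10) (by norm_num) (4 * M) (by linarith)
      have hl2 := mul_le_mul_of_nonneg_right p1 hn
      set t := exp z.2
      have ha := Bz_abs A1 A2 (z.1, t)
      have hB : Bz A1 A2 (z.1, t) / t ^ 2 ≠ 0 := by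
        refine div_ne_zero ?_ (by positivity)
        intro h0; rw [h0, abs_zero] at ha; linarith [one_le_beta A1 A2 (z.1, t)]
      have hBa : |Bz A1 A2 (z.1, t) / t ^ 2| = beta A1 A2 (z.1, t) / t ^ 2 := by
        rw [abs_div, ha, abs_of_pos (by positivity : 0 < t ^ 2)]
      obtain ⟨G, hG1, hG2, hG3⟩ := flat_one hv.1 hB 0 (L := beta A1 A2 (z.1, t) / t ^ 2) (by rw [hBa]; simp)
      have hG4 : ∫ ξ, G ξ ≤ 0 := integral_nonpos fun ξ => by simpa using hG3 ξ
      rw [← hG2, (gm_nf φ w).2] at hG4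
      have nb := (nf_box ht hε hε1 hE hts).1
      have e3 : exp (2 * ε) ≤ 3 := (y_ratio ht hε hε1 (hts hp)).2.2.2
      have hI : 0 ≤ ∫ p, ‖w p‖ ^ 2 := integral_nonneg fun p => by positivity
      have nb2 : nf w ≤ 3 * ((∫ p, ‖w p‖ ^ 2) / t ^ 2) := by
        rw [← mul_div_assoc, le_div_iff₀ (by positivity)]
        nlinarith
      have nb3 : beta A1 A2 (z.1, t) * nf w ≤ 3 * (beta A1 A2 (z.1, t) / t ^ 2 * ∫ p, ‖w p‖ ^ 2) := by
        have := mul_le_mul_of_nonneg_left nb2 (zero_le_one.trans (one_le_beta A1 A2 (z.1, t)))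
        refine this.trans (le_of_eq ?_); ring
      have nb4 : 10 / 11 * M * nf w ≤ beta A1 A2 (z.1, t) * nf w := by gcongr; linarith
      linarith
    · have : nf w = 0 := by
        unfold nf
        rw [integral_eq_zero_of_ae]
        refine Filter.Eventually.of_forall fun p => ?_
        have : w p = 0 := image_eq_zero_of_notMem_tsupport fun h => hem ⟨p, h⟩
        simp [this]
      rw [this]; linarith
end SP6b

section SP6c
lemma Bz_div {A1 A2 : R2 → ℝ} {z : R2} {t : ℝ} (ht : 0 < t) : Bz A1 A2 z / t ^ 2 ≠ 0 ∧ |Bz A1 A2 z / t ^ 2| = beta A1 A2 z / t ^ 2 := by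
  have hBa : |Bz A1 A2 z / t ^ 2| = beta A1 A2 z / t ^ 2 := by
    rw [abs_div, Bz_abs, abs_of_pos (by positivity : 0 < t ^ 2)]
  refine ⟨fun h => ?_, hBa⟩
  rw [h, abs_zero] at hBa
  have : 0 < beta A1 A2 z / t ^ 2 := div_pos (lt_of_lt_of_le one_pos (one_le_beta _ _ _)) (by positivity)
  linarith

lemma GG_eq {β l t : ℝ} (ht : 0 < t) : (∑ k ∈ Finset.range ⌈l⌉₊, max (l / t ^ 2 - (2 * k + 1) * (β / t ^ 2)) 0) * (β / t ^ 2 / (2 * π)) = GG β l / t ^ 4 := by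
  unfold GG
  have : ∀ k : ℕ, max (l / t ^ 2 - (2 * k + 1) * (β / t ^ 2)) 0 = max (l - (2 * k + 1) * β) 0 * (t ^ 2)⁻¹ := by
    intro k
    rw [max_mul_of_nonneg _ _ (by positivity), zero_mul]; congr 1; field_simp
  simp only [this, ← Finset.sum_mul]
  generalize Finset.sum (Finset.range ⌈l⌉₊) (fun k => max (l - (2 * (k:ℝ) + 1) * β) 0) = S
  field_simp

lemma exp4 {ε η : ℝ} (hε : 0 < ε) (hε1 : ε ≤ 1/4) (h : ε ≤ η) : exp (2 * ε) ≤ 1 + 4 * η ∧ exp (4 * ε) ≤ 1 + 8 * η := by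
  have a := exp_sub_one_le (x := 2 * ε) (by linarith) (by linarith)
  have b := exp_sub_one_le (x := 4 * ε) (by linarith) (by linarith)
  constructor <;> linarith

lemma num20 {η l E : ℝ} (hη : 0 < η) (hη1 : η ≤ 1/10) (hl : 0 < l) (hE0 : 0 ≤ E) (hE : E ≤ 1 + 4 * η) :
    (1 + η) * (((1 + η) * ((1 + 2 * η) * l) + η * l) * E) ≤ (1 + 20 * η) * l := by
  have e1 : η * η ≤ 1 / 10 * η := by gcongr
  have e2 : η * (η * η) ≤ 1 / 100 * η := by nlinarith
  have a0 : (1 + η) * (1 + 2 * η) + η ≤ 1 + 5 * η := by linarith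
  have a3 : (1 + η) * ((1 + 5 * η) * (1 + 4 * η)) ≤ 1 + 20 * η := by linarith
  calc (1 + η) * (((1 + η) * ((1 + 2 * η) * l) + η * l) * E) = (1 + η) * (((1 + η) * (1 + 2 * η) + η) * E) * l := by ring
    _ ≤ (1 + η) * ((1 + 5 * η) * (1 + 4 * η)) * l := by gcongr
    _ ≤ _ := by gcongr

set_option maxHeartbeats 800000 in
lemma Upper {A1 A2 : R2 → ℝ} (h1 : ContDiffOn ℝ 2 A1 UHP) (h2 : ContDiffOn ℝ 2 A2 UHP) (hH1 : H1 A1 A2) {C₀ : ℝ} (hC : 0 < C₀) (hH : H2 C₀ A1 A2)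
    {η : ℝ} (hη : 0 < η) (hη1 : η ≤ 1/10) : ∃ L0 > 0, ∀ l ≥ L0, ∀ (m : ℕ) (e : Fin m → R2 → ℂ), (∀ i, EU (e i)) →
      (∀ f : R2 → ℂ, Continuous f → HasCompactSupport f → tsupport f ⊆ UHP → ∑ i, ‖∫ p, f p * e i p‖ ^ 2 ≤ ∫ p : R2, p.2 ^ 2 * ‖f p‖ ^ 2) →
      ∑ i, (l * nf (e i) - qf A1 A2 (e i)) ≤ (1 + 8 * η) * ∫ p, Gam A1 A2 ((1 + 20 * η) * l) p := by
  obtain ⟨K, hK, hcut⟩ := cut_ex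
  obtain ⟨M0, hM0, hBig⟩ := Big h1 h2 hC hH
  obtain ⟨L0, hL0, hpar⟩ := par (η := η) (δ := min (min (1/4) η) (η / (192 * C₀))) (M := 30) hη (by positivity) hC hK (by norm_num)
  refine ⟨max L0 M0, by positivity, fun l hl m e he hbes => ?_⟩
  obtain ⟨ε, hε, hεδ, p1, p2⟩ := hpar l ((le_max_left _ _).trans hl)
  obtain ⟨g, hg⟩ := hcut ε hε
  have hl0 : 0 < l := lt_of_lt_of_le hL0 ((le_max_left _ _).trans hl)
  have hlM : M0 ≤ l := (le_max_right _ _).trans hl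
  have hε4 : ε ≤ 1/4 := hεδ.trans ((min_le_left _ _).trans (min_le_left _ _))
  have hεη : ε ≤ η := hεδ.trans ((min_le_left _ _).trans (min_le_right _ _))
  have hε1 : ε ≤ 1/2 := by linarith
  obtain ⟨x2, x4⟩ := exp4 hε hε4 hεη
  have hεC : 192 * C₀ * ε ≤ η := by
    have := mul_le_mul_of_nonneg_left (hεδ.trans (min_le_right _ _)) (by positivity : 0 ≤ 192 * C₀)
    refine this.trans (le_of_eq ?_); field_simp
  have c1 := h1.continuousOn
  have c2 := h2.continuousOn
  obtain ⟨g1, g2, g3⟩ := Gam_good h1 h2 hH1 ((1 + 20 * η) * l)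
  set Gm := Gam A1 A2 ((1 + 20 * η) * l) with hGm
  have gnn : ∀ p, 0 ≤ Gm p := fun p => Gam_nonneg _ _ _ p
  have key := IMS c1 c2 hg hε1 hε Finset.univ e (fun i _ => he i) (l := (1 + 2 * η) * l) hη
    (Γ := fun p => (1 + 8 * η) * Gm p) (by fun_prop) g2.mul_left (tsupport_mul_subset_right.trans g3) ?_
  · rw [integral_const_mul] at key
    have hR : 0 ≤ (1 + 8 * η) * ∫ p, Gm p := mul_nonneg (by linarith) (integral_nonneg gnn)
    have : (1 + η) * ∑ i, (l * nf (e i) - qf A1 A2 (e i)) ≤ (1 + 8 * η) * ∫ p, Gm p := by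
      refine le_trans ?_ key
      rw [Finset.mul_sum]
      refine Finset.sum_le_sum fun i _ => ?_
      have := mul_le_mul_of_nonneg_right p2 (nf_nonneg (e i))
      linarith
    by_cases hs : 0 ≤ ∑ i, (l * nf (e i) - qf A1 A2 (e i))
    · nlinarith
    · linarith
  · intro z
    obtain ⟨k1, k2, -⟩ := chi_props hg z
    have ht := exp_pos z.2
    have hE : ∀ i, EU (cm (chi g z) (e i)) := fun i => cm_EU k1 (he i)
    have hts : ∀ i, tsupport (cm (chi g z) (e i)) ⊆ bx z.1 (exp z.2) ε := fun i => cm_ts.trans k2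
    set w : Fin m → R2 → ℂ := fun i => cm (chi g z) (e i) with hw
    set t := exp z.2 with htd
    set β := beta A1 A2 (z.1, t) with hβ
    have hβ1 : 1 ≤ β := one_le_beta _ _ _
    have hbc : ∀ p ∈ bx z.1 t ε, _ := fun p hp => beta_cmp h1 h2 hC hH ht hε (by linarith) (by linarith) hεC hp
    by_cases hbig : 30 * l ≤ β
    · refine le_trans (Finset.sum_nonpos fun i _ => ?_) (integral_nonneg fun p => mul_nonneg (sq_nonneg _) (mul_nonneg (by linarith) (gnn p)))
      have := hBig (β / (1 + η)) (by rw [ge_iff_le, le_div_iff₀ (by linarith)]; nlinarith) (w i) (hE i) (fun p hp => by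
        obtain ⟨q1, q2⟩ := hbc p (hts i hp)
        refine ⟨by rw [div_le_iff₀ (by linarith)]; linarith, q1.trans ?_⟩
        rw [← mul_div_assoc, le_div_iff₀ (by linarith), mul_right_comm]
        gcongr
        nlinarith)
      have q3 : (1 + 2 * η) * l ≤ β / (1 + η) / 20 := by
        rw [div_div, le_div_iff₀ (by linarith)]
        have q4 : (1 + 2 * η) * (1 + η) ≤ 3 / 2 := by nlinarith
        nlinarith
      have := mul_le_mul_of_nonneg_right q3 (nf_nonneg (w i))
      show (1 + 2 * η) * l * nf (w i) - qf A1 A2 (w i) ≤ 0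
      linarith
    · push Not at hbig
      obtain ⟨φ, hφ, hl⟩ := Loc2 h1 h2 hC hH (s := z.1) ht hε hε1 (by linarith [mul_pos hC hε])
      obtain ⟨hB, hBa⟩ := Bz_div (A1 := A1) (A2 := A2) (z := (z.1, t)) ht
      set l' := ((1 + η) * ((1 + 2 * η) * l) + η * l) * exp (2 * ε) with hl'
      have hl'0 : 0 ≤ l' := by positivity
      have hl'2 : (1 + η) * l' ≤ (1 + 20 * η) * l := num20 hη hη1 hl0 (exp_pos _).le x2
      have chc : Continuous (chi g z) := k1.continuous
      have chs : HasCompactSupport (chi g z) := (bx_compact z.1 t ε).of_isClosed_subset (isClosed_tsupport _) k2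
      have iW : Integrable (fun p : R2 => p.2 ^ 2 * chi g z p ^ 2) := by
        refine Continuous.integrable_of_hasCompactSupport (by fun_prop) ?_
        have : HasCompactSupport (fun p : R2 => chi g z p ^ 2) := chs.comp_left (g := fun x : ℝ => x ^ 2) (by norm_num)
        exact this.mul_left
      have fu := flat_upper Finset.univ (fun i p => ee (φ p) * w i p) (fun i _ => (hl (w i) (hE i) (hts i)).1.1) iW hB ⌈l'⌉₊ (L := l' / t ^ 2) ?_ ?_
      · rw [hBa] at fu
        have r1 : (1 + η) * ∑ i, ((1 + 2 * η) * l * nf (w i) - qf A1 A2 (w i)) ≤ GG β l' / t ^ 4 * ∫ p : R2, p.2 ^ 2 * chi g z p ^ 2 := by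
          rw [← GG_eq ht, mul_assoc]
          refine le_trans ?_ fu
          rw [Finset.mul_sum]
          refine Finset.sum_le_sum fun i _ => ?_
          have q1 := (hl (w i) (hE i) (hts i)).2 η hη (30 * l) hbig.le
          have q2 := mul_le_mul_of_nonneg_right p1 (nf_nonneg (w i))
          have q3 := (nf_box ht hε hε1 (hE i) (hts i)).1
          rw [(gm_nf φ (w i)).2]
          have q4 : nf (w i) ≤ exp (2 * ε) / t ^ 2 * ∫ p, ‖w i p‖ ^ 2 := by
            rw [div_mul_eq_mul_div, le_div_iff₀ (by positivity), mul_comm]; exact q3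
          have q5 := mul_le_mul_of_nonneg_left q4 (by positivity : 0 ≤ (1 + η) * ((1 + 2 * η) * l) + η * l)
          have q6 : ((1 + η) * ((1 + 2 * η) * l) + η * l) * (exp (2 * ε) / t ^ 2 * ∫ p, ‖w i p‖ ^ 2) = l' / t ^ 2 * ∫ p, ‖w i p‖ ^ 2 := by rw [hl']; ring
          rw [q6] at q5
          linarith
        have hGG : 0 ≤ GG β l' := GG_nonneg (by linarith)
        have r2 : GG β l' / t ^ 4 * (∫ p : R2, p.2 ^ 2 * chi g z p ^ 2) ≤ ∫ p, chi g z p ^ 2 * ((1 + 8 * η) * Gm p) := by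
          rw [← integral_const_mul]
          refine integral_mono (iW.const_mul _) ?_ fun p => ?_
          · refine Continuous.integrable_of_hasCompactSupport (by fun_prop) ?_
            exact HasCompactSupport.mul_left (HasCompactSupport.mul_left g2)
          · simp only
            by_cases hp : p ∈ tsupport (chi g z)
            · have hpb := k2 hp
              have hp0 : 0 < p.2 := bx_sub ht hpb
              obtain ⟨b1, b2⟩ := hbc p hpb
              have G1 : GG β l' ≤ GG (beta A1 A2 p) ((1 + 20 * η) * l) := GG_cmp (one_le_beta _ _ _) hβ1 hη.le b2 b1 hl'0 hl'2
              have y1 := (y_ratio ht hε hε1 hpb).2.1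
              have y2 : (p.2 ^ 2 / t ^ 2) ≤ exp (2 * ε) := by
                have := inv_anti₀ (exp_pos _) y1
                rwa [← exp_neg, neg_neg, inv_div] at this
              have y3 : p.2 ^ 2 / t ^ 4 ≤ (1 + 8 * η) / p.2 ^ 2 := by
                rw [le_div_iff₀ (by positivity)]
                calc p.2 ^ 2 / t ^ 4 * p.2 ^ 2 = (p.2 ^ 2 / t ^ 2) ^ 2 := by field_simp
                  _ ≤ exp (2 * ε) ^ 2 := by gcongr
                  _ = exp (4 * ε) := by rw [← exp_nat_mul]; congr 1; push_cast; ring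
                  _ ≤ _ := x4
              have : Gm p = GG (beta A1 A2 p) ((1 + 20 * η) * l) / p.2 ^ 2 := by rw [hGm]; unfold Gam; rw [if_pos hp0]
              rw [this]
              calc GG β l' / t ^ 4 * (p.2 ^ 2 * chi g z p ^ 2) = chi g z p ^ 2 * (GG β l' * (p.2 ^ 2 / t ^ 4)) := by ring
                _ ≤ chi g z p ^ 2 * (GG (beta A1 A2 p) ((1 + 20 * η) * l) * ((1 + 8 * η) / p.2 ^ 2)) := by
                  refine mul_le_mul_of_nonneg_left (mul_le_mul G1 y3 (by positivity) (hGG.trans G1)) (sq_nonneg _)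
                _ = _ := by ring
            · simp [image_eq_zero_of_notMem_tsupport hp]
        have r3 : 0 ≤ ∫ p, chi g z p ^ 2 * ((1 + 8 * η) * Gm p) := integral_nonneg fun p => mul_nonneg (sq_nonneg _) (mul_nonneg (by linarith) (gnn p))
        by_cases hs : 0 ≤ ∑ i, ((1 + 2 * η) * l * nf (w i) - qf A1 A2 (w i))
        · have : ∑ i, ((1 + 2 * η) * l * nf (w i) - qf A1 A2 (w i)) ≤ ∫ p, chi g z p ^ 2 * ((1 + 8 * η) * Gm p) := by nlinarith
          exact this
        · exact le_trans (not_le.1 hs).le r3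
      · rw [hBa, ← mul_div_assoc]
        gcongr
        have := Nat.le_ceil l'
        have k0 : (0:ℝ) ≤ ⌈l'⌉₊ := by positivity
        nlinarith
      · intro f hf
        set F : R2 → ℂ := fun p => (chi g z p : ℂ) * (ee (φ p) * f p) with hF
        have hFs : tsupport F ⊆ tsupport (chi g z) := closure_minimal (fun p hp => subset_tsupport _ fun h0 => hp (by simp [hF, h0])) (isClosed_tsupport _)
        have hFU : tsupport F ⊆ UHP := hFs.trans (k2.trans (bx_sub ht))
        have hFc : Continuous F := by
          refine ContinuousOn.continuous_of_tsupport_subset (s := UHP) ?_ UHP_open hFU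
          exact (Complex.continuous_ofReal.comp chc).continuousOn.mul ((ee_cont.comp_continuousOn hφ.continuousOn).mul hf.continuousOn)
        have := hbes F hFc (chs.of_isClosed_subset (isClosed_tsupport _) hFs) hFU
        have e1 : ∀ i, ∫ p, f p * (ee (φ p) * w i p) = ∫ p, F p * e i p := fun i => by
          congr 1; ext p; simp only [hF, hw, cm]; ring
        have e2 : ∫ p : R2, p.2 ^ 2 * chi g z p ^ 2 * ‖f p‖ ^ 2 = ∫ p : R2, p.2 ^ 2 * ‖F p‖ ^ 2 := by
          congr 1; ext p; simp only [hF, norm_mul, ee_norm, one_mul, mul_pow, Complex.norm_real, Real.norm_eq_abs, sq_abs]; ring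
        simp only [e1]; rw [e2]; exact this
end SP6c

section SP7a
lemma lg (G : ℝ → ℝ) (τ : ℝ) : ∫ y, (if 0 < y then G (log y - τ) else 0) = ∫ σ, G σ * exp (σ + τ) := by
  have h1 : ∫ y, (if 0 < y then G (log y - τ) else 0) = ∫ y in Set.Ioi 0, G (log y - τ) := by
    rw [← integral_indicator measurableSet_Ioi]; rfl
  rw [h1, ← Real.range_exp, ← Set.image_univ, integral_image_eq_integral_abs_deriv_smul MeasurableSet.univ
    (fun x _ => (hasDerivAt_exp x).hasDerivWithinAt) (exp_injective.injOn), setIntegral_univ]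
  simp only [abs_exp, log_exp, smul_eq_mul]
  rw [← integral_add_right_eq_self _ τ]
  congr 1; ext x; rw [add_sub_cancel_right]; ring

lemma xg (G : ℝ → ℝ) (s τ : ℝ) : ∫ x, G ((x - s) * exp (-τ)) = exp τ * ∫ σ, G σ := by
  rw [integral_sub_right_eq_self (fun x => G (x * exp (-τ))) s, Measure.integral_comp_mul_right, abs_of_pos (by positivity), smul_eq_mul, ← exp_neg, neg_neg]

lemma gradfin {ε K τ Q D1 D2 : ℝ} (hε : 0 < ε) (hε1 : ε ≤ 1/2) (l1 : exp (τ - ε) ≤ Q) (l2 : D2 ≤ K / ε ^ 2 * exp (ε - τ))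
    (I2 : D1 ≤ K / ε ^ 2) (I20 : 0 ≤ D1) :
    (exp τ * (exp (-τ) ^ 2 * D1)) * Q + exp τ * 1 * D2 ≤ 4 * K / ε ^ 2 / exp τ ^ 2 * (exp τ * 1 * Q) := by
  have hQ : 0 < Q := lt_of_lt_of_le (exp_pos _) l1
  have hx2 : exp (ε - τ) ≤ 3 * exp (-τ) ^ 2 * Q := by
    have q2 := exp_one_lt_d9
    have q3 : exp (2 * ε) ≤ 3 := by
      calc exp (2 * ε) ≤ exp 1 := by gcongr; linarith
        _ ≤ 3 := by linarith
    calc exp (ε - τ) = exp (2 * ε) * exp (-τ) ^ 2 * exp (τ - ε) := by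
          rw [← exp_nat_mul, ← exp_add, ← exp_add]; congr 1; push_cast; ring
      _ ≤ _ := by gcongr
  have hK : 0 ≤ K / ε ^ 2 := I20.trans I2
  have hf : exp τ * (exp (-τ) ^ 2 * D1) * Q ≤ exp τ * (exp (-τ) ^ 2 * (K / ε ^ 2)) * Q := by gcongr
  have hs : exp τ * 1 * D2 ≤ exp τ * 1 * (K / ε ^ 2 * (3 * exp (-τ) ^ 2 * Q)) := by
    have := l2.trans (mul_le_mul_of_nonneg_left hx2 hK)
    gcongr
  refine (add_le_add hf hs).trans (le_of_eq ?_)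
  rw [exp_neg]; field_simp; ring

lemma sqcp {f : ℝ → ℝ} (hs : HasCompactSupport f) : HasCompactSupport (fun p => f p ^ 2) := by
  simp only [pow_two]
  exact hs.mul_left

lemma sqint {f : R2 → ℝ} (hc : Continuous f) (hs : HasCompactSupport f) : Integrable (fun p => f p ^ 2) := by
  simp only [pow_two]
  exact (hc.mul hc).integrable_of_hasCompactSupport hs.mul_left

set_option maxHeartbeats 1000000 in
lemma gradchi {g : ℝ → ℝ} {ε K : ℝ} (hg : Cut g ε K) (hε : 0 < ε) (hε1 : ε ≤ 1/2) (z : R2) :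
    0 ≤ ∫ p, chi g z p ^ 2 ∧ ∫ p, (dXr (chi g z) p ^ 2 + dYr (chi g z) p ^ 2) ≤ 4 * K / ε ^ 2 / exp z.2 ^ 2 * ∫ p, chi g z p ^ 2 := by
  obtain ⟨k1, k2, k3⟩ := chi_props hg z
  have chs : HasCompactSupport (chi g z) := (bx_compact z.1 (exp z.2) ε).of_isClosed_subset (isClosed_tsupport _) k2
  have cg : Continuous g := hg.1.continuous
  have cg' : Continuous (deriv g) := hg.1.continuous_deriv le_rfl
  have cptg : HasCompactSupport g := HasCompactSupport.intro (isCompact_Icc (a := -ε) (b := ε)) (fun x hx => hg.2.1 x (by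
      by_contra h0; exact hx (abs_le.1 (not_lt.1 h0))))
  have cptg' : HasCompactSupport (deriv g) := cptg.deriv
  have gz' : ∀ x, ε < |x| → deriv g x = 0 := by
    intro x hx
    have : g =ᶠ[nhds x] fun _ => 0 := by
      filter_upwards [continuous_abs.continuousAt.eventually (lt_mem_nhds hx)] with y hy using hg.2.1 y hy
    rw [this.deriv_eq]; simp
  have dz : ∀ p : R2, ¬ 0 < p.2 → dXr (chi g z) p = 0 ∧ dYr (chi g z) p = 0 := by
    intro p hp
    have : p ∉ tsupport (chi g z) := fun h => hp (bx_sub (exp_pos _) (k2 h))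
    have := fderiv_of_notMem_tsupport (𝕜 := ℝ) this
    unfold dXr dYr; rw [this]; simp
  have ix : Integrable (fun p => dXr (chi g z) p ^ 2) := sqint (dXr_cont k1) (dXr_cpt chs)
  have iy : Integrable (fun p => dYr (chi g z) p ^ 2) := sqint (dYr_cont k1) (dYr_cpt chs)
  obtain ⟨τ, hτ⟩ : ∃ τ, τ = z.2 := ⟨_, rfl⟩
  rw [← hτ]
  have e0 : ∫ p, chi g z p ^ 2 = (exp τ * 1) * ∫ σ, g σ ^ 2 * exp (σ + τ) := by
    rw [← hg.2.2.1, ← xg (fun x => g x ^ 2) z.1, ← lg (fun x => g x ^ 2), ← integral_prod_mul, Measure.volume_eq_prod]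
    congr 1; ext p; unfold chi; rw [← hτ]; split_ifs <;> ring
  have e1 : ∫ p, dXr (chi g z) p ^ 2 = (exp τ * ∫ x, exp (-τ) ^ 2 * deriv g x ^ 2) * ∫ σ, g σ ^ 2 * exp (σ + τ) := by
    rw [← xg (fun x => exp (-τ) ^ 2 * deriv g x ^ 2) z.1, ← lg (fun x => g x ^ 2), ← integral_prod_mul, Measure.volume_eq_prod]
    congr 1; ext p
    by_cases hp : 0 < p.2
    · rw [(k3 p hp).1, if_pos hp, ← hτ]; ring
    · rw [(dz p hp).1, if_neg hp]; ring
  have e2 : ∫ p, dYr (chi g z) p ^ 2 = (exp τ * 1) * ∫ σ, (deriv g σ ^ 2 * exp (-(2 * (σ + τ)))) * exp (σ + τ) := by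
    rw [← hg.2.2.1, ← xg (fun x => g x ^ 2) z.1, ← lg (fun x => deriv g x ^ 2 * exp (-(2 * (x + τ)))), ← integral_prod_mul, Measure.volume_eq_prod]
    congr 1; ext p
    by_cases hp : 0 < p.2
    · rw [(k3 p hp).2, if_pos hp, ← hτ, sub_add_cancel, exp_neg (2 * _), two_mul, exp_add, exp_log hp]; field_simp
    · rw [(dz p hp).2, if_neg hp]; ring
  have I2 : ∫ x, deriv g x ^ 2 ≤ K / ε ^ 2 := hg.2.2.2
  have I20 : 0 ≤ ∫ x, deriv g x ^ 2 := integral_nonneg fun x => by positivity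
  have ig : Integrable (fun x => g x ^ 2) := (cg.pow 2).integrable_of_hasCompactSupport (sqcp cptg)
  have ig' : Integrable (fun x => deriv g x ^ 2) := (cg'.pow 2).integrable_of_hasCompactSupport (sqcp cptg')
  have l1 : exp (τ - ε) ≤ ∫ σ, g σ ^ 2 * exp (σ + τ) := by
    have : ∫ σ, g σ ^ 2 * exp (τ - ε) ≤ ∫ σ, g σ ^ 2 * exp (σ + τ) := by
      refine integral_mono (ig.mul_const _) ?_ fun x => ?_
      · exact (by fun_prop : Continuous fun σ => g σ ^ 2 * exp (σ + τ)).integrable_of_hasCompactSupport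
          (HasCompactSupport.mul_right (sqcp cptg))
      · by_cases hx : ε < |x|
        · simp [hg.2.1 x hx]
        · simp only
          have := (abs_le.1 (not_lt.1 hx)).1
          gcongr; linarith
    rwa [integral_mul_const, hg.2.2.1, one_mul] at this
  have l2 : ∫ σ, (deriv g σ ^ 2 * exp (-(2 * (σ + τ)))) * exp (σ + τ) ≤ K / ε ^ 2 * exp (ε - τ) := by
    have : ∫ σ, (deriv g σ ^ 2 * exp (-(2 * (σ + τ)))) * exp (σ + τ) ≤ ∫ σ, deriv g σ ^ 2 * exp (ε - τ) := by
      refine integral_mono ?_ (ig'.mul_const _) fun x => ?_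
      · exact (by fun_prop : Continuous fun σ => (deriv g σ ^ 2 * exp (-(2 * (σ + τ)))) * exp (σ + τ)).integrable_of_hasCompactSupport
          (HasCompactSupport.mul_right (HasCompactSupport.mul_right (sqcp cptg')))
      · by_cases hx : ε < |x|
        · simp [gz' x hx]
        · simp only
          have := (abs_le.1 (not_lt.1 hx)).1
          rw [mul_assoc, ← exp_add]
          gcongr; linarith
    rw [integral_mul_const] at this
    refine this.trans ?_
    gcongr
  refine ⟨integral_nonneg fun p => sq_nonneg _, ?_⟩
  rw [integral_const_mul] at e1
  have hsum := integral_add ix iy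
  rw [e1, e2] at hsum
  rw [e0, hsum]
  exact gradfin hε hε1 l1 l2 I2 I20
end SP7a

section SP7b
lemma flat_low {χ : R2 → ℝ} (hχ : ContDiff ℝ 1 χ) (hs : HasCompactSupport χ) {B a c G L : ℝ} (hB : B ≠ 0) (hc : 1 ≤ c)
    (hG : ∫ p, (dXr χ p ^ 2 + dYr χ p ^ 2) ≤ G * ∫ p, χ p ^ 2) (haL : c * (L + G) ≤ a)
    {m : ℕ} {w : Fin m → R2 → ℂ} (hw : ∀ j, Continuous (w j) ∧ HasCompactSupport (w j)) {F : Fin m → ℝ} (hF : ∀ j, 0 ≤ F j)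
    (hyp : ∀ k ξ, a * (∫ p, ‖(χ p : ℂ) * wv B k ξ p‖ ^ 2) - c * q0 B (fun p => (χ p : ℂ) * wv B k ξ p) ≤ ∑ j, F j * ‖cf B k ξ (w j)‖ ^ 2)
    (K : ℕ) : (∑ k ∈ Finset.range K, max (L - (2 * k + 1) * |B|) 0) * (|B| / (2 * π)) * ∫ p, χ p ^ 2 ≤ ∑ j, F j * ∫ p, ‖w j p‖ ^ 2 := by
  have hb := fun j => flat_bessel (hw j).1 (hw j).2 hB K
  have i1 : Integrable (fun p => χ p ^ 2) := sqint hχ.continuous hs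
  have i2 : Integrable (fun p => dXr χ p ^ 2 + dYr χ p ^ 2) := (sqint (dXr_cont hχ) (dXr_cpt hs)).add (sqint (dYr_cont hχ) (dYr_cpt hs))
  have hX : 0 ≤ ∫ p, χ p ^ 2 := integral_nonneg fun p => sq_nonneg _
  have per : ∀ k : ℕ, max (L - (2 * k + 1) * |B|) 0 * (|B| / (2 * π)) * (∫ p, χ p ^ 2) ≤ ∑ j, F j * ∫ ξ, ‖cf B k ξ (w j)‖ ^ 2 := by
    intro k
    have hR : 0 ≤ ∑ j, F j * ∫ ξ, ‖cf B k ξ (w j)‖ ^ 2 := Finset.sum_nonneg fun j _ => mul_nonneg (hF j) (integral_nonneg fun ξ => sq_nonneg _)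
    set W : R2 → ℝ := fun p => a * χ p ^ 2 - c * (dXr χ p ^ 2 + dYr χ p ^ 2 + (2 * k + 1) * |B| * χ p ^ 2) with hW
    have iW : Integrable W := (i1.const_mul a).sub ((i2.add (i1.const_mul _)).const_mul c)
    obtain ⟨f1, f2⟩ := fub iW hB k
    have j1 : ∫ p, W p = a * (∫ p, χ p ^ 2) - c * ((∫ p, (dXr χ p ^ 2 + dYr χ p ^ 2)) + (2 * k + 1) * |B| * ∫ p, χ p ^ 2) := by
      have ia : Integrable (fun p => a * χ p ^ 2) := i1.const_mul a
      have ib0 : Integrable (fun p => (2 * k + 1) * |B| * χ p ^ 2) := i1.const_mul _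
      have ib1 : Integrable (fun p => (dXr χ p ^ 2 + dYr χ p ^ 2) + (2 * k + 1) * |B| * χ p ^ 2) := i2.add ib0
      have ib : Integrable (fun p => c * (dXr χ p ^ 2 + dYr χ p ^ 2 + (2 * k + 1) * |B| * χ p ^ 2)) := ib1.const_mul c
      rw [hW, integral_sub ia ib, integral_const_mul, integral_const_mul, integral_add i2 ib0, integral_const_mul]
    have j2 : ∫ ξ, (∫ p : R2, W p * hr |B| k (p.2 + 2 * π * ξ / B) ^ 2) ≤ ∫ ξ, ∑ j, F j * ‖cf B k ξ (w j)‖ ^ 2 := by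
      refine integral_mono f1 (integrable_finsetSum _ fun j _ => ((hb j).1 k).const_mul _) fun ξ => ?_
      refine le_trans (le_of_eq ?_) (hyp k ξ)
      have hh : Continuous fun p : R2 => hr |B| k (p.2 + 2 * π * ξ / B) ^ 2 := by
        have := (hr_cd1 (abs_pos.2 hB) k).1.continuous
        fun_prop
      have k1 : Integrable (fun p : R2 => χ p ^ 2 * hr |B| k (p.2 + 2 * π * ξ / B) ^ 2) := by
        refine ((hχ.continuous.pow 2).mul hh).integrable_of_hasCompactSupport (HasCompactSupport.mul_right ?_)
        simp only [pow_two]; exact hs.mul_left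
      have k2 : Integrable (fun p : R2 => (dXr χ p ^ 2 + dYr χ p ^ 2 + (2 * k + 1) * |B| * χ p ^ 2) * hr |B| k (p.2 + 2 * π * ξ / B) ^ 2) := by
        have c1 := dXr_cont hχ
        have c2 := dYr_cont hχ
        have c3 := hχ.continuous
        refine Continuous.integrable_of_hasCompactSupport (by fun_prop) (HasCompactSupport.mul_right ?_)
        simp only [pow_two]
        refine HasCompactSupport.add (HasCompactSupport.add (dXr_cpt hs).mul_left (dYr_cpt hs).mul_left) ?_
        exact HasCompactSupport.mul_left hs.mul_left
      rw [q0_wv hB k ξ hχ hs]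
      have e1 : ∫ p, ‖(χ p : ℂ) * wv B k ξ p‖ ^ 2 = ∫ p : R2, χ p ^ 2 * hr |B| k (p.2 + 2 * π * ξ / B) ^ 2 := by
        congr 1; ext p; rw [norm_mul, mul_pow, wv_norm, Complex.norm_real, Real.norm_eq_abs, sq_abs]
      rw [e1, ← integral_const_mul, ← integral_const_mul, ← integral_sub (k1.const_mul a) (k2.const_mul c)]
      congr 1; ext p; simp only [hW]; ring
    rw [f2, j1, integral_finsetSum _ fun j _ => ((hb j).1 k).const_mul _] at j2
    simp only [integral_const_mul] at j2
    rcases le_total (L - (2 * k + 1) * |B|) 0 with h0 | h0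
    · rw [max_eq_right h0]; simpa using hR
    · rw [max_eq_left h0]
      refine le_trans ?_ j2
      have hb0 : 0 ≤ |B| / (2 * π) := by positivity
      rw [mul_comm (L - _) (|B| / _), mul_assoc]
      refine mul_le_mul_of_nonneg_left ?_ hb0
      have q1 := mul_le_mul_of_nonneg_left hG (by linarith : 0 ≤ c)
      have q2 := mul_le_mul_of_nonneg_right haL hX
      have q3 := mul_le_mul_of_nonneg_right hc (mul_nonneg h0 hX)
      linarith
  calc _ = ∑ k ∈ Finset.range K, max (L - (2 * k + 1) * |B|) 0 * (|B| / (2 * π)) * (∫ p, χ p ^ 2) := by rw [Finset.sum_mul, Finset.sum_mul]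
    _ ≤ ∑ k ∈ Finset.range K, ∑ j, F j * ∫ ξ, ‖cf B k ξ (w j)‖ ^ 2 := Finset.sum_le_sum fun k _ => per k
    _ = ∑ j, F j * ∑ k ∈ Finset.range K, ∫ ξ, ‖cf B k ξ (w j)‖ ^ 2 := by rw [Finset.sum_comm]; simp only [Finset.mul_sum]
    _ ≤ _ := Finset.sum_le_sum fun j _ => mul_le_mul_of_nonneg_left (hb j).2 (hF j)
end SP7b

section SP7c
lemma ee_conj (t : ℝ) : (starRingEnd ℂ) (ee t) = ee (-t) := by
  unfold ee; rw [← Complex.exp_conj]; simp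

lemma low_num1 {η l n q x y S t E : ℝ} (hη : 0 < η) (hη1 : η ≤ 1/20) (hl : 1 ≤ l) (hn : 0 ≤ n) (hy : 0 ≤ y) (ht : 0 < t) (hE : E ≤ 1 + 4 * η)
    (h1 : l * n - q ≤ S + η * (n + q)) (h2 : q ≤ (1 + η) * y + η * l * n) (h3 : x ≤ E * (t ^ 2 * n)) :
    (1 - 7 * η) * l / t ^ 2 * x - (1 + 3 * η) * y ≤ S := by
  have a1 : η * n ≤ η * l * n := by nlinarith [mul_nonneg hη.le hn]
  have a2 : (1 + η) * q ≤ (1 + η) * ((1 + η) * y + η * l * n) := by gcongr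
  have a3 : η ^ 2 ≤ η := by nlinarith
  have a4 : η ^ 2 * y ≤ η * y := by gcongr
  have a5 : η ^ 2 * (l * n) ≤ η * (l * n) := by gcongr
  have b1 : x / t ^ 2 ≤ (1 + 4 * η) * n := by
    rw [div_le_iff₀ (by positivity)]
    refine h3.trans ?_
    calc E * (t ^ 2 * n) ≤ (1 + 4 * η) * (t ^ 2 * n) := by gcongr
      _ = _ := by ring
  have b2 : (1 - 7 * η) * l * (x / t ^ 2) ≤ (1 - 7 * η) * l * ((1 + 4 * η) * n) := by
    refine mul_le_mul_of_nonneg_left b1 ?_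
    have : 0 ≤ 1 - 7 * η := by linarith
    positivity
  have b3 : (1 - 7 * η) * l / t ^ 2 * x = (1 - 7 * η) * l * (x / t ^ 2) := by ring
  rw [b3]
  have : 0 ≤ η ^ 2 * (l * n) := by positivity
  linarith

set_option maxHeartbeats 800000 in
lemma LowLoc {A1 A2 : R2 → ℝ} (h1 : ContDiffOn ℝ 2 A1 UHP) (h2 : ContDiffOn ℝ 2 A2 UHP) (hH1 : H1 A1 A2) {C₀ : ℝ} (hC : 0 < C₀) (hH : H2 C₀ A1 A2)
    {η : ℝ} (hη : 0 < η) (hη1 : η ≤ 1/20) {l ε K : ℝ} (hl : 1 ≤ l) (hε : 0 < ε) (hε4 : ε ≤ 1/4) (hεη : ε ≤ η) (hεC : 192 * C₀ * ε ≤ η)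
    (p1 : (1 + 1 / η) * (3 * ((288 * C₀ + 6) * (ε * (2 * l) + 1) * ε) ^ 2) ≤ η * l) (p2 : (1 + 1 / η) * (4 * K / ε ^ 2) ≤ η * l) (hK : 0 < K)
    {g : ℝ → ℝ} (hg : Cut g ε K) {m : ℕ} {f : Fin m → R2 → ℂ} (hf : ∀ j, EU (f j)) {F : Fin m → ℝ} (hF : ∀ j, 0 ≤ F j)
    (hyp : ∀ ψ, EU ψ → l * nf ψ - qf A1 A2 ψ ≤ ∑ j, F j * ‖∫ p : R2, (starRingEnd ℂ) (ψ p) * (((p.2 ^ 2)⁻¹ : ℝ) * f j p)‖ ^ 2 + η * (nf ψ + qf A1 A2 ψ))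
    (z : R2) :
    ∫ p, chi g z p ^ 2 * Gam A1 A2 ((1 - 12 * η) * l) p ≤ (1 + 8 * η) * ∑ j, F j * ∫ p, chi g z p ^ 2 * (‖f j p‖ ^ 2 / p.2 ^ 2) := by
  obtain ⟨k1, k2, -⟩ := chi_props hg z
  obtain ⟨-, hgr⟩ := gradchi hg hε (by linarith) z
  obtain ⟨x2, x4⟩ := exp4 hε hε4 hεη
  have hε1 : ε ≤ 1/2 := by linarith
  have ht := exp_pos z.2
  set t := exp z.2 with htd
  set β := beta A1 A2 (z.1, t) with hβ
  have hβ1 : 1 ≤ β := one_le_beta _ _ _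
  have hbc : ∀ p ∈ bx z.1 t ε, _ := fun p hp => beta_cmp h1 h2 hC hH ht hε (by linarith) (by linarith) hεC hp
  have chc : Continuous (chi g z) := k1.continuous
  have chs : HasCompactSupport (chi g z) := (bx_compact z.1 t ε).of_isClosed_subset (isClosed_tsupport _) k2
  obtain ⟨g1, g2, g3⟩ := Gam_good h1 h2 hH1 ((1 - 12 * η) * l)
  have hl2 : 0 ≤ (1 - 12 * η) * l := mul_nonneg (by linarith) (by linarith)
  have inn : ∀ j, 0 ≤ ∫ p, chi g z p ^ 2 * (‖f j p‖ ^ 2 / p.2 ^ 2) := fun j => integral_nonneg fun p => by positivity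
  have Rnn : 0 ≤ (1 + 8 * η) * ∑ j, F j * ∫ p, chi g z p ^ 2 * (‖f j p‖ ^ 2 / p.2 ^ 2) :=
    mul_nonneg (by linarith) (Finset.sum_nonneg fun j _ => mul_nonneg (hF j) (inn j))
  by_cases hbig : 2 * l < β
  · refine le_trans (le_of_eq ?_) Rnn
    rw [← integral_zero (R2) ℝ]
    congr 1; ext p
    by_cases hp : p ∈ tsupport (chi g z)
    · obtain ⟨b1, b2⟩ := hbc p (k2 hp)
      have := one_le_beta A1 A2 p
      have h0 : (1 - 12 * η) * l ≤ beta A1 A2 p := by nlinarith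
      have : Gam A1 A2 ((1 - 12 * η) * l) p = 0 := by
        unfold Gam; rw [GG_zero h0 (by linarith)]; simp
      rw [this, mul_zero]
    · simp [image_eq_zero_of_notMem_tsupport hp]
  push Not at hbig
  obtain ⟨φ, hφ, hloc⟩ := Loc h1 h2 hC hH (s := z.1) ht hε hε1 (by linarith [mul_pos hC hε])
  obtain ⟨hB, hBa⟩ := Bz_div (A1 := A1) (A2 := A2) (z := (z.1, t)) ht
  have hp1 : (1 + 1 / η) * (3 * ((288 * C₀ + 6) * (ε * β + 1) * ε) ^ 2) ≤ η * l := by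
    refine le_trans ?_ p1
    gcongr
  have hKl : 4 * K / ε ^ 2 ≤ η * l := by
    have : 0 ≤ 1 / η * (4 * K / ε ^ 2) := by positivity
    linarith
  set w : Fin m → R2 → ℂ := fun j p => (((p.2 ^ 2)⁻¹ : ℝ) : ℂ) * (ee (-φ p) * cm (chi g z) (f j) p) with hw
  have hφn : ContDiffOn ℝ 1 (fun p => -φ p) UHP := hφ.neg
  have hcE : ∀ j, EU (fun p => ee (-φ p) * cm (chi g z) (f j) p) := fun j => gm_EU hφn (cm_EU k1 (hf j))
  have hwg : ∀ j, Continuous (w j) ∧ HasCompactSupport (w j) := fun j => by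
    refine ⟨mulc ?_ (hcE j).1.1.continuous (hcE j).2, (hcE j).1.2.mul_left⟩
    exact ContinuousOn.inv₀ (by fun_prop) fun p hp => pow_ne_zero 2 (ne_of_gt hp)
  have hFL := flat_low k1 chs hB (a := (1 - 7 * η) * l / t ^ 2) (c := 1 + 3 * η) (G := η * l / t ^ 2) (L := (1 - 11 * η) * l / t ^ 2)
    (by linarith) ?_ ?_ hwg hF ?_ ⌈(1 - 11 * η) * l⌉₊
  · rw [hBa, GG_eq ht] at hFL
    have hwn : ∀ j, ∫ p, ‖w j p‖ ^ 2 ≤ exp (2 * ε) / t ^ 2 * ∫ p, chi g z p ^ 2 * (‖f j p‖ ^ 2 / p.2 ^ 2) := by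
      intro j
      have nfi := nf_good (hf j)
      rw [← integral_const_mul]
      refine integral_mono (sq_int (hwg j).1 (hwg j).2) ?_ fun p => ?_
      · refine Integrable.const_mul ?_ _
        exact ((chc.pow 2).mul nfi.1).integrable_of_hasCompactSupport nfi.2.1.mul_left
      · simp only [hw, cm, norm_mul, ee_norm, one_mul, mul_pow, Complex.norm_real, Real.norm_eq_abs, sq_abs]
        by_cases hp : p ∈ tsupport (chi g z)
        · have y1 := (y_ratio ht hε hε1 (k2 hp)).1
          have hp0 : 0 < p.2 := bx_sub ht (k2 hp)
          have y2 : (p.2 ^ 2)⁻¹ ≤ exp (2 * ε) / t ^ 2 := by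
            rw [le_div_iff₀ (by positivity)]
            calc _ = t ^ 2 / p.2 ^ 2 := by ring
              _ ≤ _ := y1
          calc ((p.2 ^ 2)⁻¹) ^ 2 * (chi g z p ^ 2 * ‖f j p‖ ^ 2) = (p.2 ^ 2)⁻¹ * (chi g z p ^ 2 * (‖f j p‖ ^ 2 / p.2 ^ 2)) := by ring
            _ ≤ _ := by gcongr
        · simp [image_eq_zero_of_notMem_tsupport hp]
    have hGG : 0 ≤ GG β ((1 - 11 * η) * l) := GG_nonneg (by linarith)
    have r2 : ∫ p, chi g z p ^ 2 * Gam A1 A2 ((1 - 12 * η) * l) p ≤ exp (2 * ε) / t ^ 2 * GG β ((1 - 11 * η) * l) * ∫ p, chi g z p ^ 2 := by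
      rw [← integral_const_mul]
      refine integral_mono ?_ ((sqint chc chs).const_mul _) fun p => ?_
      · exact ((chc.pow 2).mul g1).integrable_of_hasCompactSupport g2.mul_left
      · simp only
        by_cases hp : p ∈ tsupport (chi g z)
        · have hpb := k2 hp
          have hp0 : 0 < p.2 := bx_sub ht hpb
          obtain ⟨b1, b2⟩ := hbc p hpb
          have G1 : GG (beta A1 A2 p) ((1 - 12 * η) * l) ≤ GG β ((1 - 11 * η) * l) :=
            GG_cmp hβ1 (one_le_beta _ _ _) hη.le b1 b2 hl2 (by linarith [mul_pos hη (by linarith : 0 < l), mul_pos hη (mul_pos hη (by linarith : 0 < l))])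
          have y1 := (y_ratio ht hε hε1 hpb).1
          have y2 : (p.2 ^ 2)⁻¹ ≤ exp (2 * ε) / t ^ 2 := by
            rw [le_div_iff₀ (by positivity)]
            calc _ = t ^ 2 / p.2 ^ 2 := by ring
              _ ≤ _ := y1
          unfold Gam; rw [if_pos hp0]
          calc chi g z p ^ 2 * (GG (beta A1 A2 p) ((1 - 12 * η) * l) / p.2 ^ 2) = chi g z p ^ 2 * ((p.2 ^ 2)⁻¹ * GG (beta A1 A2 p) ((1 - 12 * η) * l)) := by ring
            _ ≤ chi g z p ^ 2 * (exp (2 * ε) / t ^ 2 * GG β ((1 - 11 * η) * l)) := by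
              refine mul_le_mul_of_nonneg_left (mul_le_mul y2 G1 (GG_nonneg (by linarith [one_le_beta A1 A2 p])) (by positivity)) (sq_nonneg _)
            _ = _ := by ring
        · simp [image_eq_zero_of_notMem_tsupport hp]
    have r3 : GG β ((1 - 11 * η) * l) / t ^ 4 * (∫ p, chi g z p ^ 2) ≤ exp (2 * ε) / t ^ 2 * ∑ j, F j * ∫ p, chi g z p ^ 2 * (‖f j p‖ ^ 2 / p.2 ^ 2) := by
      refine hFL.trans ?_
      rw [Finset.mul_sum]
      refine Finset.sum_le_sum fun j _ => ?_
      rw [mul_left_comm]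
      exact mul_le_mul_of_nonneg_left (hwn j) (hF j)
    set SS := ∑ j, F j * ∫ p, chi g z p ^ 2 * (‖f j p‖ ^ 2 / p.2 ^ 2) with hSS
    have hSS0 : 0 ≤ SS := Finset.sum_nonneg fun j _ => mul_nonneg (hF j) (inn j)
    refine r2.trans ?_
    have r4 := mul_le_mul_of_nonneg_left r3 (by positivity : 0 ≤ exp (2 * ε) * t ^ 2)
    calc _ = exp (2 * ε) * t ^ 2 * (GG β ((1 - 11 * η) * l) / t ^ 4 * (∫ p, chi g z p ^ 2)) := by field_simp
      _ ≤ exp (2 * ε) * t ^ 2 * (exp (2 * ε) / t ^ 2 * SS) := r4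
      _ = exp (4 * ε) * SS := by
        have : exp (4 * ε) = exp (2 * ε) * exp (2 * ε) := by rw [← exp_add]; congr 1; ring
        rw [this]; field_simp
      _ ≤ _ := by gcongr
  · refine hgr.trans (mul_le_mul_of_nonneg_right ?_ (integral_nonneg fun p => sq_nonneg _))
    gcongr
  · rw [← add_div, ← mul_div_assoc]
    refine div_le_div_of_nonneg_right ?_ (by positivity)
    linarith [mul_pos hη (mul_pos hη (by linarith : 0 < l))]
  · intro k ξ
    set v : R2 → ℂ := fun p => (chi g z p : ℂ) * wv (Bz A1 A2 (z.1, t) / t ^ 2) k ξ p with hv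
    have hvs : tsupport v ⊆ tsupport (chi g z) := cm_ts (e := wv (Bz A1 A2 (z.1, t) / t ^ 2) k ξ)
    have hvE : EU v := ⟨⟨(Complex.ofRealCLM.contDiff.comp k1).mul (wv_cd hB k ξ), chs.of_isClosed_subset (isClosed_tsupport _) hvs⟩,
      hvs.trans (k2.trans (bx_sub ht))⟩
    have hL := (hloc v hvE (hvs.trans k2) η hη).2
    have hL2 := hyp _ (gm_EU hφ hvE)
    rw [(gm_nf φ v).1] at hL2
    have e1 : ∀ j, ∫ p : R2, (starRingEnd ℂ) (ee (φ p) * v p) * (((p.2 ^ 2)⁻¹ : ℝ) * f j p) = cf (Bz A1 A2 (z.1, t) / t ^ 2) k ξ (w j) := by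
      intro j
      unfold cf
      congr 1; ext p
      simp only [hv, hw, cm, wv, map_mul, ee_conj, Complex.conj_ofReal]
      ring
    simp only [e1] at hL2
    refine low_num1 hη hη1 hl (nf_nonneg v) ?_ ht x2 hL2 (hL.trans ?_) (nf_box ht hε hε1 hvE (hvs.trans k2)).2
    · unfold q0; exact integral_nonneg fun p => by positivity
    · gcongr
      exact nf_nonneg v

lemma Lower {A1 A2 : R2 → ℝ} (h1 : ContDiffOn ℝ 2 A1 UHP) (h2 : ContDiffOn ℝ 2 A2 UHP) (hH1 : H1 A1 A2) {C₀ : ℝ} (hC : 0 < C₀) (hH : H2 C₀ A1 A2)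
    {η : ℝ} (hη : 0 < η) (hη1 : η ≤ 1/20) : ∃ L0 ≥ 1, ∀ l ≥ L0, ∀ (m : ℕ) (f : Fin m → R2 → ℂ) (_ : ∀ j, EU (f j)) (F : Fin m → ℝ) (_ : ∀ j, 0 ≤ F j),
    (∀ ψ, EU ψ → l * nf ψ - qf A1 A2 ψ ≤ ∑ j, F j * ‖∫ p : R2, (starRingEnd ℂ) (ψ p) * (((p.2 ^ 2)⁻¹ : ℝ) * f j p)‖ ^ 2 + η * (nf ψ + qf A1 A2 ψ)) →
    ∫ p, Gam A1 A2 ((1 - 12 * η) * l) p ≤ (1 + 8 * η) * ∑ j, F j * nf (f j) := by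
  obtain ⟨K, hK, hcut⟩ := cut_ex
  obtain ⟨L0, hL0, hpar⟩ := par (η := η) (δ := min (min (1/4) η) (η / (192 * C₀))) (M := 2) hη (by positivity) hC hK (by norm_num)
  refine ⟨max L0 1, le_max_right _ _, fun l hl m f hf F hF hyp => ?_⟩
  obtain ⟨ε, hε, hεδ, p1, p2⟩ := hpar l ((le_max_left _ _).trans hl)
  obtain ⟨g, hg⟩ := hcut ε hε
  have hl0 : 1 ≤ l := (le_max_right _ _).trans hl
  have hε4 : ε ≤ 1/4 := hεδ.trans ((min_le_left _ _).trans (min_le_left _ _))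
  have hεη : ε ≤ η := hεδ.trans ((min_le_left _ _).trans (min_le_right _ _))
  have hεC : 192 * C₀ * ε ≤ η := by
    have := mul_le_mul_of_nonneg_left (hεδ.trans (min_le_right _ _)) (by positivity : 0 ≤ 192 * C₀)
    refine this.trans (le_of_eq ?_); field_simp
  have key := LowLoc h1 h2 hH1 hC hH hη hη1 hl0 hε hε4 hεη hεC p1 p2 hK hg hf hF hyp
  obtain ⟨g1, g2, g3⟩ := Gam_good h1 h2 hH1 ((1 - 12 * η) * l)
  have z1 : ∀ x, ε < |x| → (fun x => g x ^ 2) x = 0 := fun x hx => by simp [hg.2.1 x hx]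
  have cg : Continuous g := hg.1.continuous
  have c1 : Continuous (fun x => g x ^ 2) := by fun_prop
  have fe := fubGH c1 c1 z1 z1 g1 g2 g3
  have fa := fun j => fubGH c1 c1 z1 z1 (nf_good (hf j)).1 (nf_good (hf j)).2.1 (nf_good (hf j)).2.2
  have I1 : ∫ x, g x ^ 2 = 1 := hg.2.2.1
  have := integral_mono (g := fun z => (1 + 8 * η) * ∑ j, F j * ∫ p : R2, Wk (fun x => g x ^ 2) (fun x => g x ^ 2) z p * (‖f j p‖ ^ 2 / p.2 ^ 2)) fe.1
    ((integrable_finsetSum _ fun j _ => (fa j).1.const_mul (F j)).const_mul _) (fun z => ?_)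
  · rw [fe.2, integral_const_mul, integral_finsetSum _ fun j _ => (fa j).1.const_mul (F j)] at this
    simp only [integral_const_mul, fun j => (fa j).2, I1, one_mul] at this
    exact this
  · simp only [Wk_chi g g3, fun j => Wk_chi g (nf_good (hf j)).2.2, integral_const_mul]
    have := mul_le_mul_of_nonneg_left (key z) (exp_pos (-z.2)).le
    refine this.trans (le_of_eq ?_)
    rw [mul_left_comm, Finset.mul_sum]
    congr 1
    refine Finset.sum_congr rfl fun j _ => by ring
end SP7c

section SP8a
lemma int_cpt {f : R2 → ℝ} {K : Set (R2)} (hK : IsCompact K) {c : ℝ} (h0 : ∀ p ∉ K, f p = 0) (hc : ∀ p ∈ K, f p ≤ c) (hf : Integrable f) :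
    ∫ p, f p ≤ c * volume.real K := by
  rw [← setIntegral_eq_integral_of_forall_compl_eq_zero h0]
  have hKv : volume K ≠ ⊤ := hK.measure_lt_top.ne
  calc ∫ p in K, f p ≤ ∫ p in K, c := by
        refine setIntegral_mono_on hf.integrableOn (integrableOn_const hKv) hK.measurableSet hc
    _ = _ := by rw [setIntegral_const, smul_eq_mul, mul_comm]

open scoped Convolution in
lemma moll {A1 A2 : R2 → ℝ} (h1 : ContinuousOn A1 UHP) (h2 : ContinuousOn A2 UHP) {u : R2 → ℂ} (hu : EU u) {ε : ℝ} (hε : 0 < ε) :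
    ∃ g, IsTestOn UHP g ∧ nf (fun p => g p - u p) ≤ ε ∧ qf A1 A2 (fun p => g p - u p) ≤ ε := by
  obtain ⟨⟨hu1, hu2⟩, hu3⟩ := hu
  have huE : EU u := ⟨⟨hu1, hu2⟩, hu3⟩
  have hKc : IsCompact (tsupport u) := hu2
  obtain ⟨δ, hδ, hδU⟩ := hKc.exists_cthickening_subset_open UHP_open hu3
  set K := Metric.cthickening δ (tsupport u) with hK
  have hKcpt : IsCompact K := hKc.cthickening
  obtain ⟨M1, hM1⟩ := hKcpt.exists_bound_of_continuousOn (h1.mono hδU)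
  obtain ⟨M2, hM2⟩ := hKcpt.exists_bound_of_continuousOn (h2.mono hδU)
  obtain ⟨M3, hM3⟩ := hKcpt.exists_bound_of_continuousOn (f := fun p : R2 => (p.2)⁻¹) (ContinuousOn.inv₀ (by fun_prop) fun p hp => ne_of_gt (hδU hp))
  set M := max (max M1 M2) (max M3 0) with hM
  have hM0 : 0 ≤ M := (le_max_right M3 0).trans (le_max_right _ _)
  have b1 : ∀ p ∈ K, |A1 p| ≤ M := fun p hp => (hM1 p hp).trans ((le_max_left _ _).trans (le_max_left _ _))
  have b2 : ∀ p ∈ K, |A2 p| ≤ M := fun p hp => (hM2 p hp).trans ((le_max_right _ _).trans (le_max_left _ _))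
  have b3 : ∀ p ∈ K, |(p.2)⁻¹| ≤ M := fun p hp => (hM3 p hp).trans ((le_max_left _ _).trans (le_max_right _ _))
  set C := 2 * (1 + M) ^ 2 * volume.real K with hC
  have hC0 : 0 ≤ C := by positivity
  set κ := min 1 (ε / (C + 1)) with hκ
  have hκ0 : 0 < κ := by positivity
  have hκC : κ ^ 2 * C ≤ ε := by
    have q1 : κ ≤ 1 := min_le_left _ _
    have q2 : κ * (C + 1) ≤ ε := by
      have := min_le_right 1 (ε / (C + 1))
      rwa [← hκ, le_div_iff₀ (by positivity)] at this
    calc κ ^ 2 * C = κ * (κ * C) := by ring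
      _ ≤ 1 * (κ * (C + 1)) := by gcongr; linarith
      _ ≤ ε := by linarith
  have cf' : Continuous (fderiv ℝ u) := hu1.continuous_fderiv (by norm_num)
  have hfs : HasCompactSupport (fderiv ℝ u) := hu2.fderiv ℝ
  obtain ⟨r1, hr1, hr1'⟩ := Metric.uniformContinuous_iff.1 (hu2.uniformContinuous_of_continuous hu1.continuous) κ hκ0
  obtain ⟨r2, hr2, hr2'⟩ := Metric.uniformContinuous_iff.1 (hfs.uniformContinuous_of_continuous cf') κ hκ0
  set r := min (min r1 r2) δ with hr
  have hr0 : 0 < r := by positivity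
  let φ : ContDiffBump (0 : R2) := ⟨r / 2, r, by positivity, by linarith⟩
  set g : R2 → ℂ := φ.normed volume ⋆[ContinuousLinearMap.lsmul ℝ ℝ, volume] u with hg
  have hφl : LocallyIntegrable (φ.normed volume) volume := φ.continuous_normed.locallyIntegrable
  have gs : ContDiff ℝ (⊤ : ℕ∞) g := φ.hasCompactSupport_normed.contDiff_convolution_left _ φ.contDiff_normed hu1.continuous.locallyIntegrable
  have gsup : tsupport g ⊆ K := by
    refine closure_minimal ?_ Metric.isClosed_cthickening
    refine (support_convolution_subset _).trans ?_
    rintro p ⟨a, ha, b, hb, rfl⟩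
    rw [φ.support_normed_eq, mem_ball_zero_iff] at ha
    refine Metric.mem_cthickening_of_dist_le _ b _ _ (subset_tsupport _ hb) ?_
    rw [dist_eq_norm, add_sub_cancel_right]
    exact ha.le.trans (min_le_right _ _)
  have usup : tsupport u ⊆ K := Metric.self_subset_cthickening _
  have gc : HasCompactSupport g := hKcpt.of_isClosed_subset (isClosed_tsupport _) gsup
  have d0 : ∀ p, ‖g p - u p‖ ≤ κ := by
    intro p
    rw [← dist_eq_norm]
    refine φ.dist_normed_convolution_le hu1.continuous.aestronglyMeasurable fun x hx => ?_
    exact (hr1' (lt_of_lt_of_le (Metric.mem_ball.1 hx) ((min_le_left _ _).trans (min_le_left _ _)))).le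
  have dv : ∀ p v, ‖v‖ ≤ 1 → ‖fderiv ℝ g p v - fderiv ℝ u p v‖ ≤ κ := by
    intro p v hv
    have := hu2.hasFDerivAt_convolution_right (ContinuousLinearMap.lsmul ℝ ℝ) hφl hu1 p
    rw [this.fderiv, convolution_precompR_apply _ hφl hfs cf', ← dist_eq_norm]
    refine φ.dist_normed_convolution_le (cf'.clm_apply continuous_const).aestronglyMeasurable fun x hx => ?_
    have q := (hr2' (lt_of_lt_of_le (Metric.mem_ball.1 hx) ((min_le_left _ _).trans (min_le_right _ _)))).le
    rw [dist_eq_norm] at q ⊢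
    rw [← ContinuousLinearMap.sub_apply]
    calc _ ≤ ‖fderiv ℝ u x - fderiv ℝ u p‖ * ‖v‖ := ContinuousLinearMap.le_opNorm _ _
      _ ≤ κ * 1 := by gcongr
      _ = κ := mul_one _
  have wE : EU (fun p => g p - u p) := by
    have : tsupport (fun p => g p - u p) ⊆ K := closure_minimal (fun p hp => by
      by_contra h
      exact hp (by simp [image_eq_zero_of_notMem_tsupport (fun h' => h (gsup h')), image_eq_zero_of_notMem_tsupport (fun h' => h (usup h'))])) Metric.isClosed_cthickening
    exact ⟨⟨(gs.of_le (by exact_mod_cast le_top)).sub hu1, hKcpt.of_isClosed_subset (isClosed_tsupport _) this⟩, this.trans hδU⟩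
  have wz : ∀ p ∉ K, g p - u p = 0 := fun p h => by
    simp [image_eq_zero_of_notMem_tsupport (fun h' => h (gsup h')), image_eq_zero_of_notMem_tsupport (fun h' => h (usup h'))]
  have wdz : ∀ p ∉ K, fderiv ℝ (fun p => g p - u p) p = 0 := fun p h => by
    have : fderiv ℝ (fun p => g p - u p) p = fderiv ℝ g p - fderiv ℝ u p := fderiv_fun_sub (gs.differentiable (by simp) p) (hu1.differentiable (by norm_num) p)
    rw [this, fderiv_of_notMem_tsupport ℝ (fun h' => h (gsup h')), fderiv_of_notMem_tsupport ℝ (fun h' => h (usup h')), sub_zero]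
  have wd : ∀ p v, ‖v‖ ≤ 1 → ‖fderiv ℝ (fun p => g p - u p) p v‖ ≤ κ := fun p v hv => by
    have : fderiv ℝ (fun p => g p - u p) p = fderiv ℝ g p - fderiv ℝ u p := fderiv_fun_sub (gs.differentiable (by simp) p) (hu1.differentiable (by norm_num) p)
    rw [this, ContinuousLinearMap.sub_apply]; exact dv p v hv
  refine ⟨g, ⟨gs, gc, gsup.trans hδU⟩, ?_, ?_⟩
  · refine (int_cpt hKcpt (c := 2 * (1 + M) ^ 2 * κ ^ 2) (fun p hp => by simp [wz p hp]) (fun p hp => ?_) (nf_int wE)).trans ?_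
    · have : ‖g p - u p‖ ^ 2 / p.2 ^ 2 = |(p.2)⁻¹| ^ 2 * ‖g p - u p‖ ^ 2 := by rw [sq_abs, inv_pow]; ring
      rw [this]
      have q1 : |(p.2)⁻¹| ^ 2 ≤ M ^ 2 := by have := b3 p hp; gcongr
      have q2 : ‖g p - u p‖ ^ 2 ≤ κ ^ 2 := by have := d0 p; gcongr
      refine (mul_le_mul q1 q2 (by positivity) (by positivity)).trans ?_
      gcongr; nlinarith
    · calc _ = κ ^ 2 * C := by rw [hC]; ring
        _ ≤ ε := hκC
  · refine (int_cpt hKcpt (c := 2 * (1 + M) ^ 2 * κ ^ 2) (fun p hp => ?_) (fun p hp => ?_) (qf_int h1 h2 wE)).trans ?_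
    · simp [E1, E2, dX, dY, wz p hp, wdz p hp]
    · have gen : ∀ (a : ℝ) (v : R2), ‖v‖ ≤ 1 → |a| ≤ M → ‖-Complex.I * fderiv ℝ (fun p => g p - u p) p v - (a : ℂ) * (g p - u p)‖ ^ 2 ≤ ((1 + M) * κ) ^ 2 := by
        intro a v hv ha
        have : ‖-Complex.I * fderiv ℝ (fun p => g p - u p) p v - (a : ℂ) * (g p - u p)‖ ≤ (1 + M) * κ := by
          refine (norm_sub_le _ _).trans ?_
          rw [norm_mul, norm_mul, norm_neg, Complex.norm_I, one_mul, Complex.norm_real, Real.norm_eq_abs]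
          calc _ ≤ κ + M * κ := add_le_add (wd p v hv) (mul_le_mul ha (d0 p) (norm_nonneg _) hM0)
            _ = _ := by ring
        gcongr
      have e1 := gen (A1 p) (1, 0) (by simp [Prod.norm_def]) (b1 p hp)
      have e2 := gen (A2 p) (0, 1) (by simp [Prod.norm_def]) (b2 p hp)
      unfold E1 E2 dX dY
      calc _ ≤ ((1 + M) * κ) ^ 2 + ((1 + M) * κ) ^ 2 := add_le_add e1 e2
        _ = _ := by ring
    · calc _ = κ ^ 2 * C := by rw [hC]; ring
        _ ≤ ε := hκC
end SP8a

section SP8b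
lemma EU_add {u v : R2 → ℂ} (hu : EU u) (hv : EU v) : EU (u + v) :=
  ⟨⟨hu.1.1.add hv.1.1, hu.1.2.add hv.1.2⟩, (tsupport_add u v).trans (Set.union_subset hu.2 hv.2)⟩
lemma EU_smul {u : R2 → ℂ} (c : ℂ) (hu : EU u) : EU (c • u) :=
  ⟨⟨contDiff_const.smul hu.1.1, hu.1.2.smul_left (f := fun _ => c)⟩, (tsupport_smul_subset_right (fun _ => c) u).trans hu.2⟩
lemma EU_zero0 : EU (0 : R2 → ℂ) := ⟨⟨contDiff_const, HasCompactSupport.zero⟩, by simp [tsupport]⟩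

def EM : Submodule ℂ (R2 → ℂ) where
  carrier := {u | EU u}
  add_mem' hu hv := EU_add hu hv
  zero_mem' := EU_zero0
  smul_mem' c _ hu := EU_smul c hu

def TM : Submodule ℂ (R2 → ℂ) where
  carrier := {u | IsTestOn UHP u}
  add_mem' {u v} hu hv := ⟨hu.1.add hv.1, hu.2.1.add hv.2.1, (tsupport_add u v).trans (Set.union_subset hu.2.2 hv.2.2)⟩
  zero_mem' := ⟨contDiff_const, HasCompactSupport.zero, by simp [tsupport]⟩
  smul_mem' c u hu := ⟨contDiff_const.smul hu.1, hu.2.1.smul_left (f := fun _ => c), (tsupport_smul_subset_right (fun _ => c) u).trans hu.2.2⟩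

lemma TM_EM {u : R2 → ℂ} (h : IsTestOn UHP u) : EU u := ⟨⟨h.1.of_le (by exact_mod_cast le_top), h.2.1⟩, h.2.2⟩

def CM : Submodule ℂ (R2 → ℂ) where
  carrier := {u | Continuous u ∧ HasCompactSupport u}
  add_mem' hu hv := ⟨hu.1.add hv.1, hu.2.add hv.2⟩
  zero_mem' := ⟨continuous_const, HasCompactSupport.zero⟩
  smul_mem' c _ hu := ⟨hu.1.const_smul c, hu.2.smul_left (f := fun _ => c)⟩

lemma CM_memLp (u : CM) : MemLp u.1 2 (volume : Measure (R2)) := u.2.1.memLp_of_hasCompactSupport u.2.2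

def LL : CM →ₗ[ℂ] Lp ℂ 2 (volume : Measure (R2)) where
  toFun u := (CM_memLp u).toLp u.1
  map_add' u v := MemLp.toLp_add (CM_memLp u) (CM_memLp v)
  map_smul' c u := MemLp.toLp_const_smul c (CM_memLp u)

lemma LL_inner (u v : CM) : inner ℂ (LL u) (LL v) = ∫ p, (starRingEnd ℂ) (u.1 p) * v.1 p := by
  rw [L2.inner_def]
  refine integral_congr_ae ?_
  filter_upwards [(CM_memLp u).coeFn_toLp, (CM_memLp v).coeFn_toLp] with p h1 h2
  change inner ℂ (((CM_memLp u).toLp u.1) p) (((CM_memLp v).toLp v.1) p) = _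
  rw [h1, h2, RCLike.inner_apply, mul_comm]

lemma LL_norm (u : CM) : ‖LL u‖ ^ 2 = ∫ p, ‖u.1 p‖ ^ 2 := by
  have h : (inner ℂ (LL u) (LL u) : ℂ) = ((∫ p, ‖u.1 p‖ ^ 2 : ℝ) : ℂ) := by
    rw [LL_inner, ← integral_complex_ofReal]
    congr 1; ext p
    rw [Complex.conj_mul']; push_cast; rfl
  rw [← inner_self_eq_norm_sq (𝕜 := ℂ), h]
  exact Complex.ofReal_re _

lemma dX_add {u v : R2 → ℂ} (hu : EU u) (hv : EU v) (p w) : fderiv ℝ (u + v) p w = fderiv ℝ u p w + fderiv ℝ v p w := by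
  rw [fderiv_add (hu.1.1.differentiable (by norm_num) p) (hv.1.1.differentiable (by norm_num) p)]; rfl
lemma dX_smul {u : R2 → ℂ} (c : ℂ) (hu : EU u) (p w) : fderiv ℝ (c • u) p w = c * fderiv ℝ u p w := by
  rw [fderiv_const_smul (hu.1.1.differentiable (by norm_num) p)]; rfl

def JM : EM →ₗ[ℂ] CM where
  toFun u := ⟨Jf u.1, Jf_cont u.2, Jf_cpt u.2⟩
  map_add' u v := by ext p; simp [Jf, mul_add]
  map_smul' c u := by ext p; simp [Jf]; ring

def EM1 {A : R2 → ℝ} (h : ContinuousOn A UHP) : EM →ₗ[ℂ] CM where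
  toFun u := ⟨E1 A u.1, E1_cont h u.2, E1_cpt u.2⟩
  map_add' u v := by ext p; simp [E1, dX, dX_add u.2 v.2]; ring
  map_smul' c u := by ext p; simp [E1, dX, dX_smul c u.2]; ring

def EM2 {A : R2 → ℝ} (h : ContinuousOn A UHP) : EM →ₗ[ℂ] CM where
  toFun u := ⟨E2 A u.1, E2_cont h u.2, E2_cpt u.2⟩
  map_add' u v := by ext p; simp [E2, dY, dX_add u.2 v.2]; ring
  map_smul' c u := by ext p; simp [E2, dY, dX_smul c u.2]; ring

abbrev HL := Lp ℂ 2 (volume : Measure (R2))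

def JJ : EM →ₗ[ℂ] HL := LL ∘ₗ JM

def TT {A1 A2 : R2 → ℝ} (h1 : ContinuousOn A1 UHP) (h2 : ContinuousOn A2 UHP) : EM →ₗ[ℂ] WithLp 2 (HL × HL) :=
  (WithLp.linearEquiv 2 ℂ (HL × HL)).symm.toLinearMap ∘ₗ LinearMap.prod (LL ∘ₗ EM1 h1) (LL ∘ₗ EM2 h2)

lemma JJ_norm (u : EM) : ‖JJ u‖ ^ 2 = nf u.1 := by
  refine (LL_norm _).trans ?_
  unfold nf; congr 1; ext p; exact Jf_norm _ _

lemma TT_norm {A1 A2 : R2 → ℝ} (h1 : ContinuousOn A1 UHP) (h2 : ContinuousOn A2 UHP) (u : EM) : ‖TT h1 h2 u‖ ^ 2 = qf A1 A2 u.1 := by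
  rw [WithLp.prod_norm_sq_eq_of_L2]
  have a : ‖(TT h1 h2 u).fst‖ ^ 2 = ∫ p, ‖E1 A1 u.1 p‖ ^ 2 := LL_norm (EM1 h1 u)
  have b : ‖(TT h1 h2 u).snd‖ ^ 2 = ∫ p, ‖E2 A2 u.1 p‖ ^ 2 := LL_norm (EM2 h2 u)
  rw [a, b]
  exact (integral_add (sq_int (E1_cont h1 u.2) (E1_cpt u.2)) (sq_int (E2_cont h2 u.2) (E2_cpt u.2))).symm

lemma JJ_inner (u v : EM) : inner ℂ (JJ u) (JJ v) = ∫ p : R2, (starRingEnd ℂ) (u.1 p) * (((p.2 ^ 2)⁻¹ : ℝ) * v.1 p) := by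
  refine (LL_inner _ _).trans ?_
  congr 1; ext p
  simp only [JM, LinearMap.coe_mk, AddHom.coe_mk, Jf, map_mul, Complex.conj_ofReal]
  push_cast; ring

lemma JJ_inj : Function.Injective JJ := by
  rw [← LinearMap.ker_eq_bot, LinearMap.ker_eq_bot']
  intro u hu
  have h0 : nf u.1 = 0 := by rw [← JJ_norm, hu]; simp
  have h1 : (fun p : R2 => ‖Jf u.1 p‖ ^ 2) = 0 := by
    have h2 : ∫ p : R2, ‖Jf u.1 p‖ ^ 2 = 0 := by
      rw [← h0]; unfold nf; congr 1; ext p; exact Jf_norm _ _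
    have h3 := (integral_eq_zero_iff_of_nonneg (fun p => by positivity) (sq_int (Jf_cont u.2) (Jf_cpt u.2))).1 h2
    have hc : Continuous (fun p : R2 => ‖Jf u.1 p‖ ^ 2) := (Jf_cont u.2).norm.pow 2
    exact (hc.ae_eq_iff_eq volume continuous_const).1 h3
  ext p
  by_cases hp : p ∈ UHP
  · have := congrFun h1 p
    simp only [Pi.zero_apply, Jf] at this
    have hp' : p.2 ≠ 0 := ne_of_gt hp
    simpa [hp'] using this
  · exact EU_zero u.2 hp
end SP8b

section SP8c
def RR (A1 A2 : R2 → ℝ) (L : ℝ) : ℝ := ∫ p, Gam A1 A2 L p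

lemma bessel {m : ℕ} {e : Fin m → EM} (he : Orthonormal ℂ (JJ ∘ e)) {f : R2 → ℂ} (fc : Continuous f) (fk : HasCompactSupport f) (_ : tsupport f ⊆ UHP) :
    ∑ i, ‖∫ p, f p * (e i).1 p‖ ^ 2 ≤ ∫ p : R2, p.2 ^ 2 * ‖f p‖ ^ 2 := by
  set g : CM := ⟨fun p => (p.2 : ℂ) * (starRingEnd ℂ) (f p), by
    refine ⟨by fun_prop, HasCompactSupport.mul_left ?_⟩
    exact fk.comp_left (g := starRingEnd ℂ) (map_zero _)⟩ with hg
  have h := he.sum_inner_products_le (LL g) (s := Finset.univ)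
  rw [LL_norm] at h
  have e1 : ∫ p, ‖g.1 p‖ ^ 2 = ∫ p : R2, p.2 ^ 2 * ‖f p‖ ^ 2 := by
    congr 1; ext p; simp [hg, mul_pow]
  rw [e1] at h
  refine le_trans (le_of_eq (Finset.sum_congr rfl fun i _ => ?_)) h
  rw [norm_inner_symm]
  have : inner ℂ (LL g) ((JJ ∘ e) i) = ∫ p, f p * (e i).1 p := by
    refine (LL_inner _ _).trans ?_
    congr 1; ext p
    by_cases hp : p ∈ UHP
    · have hp' : (p.2 : ℂ) ≠ 0 := by exact_mod_cast (ne_of_gt hp)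
      simp only [hg, JM, LinearMap.coe_mk, AddHom.coe_mk, Jf, map_mul, Complex.conj_ofReal, Complex.conj_conj]
      push_cast; field_simp
    · simp [hg, JM, Jf, EU_zero (e i).2 hp]
  rw [this]

lemma TT_dense {A1 A2 : R2 → ℝ} (h1 : ContinuousOn A1 UHP) (h2 : ContinuousOn A2 UHP) (f : EM) (ε : ℝ) (hε : 0 < ε) :
    ∃ g ∈ TM.comap EM.subtype, ‖JJ (g - f)‖ ≤ ε ∧ ‖TT h1 h2 (g - f)‖ ≤ ε := by
  obtain ⟨g, gt, a, b⟩ := moll h1 h2 f.2 (ε := ε ^ 2) (by positivity)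
  refine ⟨⟨g, TM_EM gt⟩, gt, ?_, ?_⟩
  · refine le_of_sq_le_sq ?_ hε.le
    rw [JJ_norm]; exact a
  · refine le_of_sq_le_sq ?_ hε.le
    rw [TT_norm]; exact b

lemma NH_bounds {A1 A2 : R2 → ℝ} (h1 : ContDiffOn ℝ 2 A1 UHP) (h2 : ContDiffOn ℝ 2 A2 UHP) (hH1 : H1 A1 A2) {C₀ : ℝ} (hC : 0 < C₀) (hH : H2 C₀ A1 A2)
    {η : ℝ} (hη : 0 < η) (hη1 : η ≤ 1/20) : ∃ L0 ≥ 1, ∀ l ≥ L0, ∀ h > 0,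
      h * NH A1 A2 l ≤ (1 + 8 * η) * RR A1 A2 ((1 + 20 * η) * (l + h)) - RR A1 A2 ((1 - 12 * η) * l) / (1 + 8 * η) ∧
      (L0 ≤ l - h → RR A1 A2 ((1 - 12 * η) * l) / (1 + 8 * η) - (1 + 8 * η) * RR A1 A2 ((1 + 20 * η) * (l - h)) ≤ h * NH A1 A2 l) := by
  have c1 := h1.continuousOn
  have c2 := h2.continuousOn
  obtain ⟨La, hLa, hU⟩ := Upper h1 h2 hH1 hC hH hη (by linarith)
  obtain ⟨Lb, hLb, hL⟩ := Lower h1 h2 hH1 hC hH hη hη1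
  have hSB : ∀ l ≥ La, SB JJ (TT c1 c2) l ((1 + 8 * η) * RR A1 A2 ((1 + 20 * η) * l)) := by
    intro l hl n e he
    have := hU l hl n (fun i => (e i).1) (fun i => (e i).2) (fun f a b c => bessel he a b c)
    simpa only [FF, JJ_norm, TT_norm, RR] using this
  have hFF : ∀ l (u : EM), FF JJ (TT c1 c2) l u = l * nf u.1 - qf A1 A2 u.1 := fun l u => by
    rw [FF, JJ_norm, TT_norm]
  refine ⟨max La Lb, hLb.trans (le_max_right _ _), fun l hl h hh => ?_⟩
  have hla : La ≤ l := (le_max_left _ _).trans hl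
  have hlb : Lb ≤ l := (le_max_right _ _).trans hl
  obtain ⟨m, f, f1, f2, f3⟩ := nearmax JJ_inj (T := TT c1 c2) (by linarith) (hSB l hla) (hSB (l + 1) (by linarith)) hη
  have hlow : RR A1 A2 ((1 - 12 * η) * l) / (1 + 8 * η) ≤ ∑ k, FF JJ (TT c1 c2) l (f k) := by
    rw [div_le_iff₀ (by positivity), mul_comm _ (1 + 8 * η)]
    have := hL l hlb m (fun j => (f j).1) (fun j => (f j).2) (fun j => FF JJ (TT c1 c2) l (f j)) (fun j => (f2 j).le) (fun ψ hψ => by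
      have := f3 ⟨ψ, hψ⟩
      have hsw : ∀ j, ‖(inner ℂ (JJ (f j)) (JJ ⟨ψ, hψ⟩) : ℂ)‖ = ‖∫ p : R2, (starRingEnd ℂ) (ψ p) * (((p.2 ^ 2)⁻¹ : ℝ) * (f j).1 p)‖ := fun j => by
        rw [norm_inner_symm, JJ_inner]
      simp only [hsw] at this
      simpa only [hFF, JJ_norm, TT_norm] using this)
    refine this.trans (le_of_eq ?_)
    congr 1
    refine Finset.sum_congr rfl fun j _ => ?_
    have : ‖JJ (f j)‖ = 1 := f1.1 j
    rw [← JJ_norm, this]; ring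
  have hset : ∀ V : Submodule ℂ (R2 → ℂ), (V : Set (R2 → ℂ)) ⊆ {f | IsTestOn UHP f} → (∀ u ∈ V, u ≠ 0 → qA A1 A2 u < l * ∫ p, ‖u p‖ ^ 2 ∂volH) →
      h * Module.finrank ℂ V ≤ (1 + 8 * η) * RR A1 A2 ((1 + 20 * η) * (l + h)) - RR A1 A2 ((1 - 12 * η) * l) / (1 + 8 * η) := by
    intro V hV hq
    have hVE : V ≤ EM := fun u hu => TM_EM (hV hu)
    have key : ∀ W : Submodule ℂ EM, FiniteDimensional ℂ W → (∀ u ∈ W, u.1 ∈ V) → h * Module.finrank ℂ W ≤ (1 + 8 * η) * RR A1 A2 ((1 + 20 * η) * (l + h)) - RR A1 A2 ((1 - 12 * η) * l) / (1 + 8 * η) := by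
      intro W hW hWV
      refine N_upper JJ_inj hh.le (hSB (l + h) (by linarith)) f1 hlow W (fun u hu hu0 => ?_)
      have := hq u.1 (hWV u hu) (fun h => hu0 (Subtype.ext h))
      rw [qf_eq u.2, nf_eq u.2] at this
      rw [hFF]; linarith
    have eqv := Submodule.comapSubtypeEquivOfLe hVE
    by_cases hfd : FiniteDimensional ℂ V
    · have hfd' : FiniteDimensional ℂ (V.comap EM.subtype) := eqv.symm.finiteDimensional
      have := key _ hfd' (fun u hu => hu)
      rwa [eqv.finrank_eq] at this
    · rw [Module.finrank_of_not_finite hfd]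
      have := key ⊥ inferInstance (fun u hu => by rw [(Submodule.mem_bot ℂ).1 hu]; exact V.zero_mem)
      simpa using this
  set S := {n : ℕ | ∃ V : Submodule ℂ (R2 → ℂ), (V : Set (R2 → ℂ)) ⊆ {f | IsTestOn UHP f} ∧
    Module.finrank ℂ V = n ∧ ∀ u ∈ V, u ≠ 0 → qA A1 A2 u < l * ∫ p, ‖u p‖ ^ 2 ∂volH} with hS
  have hNS : NH A1 A2 l = sSup S := rfl
  have hb : BddAbove S := by
    refine ⟨⌈((1 + 8 * η) * RR A1 A2 ((1 + 20 * η) * (l + h)) - RR A1 A2 ((1 - 12 * η) * l) / (1 + 8 * η)) / h⌉₊, ?_⟩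
    rintro n ⟨V, hV, rfl, hq⟩
    have := hset V hV hq
    refine Nat.cast_le (α := ℝ).1 (le_trans ?_ (Nat.le_ceil _))
    rw [le_div_iff₀ hh]; linarith
  have hne : S.Nonempty := by
    refine ⟨0, ⊥, ?_, by simp, fun u hu h0 => absurd ((Submodule.mem_bot ℂ).1 hu) h0⟩
    intro u hu
    have : u = 0 := (Submodule.mem_bot ℂ).1 hu
    rw [this]; exact TM.zero_mem
  refine ⟨?_, fun hlh => ?_⟩
  · obtain ⟨V, hV, hVn, hq⟩ := Nat.sSup_mem hne hb
    rw [hNS, ← hVn]; exact hset V hV hq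
  · obtain ⟨m', f', g1, g2, g3, g4⟩ := N_lower JJ_inj (hSB (l - h) ((le_max_left _ _).trans hlh)) f1 hlow
    obtain ⟨V, v1, v2, v3⟩ := dense_family (by linarith) g1 g2 g3 (TM.comap EM.subtype) (TT_dense c1 c2)
    refine g4.trans (mul_le_mul_of_nonneg_left ?_ hh.le)
    rw [hNS]
    refine Nat.cast_le.2 (le_csSup hb ⟨V.map EM.subtype, ?_, ?_, ?_⟩)
    · rintro _ ⟨u, hu, rfl⟩
      exact v1 hu
    · rw [← v2]
      exact Submodule.finrank_map_subtype_eq _ _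
    · rintro _ ⟨u, hu, rfl⟩ hu0
      have := v3 u hu (fun h => hu0 (by rw [h]; simp))
      rw [hFF] at this
      change qA A1 A2 u.1 < l * ∫ p, ‖u.1 p‖ ^ 2 ∂volH
      rw [qf_eq u.2, nf_eq u.2]; linarith
end SP8c

section SP9a
def cc (β L : ℝ) : ℕ := ⌈(L / β - 1) / 2⌉₊

lemma lt_cc {β L : ℝ} (hβ : 0 < β) (k : ℕ) : k < cc β L ↔ (2 * (k : ℝ) + 1) * β < L := by
  unfold cc
  rw [Nat.lt_ceil, lt_div_iff₀ (by norm_num), lt_sub_iff_add_lt, lt_div_iff₀ hβ, mul_comm (k : ℝ) 2]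

lemma heav_cc {β L : ℝ} (hβ : 0 < β) (k : ℕ) : heav (L - (2 * (k : ℝ) + 1) * β) = if k < cc β L then 1 else 0 := by
  unfold heav
  simp only [lt_cc hβ, sub_pos]

lemma heav_tsum {β L : ℝ} (hβ : 0 < β) : ∑' k : ℕ, heav (L - (2 * (k : ℝ) + 1) * β) = cc β L := by
  rw [tsum_eq_sum (s := Finset.range (cc β L)) (fun k hk => by rw [heav_cc hβ, if_neg (by simpa using hk)])]
  rw [Finset.sum_congr rfl (fun k hk => by rw [heav_cc hβ, if_pos (by simpa using hk)])]
  simp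

lemma heav_sum {β L : ℝ} (hβ : 0 < β) (N : ℕ) : ∑ k ∈ Finset.range N, heav (L - (2 * (k : ℝ) + 1) * β) = (min N (cc β L) : ℕ) := by
  simp only [heav_cc hβ]
  rw [Finset.sum_boole]
  congr 1
  have : Finset.filter (fun k => k < cc β L) (Finset.range N) = Finset.range (min N (cc β L)) := by
    ext k; simp
  rw [this, Finset.card_range]

lemma heav_nonneg (x : ℝ) : 0 ≤ heav x := by unfold heav; split_ifs <;> norm_num
lemma heav_le_one (x : ℝ) : heav x ≤ 1 := by unfold heav; split_ifs <;> norm_num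
lemma heav_mono {x y : ℝ} (h : x ≤ y) : heav x ≤ heav y := by
  unfold heav; split_ifs <;> first | linarith | norm_num
lemma heav_meas : Measurable heav := Measurable.ite measurableSet_Ioi measurable_const measurable_const

lemma cc_ub {β L : ℝ} (hβ : 0 ≤ β) (hL : 0 ≤ L) : β * cc β L ≤ L * heav (L - β) := by
  rcases hβ.eq_or_lt with h | h
  · rw [← h]; simp; exact mul_nonneg hL (heav_nonneg _)
  · by_cases h1 : β < L
    · have : heav (L - β) = 1 := if_pos (by linarith)
      rw [this, mul_one]
      have h2 : 0 ≤ (L / β - 1) / 2 := by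
        have : 1 ≤ L / β := by rw [one_le_div h]; linarith
        linarith
      have h3 := (Nat.ceil_lt_add_one h2).le
      calc β * cc β L ≤ β * ((L / β - 1) / 2 + 1) := by unfold cc; gcongr
        _ = (L + β) / 2 := by field_simp; ring
        _ ≤ L := by linarith
    · have : cc β L = 0 := by
        by_contra h0
        have := (lt_cc h 0).1 (Nat.pos_of_ne_zero h0)
        simp at this; linarith
      rw [this]; simp; exact mul_nonneg hL (heav_nonneg _)

lemma cc_lb {β L : ℝ} (hβ : 0 < β) (hL : 0 ≤ L) : L / 4 * heav (L / 2 - β) ≤ β * cc β L := by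
  by_cases h1 : β < L / 2
  · have : heav (L / 2 - β) = 1 := if_pos (by linarith)
    rw [this, mul_one]
    calc L / 4 ≤ β * ((L / β - 1) / 2) := by
          have : β * ((L / β - 1) / 2) = (L - β) / 2 := by field_simp
          rw [this]; linarith
      _ ≤ β * cc β L := by unfold cc; gcongr; exact Nat.le_ceil _
  · have : heav (L / 2 - β) = 0 := if_neg (by linarith)
    rw [this]; simp; positivity

lemma cc_step {β L L' : ℝ} (hβ : 0 < β) (hL : 0 ≤ L) (hLL : L ≤ L') (K : ℕ) :
    β * cc β L' ≤ β * cc β L + ((L' - L) / 2 + L' / (2 * K + 1)) * heav (L' - β) +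
      ∑ k ∈ Finset.range K, L' * (heav (L' / (2 * k + 1) - β) - heav (L / (2 * k + 1) - β)) := by
  have hs : ∀ (M : ℝ) (k : ℕ), heav (M / (2 * k + 1) - β) = heav (M - (2 * k + 1) * β) := by
    intro M k
    unfold heav
    simp only [sub_pos, lt_div_iff₀ (show (0:ℝ) < 2 * k + 1 by positivity), mul_comm β]
  rw [← Finset.mul_sum, Finset.sum_sub_distrib]
  simp only [hs, heav_sum hβ]
  have hm : cc β L ≤ cc β L' := by
    unfold cc; gcongr
  have hD : (0:ℝ) ≤ (min K (cc β L') : ℕ) - (min K (cc β L) : ℕ) := by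
    rw [sub_nonneg]; exact_mod_cast min_le_min_left K hm
  have hL' : 0 ≤ L' := hL.trans hLL
  have hc0 : 0 ≤ ((L' - L) / 2 + L' / (2 * K + 1)) := by
    have : 0 ≤ L' - L := by linarith
    positivity
  by_cases hz : β < L'
  swap
  · have : cc β L' = 0 := by
      by_contra h0
      have := (lt_cc hβ 0).1 (Nat.pos_of_ne_zero h0)
      simp at this; linarith
    have h0 := heav_nonneg (L' - β)
    rw [this, Nat.cast_zero, mul_zero]
    rw [this] at hD
    positivity
  have h1 : heav (L' - β) = 1 := if_pos (by linarith)
  rw [h1, mul_one]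
  by_cases hK : cc β L' ≤ K
  · rw [min_eq_right hK, min_eq_right (hm.trans hK)]
    have : β * ((cc β L' : ℝ) - cc β L) ≤ L' * ((cc β L' : ℝ) - cc β L) := by
      have : (0:ℝ) ≤ (cc β L' : ℝ) - cc β L := by rw [sub_nonneg]; exact_mod_cast hm
      gcongr
    linarith
  · have hK1 := (lt_cc hβ K).1 (not_le.1 hK)
    have e1 : β ≤ L' / (2 * K + 1) := by
      rw [le_div_iff₀ (by positivity)]; linarith
    have e2 : (cc β L' : ℝ) ≤ cc β L + ((L' - L) / 2 / β + 1) := by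
      have h2 : 0 ≤ (L' / β - 1) / 2 := by
        have : 1 ≤ L' / β := by rw [one_le_div hβ]; linarith
        linarith
      have h3 := (Nat.ceil_lt_add_one h2).le
      have h4 := Nat.le_ceil ((L / β - 1) / 2)
      change (⌈(L' / β - 1) / 2⌉₊ : ℝ) ≤ ⌈(L / β - 1) / 2⌉₊ + _
      have : (L' - L) / 2 / β = (L' / β - 1) / 2 - (L / β - 1) / 2 := by field_simp; ring
      linarith
    calc β * cc β L' ≤ β * (cc β L + ((L' - L) / 2 / β + 1)) := by gcongr
      _ = β * cc β L + ((L' - L) / 2 + β) := by field_simp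
      _ ≤ β * cc β L + ((L' - L) / 2 + L' / (2 * K + 1)) := by linarith
      _ ≤ _ := by have := mul_nonneg hL' hD; linarith

lemma GG_ext {β L : ℝ} (hβ : 1 ≤ β) {N : ℕ} (hN : ⌈L⌉₊ ≤ N) : 2 * π * GG β L = β * ∑ k ∈ Finset.range N, max (L - (2 * k + 1) * β) 0 := by
  unfold GG
  have : ∑ k ∈ Finset.range ⌈L⌉₊, max (L - (2 * k + 1) * β) 0 = ∑ k ∈ Finset.range N, max (L - (2 * k + 1) * β) 0 := by
    refine Finset.sum_subset (Finset.range_subset_range.2 hN) fun k _ hk => ?_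
    simp only [Finset.mem_range, not_lt] at hk
    have := (Nat.le_ceil L).trans (Nat.cast_le.2 hk)
    refine max_eq_right ?_
    nlinarith [show (0:ℝ) ≤ k by positivity]
  rw [this]; field_simp

lemma cc_le {β L : ℝ} (hβ : 1 ≤ β) : cc β L ≤ ⌈L⌉₊ := by
  by_contra h
  have := (lt_cc (by linarith) _).1 (not_le.1 h)
  have h2 := Nat.le_ceil L
  nlinarith [show (0:ℝ) ≤ (⌈L⌉₊ : ℝ) by positivity]

lemma GG_diff {β L L' : ℝ} (hβ : 1 ≤ β) (hLL : L ≤ L') :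
    (L' - L) * (β * cc β L) ≤ 2 * π * GG β L' - 2 * π * GG β L ∧ 2 * π * GG β L' - 2 * π * GG β L ≤ (L' - L) * (β * cc β L') := by
  have hβ0 : 0 < β := by linarith
  have hN : ⌈L⌉₊ ≤ ⌈L'⌉₊ := Nat.ceil_mono hLL
  rw [GG_ext hβ hN, GG_ext hβ le_rfl, ← mul_sub, ← Finset.sum_sub_distrib]
  have e1 : (L' - L) * (β * cc β L) = β * ∑ k ∈ Finset.range ⌈L'⌉₊, (L' - L) * heav (L - (2 * k + 1) * β) := by
    rw [← Finset.mul_sum, heav_sum hβ0, min_eq_right ((cc_le hβ).trans hN)]; ring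
  have e2 : (L' - L) * (β * cc β L') = β * ∑ k ∈ Finset.range ⌈L'⌉₊, (L' - L) * heav (L' - (2 * k + 1) * β) := by
    rw [← Finset.mul_sum, heav_sum hβ0, min_eq_right (cc_le hβ)]; ring
  rw [e1, e2]
  constructor <;> refine mul_le_mul_of_nonneg_left (Finset.sum_le_sum fun k _ => ?_) hβ0.le
  · unfold heav; split_ifs with h
    · rw [max_eq_left h.le, max_eq_left (by linarith)]; linarith
    · rw [max_eq_right (not_lt.1 h)]; simp
  · unfold heav; split_ifs with h
    · rw [max_eq_left h.le]; have := le_max_left (L - (2 * k + 1) * β) 0; linarith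
    · rw [max_eq_right (not_lt.1 h)]; simp

lemma GG_le {β L : ℝ} (hβ : 1 ≤ β) (hL : 0 ≤ L) : 2 * π * GG β L ≤ L * (β * cc β L) := by
  have := (GG_diff hβ hL).2
  rw [GG_zero (show (0:ℝ) ≤ β by linarith) (by linarith)] at this
  simpa using this
end SP9a

section SP9b
section Abs
variable {X : Type*} [MeasurableSpace X] {v : Measure X} {β : X → ℝ}

lemma int_heav (hm : AEMeasurable β v) (hf : ∀ μ, v {p | β p < μ} ≠ ⊤) (μ : ℝ) : Integrable (fun p => heav (μ - β p)) v := by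
  refine ⟨(heav_meas.comp_aemeasurable (aemeasurable_const.sub hm)).aestronglyMeasurable, ?_⟩
  have : ∀ p, ‖heav (μ - β p)‖ₑ = Set.indicator {p | β p < μ} (fun _ => (1 : ENNReal)) p := by
    intro p
    by_cases h : β p < μ
    · rw [Set.indicator_of_mem (by exact h)]; simp [heav, h]
    · rw [Set.indicator_of_notMem (by exact h)]; simp [heav, h]
  rw [HasFiniteIntegral]
  simp only [this]
  refine lt_of_le_of_lt (lintegral_indicator_const_le _ _) ?_
  rw [one_mul]; exact (hf μ).lt_top

lemma int_of (hm : AEMeasurable β v) (hf : ∀ μ, v {p | β p < μ} ≠ ⊤) {g : ℝ → ℝ} (hg : Measurable g) {M μ : ℝ}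
    (hb : ∀ p, |g (β p)| ≤ M * heav (μ - β p)) : Integrable (fun p => g (β p)) v :=
  Integrable.mono' ((int_heav hm hf μ).const_mul M) (hg.comp_aemeasurable hm).aestronglyMeasurable (Eventually.of_forall hb)

lemma cc_meas (L : ℝ) : Measurable (fun x : ℝ => x * (cc x L : ℝ)) := by
  unfold cc
  refine measurable_id.mul ?_
  have : Measurable (fun x : ℝ => ⌈(L / x - 1) / 2⌉₊) := Nat.measurable_ceil.comp (by fun_prop)
  exact measurable_from_top.comp this

lemma GG_meas (L : ℝ) : Measurable (fun x : ℝ => GG x L) := by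
  unfold GG; fun_prop

lemma int_cc (hm : AEMeasurable β v) (hf : ∀ μ, v {p | β p < μ} ≠ ⊤) (h0 : ∀ p, 0 ≤ β p) {L : ℝ} (hL : 0 ≤ L) : Integrable (fun p => β p * cc (β p) L) v := by
  refine int_of hm hf (cc_meas L) (M := L) (μ := L) fun p => ?_
  rw [abs_of_nonneg (mul_nonneg (h0 p) (by positivity))]
  exact cc_ub (h0 p) hL

lemma int_GG (hm : AEMeasurable β v) (hf : ∀ μ, v {p | β p < μ} ≠ ⊤) (h1 : ∀ p, 1 ≤ β p) {L : ℝ} (hL : 0 ≤ L) : Integrable (fun p => GG (β p) L) v := by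
  refine int_of hm hf (GG_meas L) (M := L * L) (μ := L) fun p => ?_
  have h0 : 0 ≤ β p := by linarith [h1 p]
  have hg := GG_nonneg (L := L) h0
  rw [abs_of_nonneg hg]
  have a := GG_le (h1 p) hL
  have b := cc_ub h0 hL
  have c : GG (β p) L ≤ 2 * π * GG (β p) L := by nlinarith [pi_gt_three]
  calc _ ≤ L * (β p * cc (β p) L) := c.trans a
    _ ≤ L * (L * heav (L - β p)) := by gcongr
    _ = _ := by ring

def om (v : Measure X) (β : X → ℝ) (μ : ℝ) : ℝ := ∫ p, heav (μ - β p) ∂v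
def PP (v : Measure X) (β : X → ℝ) (L : ℝ) : ℝ := ∫ p, β p * cc (β p) L ∂v
def RG (v : Measure X) (β : X → ℝ) (L : ℝ) : ℝ := ∫ p, GG (β p) L ∂v

variable (hm : AEMeasurable β v) (hf : ∀ μ, v {p | β p < μ} ≠ ⊤) (h1 : ∀ p, 1 ≤ β p)
include hm hf

lemma om_mono {a b : ℝ} (h : a ≤ b) : om v β a ≤ om v β b :=
  integral_mono (int_heav hm hf a) (int_heav hm hf b) fun p => heav_mono (by linarith)
omit hm hf in
lemma om_nonneg (a : ℝ) : 0 ≤ om v β a := integral_nonneg fun p => heav_nonneg _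

include h1

lemma RG_diff {L L' : ℝ} (hL : 0 ≤ L) (hLL : L ≤ L') :
    (L' - L) * PP v β L ≤ 2 * π * RG v β L' - 2 * π * RG v β L ∧ 2 * π * RG v β L' - 2 * π * RG v β L ≤ (L' - L) * PP v β L' := by
  have h0 : ∀ p, 0 ≤ β p := fun p => by linarith [h1 p]
  have hL' := hL.trans hLL
  have iL := (int_GG hm hf h1 hL).const_mul (2 * π)
  have iL' := (int_GG hm hf h1 hL').const_mul (2 * π)
  unfold RG PP
  rw [← integral_const_mul, ← integral_const_mul, ← integral_const_mul, ← integral_const_mul, ← integral_sub iL' iL]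
  exact ⟨integral_mono ((int_cc hm hf h0 hL).const_mul _) (iL'.sub iL) fun p => (GG_diff (h1 p) hLL).1,
    integral_mono (iL'.sub iL) ((int_cc hm hf h0 hL').const_mul _) fun p => (GG_diff (h1 p) hLL).2⟩

lemma RG_le {L : ℝ} (hL : 0 ≤ L) : 2 * π * RG v β L ≤ L * PP v β L := by
  have h0 : ∀ p, 0 ≤ β p := fun p => by linarith [h1 p]
  unfold RG PP
  rw [← integral_const_mul, ← integral_const_mul]
  exact integral_mono ((int_GG hm hf h1 hL).const_mul _) ((int_cc hm hf h0 hL).const_mul _) fun p => GG_le (h1 p) hL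

lemma PP_mono {L L' : ℝ} (hL : 0 ≤ L) (hLL : L ≤ L') : PP v β L ≤ PP v β L' := by
  have h0 : ∀ p, 0 ≤ β p := fun p => by linarith [h1 p]
  refine integral_mono (int_cc hm hf h0 hL) (int_cc hm hf h0 (hL.trans hLL)) fun p => ?_
  have := h0 p
  change β p * _ ≤ β p * _
  unfold cc; gcongr

lemma PP_lb {L : ℝ} (hL : 0 ≤ L) : L / 4 * om v β (L / 2) ≤ PP v β L := by
  have h0 : ∀ p, 0 ≤ β p := fun p => by linarith [h1 p]
  unfold om PP
  rw [← integral_const_mul]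
  exact integral_mono ((int_heav hm hf _).const_mul _) (int_cc hm hf h0 hL) fun p => cc_lb (by linarith [h1 p]) hL

lemma PP_step {L L' : ℝ} (hL : 0 ≤ L) (hLL : L ≤ L') (K : ℕ) :
    PP v β L' ≤ PP v β L + ((L' - L) / 2 + L' / (2 * K + 1)) * om v β L' +
      ∑ k ∈ Finset.range K, L' * (om v β (L' / (2 * k + 1)) - om v β (L / (2 * k + 1))) := by
  have h0 : ∀ p, 0 ≤ β p := fun p => by linarith [h1 p]
  have i1 := int_cc hm hf h0 hL
  have i2 : Integrable (fun p => ((L' - L) / 2 + L' / (2 * K + 1)) * heav (L' - β p)) v := (int_heav hm hf _).const_mul _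
  have i12 : Integrable (fun p => β p * cc (β p) L + ((L' - L) / 2 + L' / (2 * K + 1)) * heav (L' - β p)) v := i1.add i2
  have i3 : ∀ k ∈ Finset.range K, Integrable (fun p => L' * (heav (L' / (2 * k + 1) - β p) - heav (L / (2 * k + 1) - β p))) v :=
    fun k _ => ((int_heav hm hf _).sub (int_heav hm hf _)).const_mul _
  have i3s : Integrable (fun p => ∑ k ∈ Finset.range K, L' * (heav (L' / (2 * k + 1) - β p) - heav (L / (2 * k + 1) - β p))) v := integrable_finsetSum _ i3
  have := integral_mono (int_cc hm hf h0 (hL.trans hLL)) (i12.add i3s) fun p => cc_step (by linarith [h1 p]) hL hLL K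
  refine this.trans (le_of_eq ?_)
  have e := integral_add i12 i3s
  refine e.trans ?_
  rw [integral_add i1 i2, integral_finsetSum _ i3, integral_const_mul]
  unfold PP om
  congr 1
  refine Finset.sum_congr rfl fun k _ => ?_
  rw [integral_const_mul, integral_sub (int_heav hm hf _) (int_heav hm hf _)]

end Abs
end SP9b

section SP9c
section Abs2
variable {X : Type*} [MeasurableSpace X] {v : Measure X} {β : X → ℝ}

lemma om_dbl {C1 : ℝ} (hC : 0 < C1)
    (hω : ∀ μ, C1 < μ → ∀ τ, 0 < τ → τ < 1 → om v β ((1 + τ) * μ) - om v β μ ≤ C1 * τ * om v β μ)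
    (hm : AEMeasurable β v) (hf : ∀ μ, v {p | β p < μ} ≠ ⊤) {μ : ℝ} (hμ : C1 < μ) : om v β (2 * μ) ≤ (1 + C1) ^ 2 * om v β μ := by
  have a := hω μ hμ (1/2) (by norm_num) (by norm_num)
  have b := hω ((1 + 1/2) * μ) (by linarith) (1/2) (by norm_num) (by norm_num)
  have c := om_mono hm hf (show 2 * μ ≤ (1 + 1/2) * ((1 + 1/2) * μ) by linarith)
  have d := om_nonneg (v := v) (β := β) μ
  have e := om_nonneg (v := v) (β := β) ((1 + 1/2) * μ)
  have a' : om v β ((1 + 1/2) * μ) ≤ (1 + C1) * om v β μ := by nlinarith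
  have b' : om v β ((1 + 1/2) * ((1 + 1/2) * μ)) ≤ (1 + C1) * om v β ((1 + 1/2) * μ) := by nlinarith
  calc _ ≤ (1 + C1) * om v β ((1 + 1/2) * μ) := c.trans b'
    _ ≤ (1 + C1) * ((1 + C1) * om v β μ) := by gcongr
    _ = _ := by ring

lemma PP_lb2 {C1 : ℝ} (hC : 0 < C1)
    (hω : ∀ μ, C1 < μ → ∀ τ, 0 < τ → τ < 1 → om v β ((1 + τ) * μ) - om v β μ ≤ C1 * τ * om v β μ)
    (hm : AEMeasurable β v) (hf : ∀ μ, v {p | β p < μ} ≠ ⊤) (h1 : ∀ p, 1 ≤ β p) {L : ℝ} (hL : 2 * C1 < L) :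
    L * om v β L ≤ 4 * (1 + C1) ^ 2 * PP v β L := by
  have a := om_dbl hC hω hm hf (μ := L / 2) (by linarith)
  have b := PP_lb hm hf h1 (L := L) (by linarith)
  rw [mul_div_cancel₀ _ (by norm_num)] at a
  calc L * om v β L ≤ L * ((1 + C1) ^ 2 * om v β (L / 2)) := by
        have : 0 < L := by linarith
        gcongr
    _ = 4 * (1 + C1) ^ 2 * (L / 4 * om v β (L / 2)) := by ring
    _ ≤ _ := by gcongr

lemma PP_cont {C1 : ℝ} (hC : 0 < C1)
    (hω : ∀ μ, C1 < μ → ∀ τ, 0 < τ → τ < 1 → om v β ((1 + τ) * μ) - om v β μ ≤ C1 * τ * om v β μ)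
    (hm : AEMeasurable β v) (hf : ∀ μ, v {p | β p < μ} ≠ ⊤) (h1 : ∀ p, 1 ≤ β p) {κ : ℝ} (hκ : 0 < κ) :
    ∃ τ, 0 < τ ∧ τ < 1 ∧ ∃ L0 ≥ 1, ∀ L ≥ L0, PP v β ((1 + τ) * L) ≤ (1 + κ) * PP v β L := by
  set D := (1 + C1) ^ 2 with hD
  have hD0 : 0 < D := by positivity
  obtain ⟨K, hK⟩ := exists_nat_ge (16 * D ^ 2 / κ)
  set τ := min (1/2) (κ / (2 * (2 * D ^ 2 + 8 * D * K * C1))) with hτ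
  have hτ0 : 0 < τ := by positivity
  have hτ1 : τ ≤ 1/2 := min_le_left _ _
  have hτ2 : τ * (2 * D ^ 2 + 8 * D * K * C1) ≤ κ / 2 := by
    have : τ ≤ κ / (2 * (2 * D ^ 2 + 8 * D * K * C1)) := min_le_right _ _
    rw [le_div_iff₀ (by positivity)] at this; linarith
  have hKκ : 8 * D ^ 2 / (2 * K + 1) ≤ κ / 2 := by
    rw [div_le_iff₀ hκ] at hK
    rw [div_le_iff₀ (by positivity)]
    nlinarith
  refine ⟨τ, hτ0, by linarith, max 1 ((2 * K + 2) * C1 + 1), le_max_left _ _, fun L hL => ?_⟩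
  have hL1 : 1 ≤ L := (le_max_left _ _).trans hL
  have hL2 : (2 * K + 2) * C1 < L := by linarith [(le_max_right _ _).trans hL]
  have hK0 : (0:ℝ) ≤ K := by positivity
  have hLC : C1 < L := by nlinarith
  have hLC2 : 2 * C1 < L := by nlinarith
  have st := PP_step hm hf h1 (L := L) (L' := (1 + τ) * L) (by linarith) (by nlinarith) K
  set W := om v β L with hW
  have hW0 : 0 ≤ W := om_nonneg _
  have hlb : L * W ≤ 4 * D * PP v β L := PP_lb2 hC hω hm hf h1 hLC2
  have hW' : om v β ((1 + τ) * L) ≤ D * W :=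
    (om_mono hm hf (by nlinarith)).trans (om_dbl hC hω hm hf hLC)
  have t1 : (((1 + τ) * L - L) / 2 + (1 + τ) * L / (2 * K + 1)) * om v β ((1 + τ) * L) ≤ (τ / 2 + 2 / (2 * K + 1)) * L * (D * W) := by
    have e : ((1 + τ) * L - L) / 2 + (1 + τ) * L / (2 * K + 1) ≤ (τ / 2 + 2 / (2 * K + 1)) * L := by
      have : (1 + τ) * L / (2 * K + 1) ≤ 2 * L / (2 * K + 1) := by gcongr; linarith
      calc _ ≤ τ * L / 2 + 2 * L / (2 * K + 1) := by linarith
        _ = _ := by ring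
    exact mul_le_mul e hW' (om_nonneg _) (by positivity)
  have t2 : ∑ k ∈ Finset.range K, (1 + τ) * L * (om v β ((1 + τ) * L / (2 * k + 1)) - om v β (L / (2 * k + 1))) ≤ K * (2 * L * (C1 * τ * W)) := by
    have : ∀ k ∈ Finset.range K, (1 + τ) * L * (om v β ((1 + τ) * L / (2 * k + 1)) - om v β (L / (2 * k + 1))) ≤ 2 * L * (C1 * τ * W) := by
      intro k hk
      have hk' : (k : ℝ) ≤ K := by exact_mod_cast (Finset.mem_range.1 hk).le
      have hk0 : (0:ℝ) ≤ k := by positivity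
      have a := hω (L / (2 * k + 1)) (by rw [lt_div_iff₀ (by positivity)]; nlinarith) τ hτ0 (by linarith)
      rw [← mul_div_assoc] at a
      have b : om v β (L / (2 * k + 1)) ≤ W := om_mono hm hf (div_le_self (by linarith) (by linarith))
      have c : om v β ((1 + τ) * L / (2 * k + 1)) - om v β (L / (2 * k + 1)) ≤ C1 * τ * W := a.trans (by gcongr)
      calc _ ≤ (1 + τ) * L * (C1 * τ * W) := by gcongr
        _ ≤ _ := by gcongr; linarith
    refine (Finset.sum_le_card_nsmul _ _ _ this).trans (le_of_eq ?_)
    simp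
  calc _ ≤ PP v β L + (τ / 2 + 2 / (2 * K + 1)) * L * (D * W) + K * (2 * L * (C1 * τ * W)) := st.trans (by linarith)
    _ = PP v β L + ((τ / 2 + 2 / (2 * K + 1)) * D + 2 * K * C1 * τ) * (L * W) := by ring
    _ ≤ PP v β L + ((τ / 2 + 2 / (2 * K + 1)) * D + 2 * K * C1 * τ) * (4 * D * PP v β L) := by gcongr
    _ = PP v β L + (τ * (2 * D ^ 2 + 8 * D * K * C1) + 8 * D ^ 2 / (2 * K + 1)) * PP v β L := by ring
    _ ≤ PP v β L + (κ / 2 + κ / 2) * PP v β L := by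
        have : 0 ≤ PP v β L := by
          have h4 : 0 ≤ L * W := by positivity
          by_contra h; nlinarith
        gcongr
    _ = _ := by ring

lemma num9 {σ η τ κ : ℝ} (hσ0 : 0 < σ) (hσκ : σ ≤ κ / 2) (hστ : σ ≤ τ / 40) (hτ1 : τ < 1) (hκ1 : κ < 1) (hη0 : 0 < η) (hη : η = σ ^ 2 / 200) :
    η ≤ σ / 8000 ∧ (1 + 20 * η) * (1 - σ) ≤ 1 ∧ 1 ≤ (1 + τ) * (1 - σ) ∧ σ * (1 - κ) ≤ (1 - 8 * η) * (σ - 32 * η) - 16 * η ∧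
    (1 + 20 * η) * (1 + σ) ≤ 1 + τ ∧ (1 + 8 * η) * (σ + 52 * η) + 16 * η ≤ σ * (1 + κ) := by
  have h : η ≤ σ / 8000 := by nlinarith
  have hs : σ ≤ 1/40 := by linarith
  have h2 : σ ^ 2 ≤ σ * κ / 2 := by nlinarith
  have h3 := mul_pos hη0 hσ0
  have h4 := mul_pos hη0 hη0
  have h5 : η * σ ≤ η / 40 := by nlinarith
  have h6 : η * η ≤ η / 40 := by nlinarith
  refine ⟨h, by nlinarith, by nlinarith, ?_, by nlinarith, ?_⟩
  · have : 200 * η ≤ σ * κ / 2 := by rw [hη]; linarith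
    linarith
  · have : 200 * η ≤ σ * κ / 2 := by rw [hη]; linarith
    linarith

set_option maxHeartbeats 800000 in
lemma N_asym {N : ℝ → ℝ} {C1 : ℝ} (hC : 0 < C1)
    (hω : ∀ μ, C1 < μ → ∀ τ, 0 < τ → τ < 1 → om v β ((1 + τ) * μ) - om v β μ ≤ C1 * τ * om v β μ)
    (hm : AEMeasurable β v) (hf : ∀ μ, v {p | β p < μ} ≠ ⊤) (h1 : ∀ p, 1 ≤ β p)
    (hN : ∀ η, 0 < η → η ≤ 1/20 → ∃ L0 ≥ 1, ∀ l ≥ L0, ∀ h > 0,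
      h * N l ≤ (1 + 8 * η) * RG v β ((1 + 20 * η) * (l + h)) - RG v β ((1 - 12 * η) * l) / (1 + 8 * η) ∧
      (L0 ≤ l - h → RG v β ((1 - 12 * η) * l) / (1 + 8 * η) - (1 + 8 * η) * RG v β ((1 + 20 * η) * (l - h)) ≤ h * N l))
    {κ : ℝ} (hκ : 0 < κ) (hκ1 : κ < 1) : ∀ᶠ l in atTop, (1 - κ) * PP v β l ≤ (1 + κ) * (2 * π * N l) ∧ 2 * π * N l ≤ (1 + κ) ^ 2 * PP v β l := by
  obtain ⟨τ, hτ0, hτ1, La, hLa, hP⟩ := PP_cont hC hω hm hf h1 hκ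
  obtain ⟨σ, hσ0, hσκ, hστ⟩ : ∃ σ, 0 < σ ∧ σ ≤ κ / 2 ∧ σ ≤ τ / 40 := ⟨min (κ / 2) (τ / 40), by positivity, min_le_left _ _, min_le_right _ _⟩
  obtain ⟨η, hη0, hη⟩ : ∃ η, 0 < η ∧ η = σ ^ 2 / 200 := ⟨_, by positivity, rfl⟩
  obtain ⟨hησ, n1, n2, n3, n4, n5⟩ := num9 hσ0 hσκ hστ hτ1 hκ1 hη0 hη
  clear hη
  obtain ⟨Lb, hLb, hB⟩ := hN η hη0 (by linarith)
  filter_upwards [eventually_ge_atTop (2 * La), eventually_ge_atTop (2 * Lb)] with l hl1 hl2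
  have hl : 1 ≤ l := by linarith
  have hl0 : 0 < l := by linarith
  obtain ⟨up, lo⟩ := hB l (by linarith) (σ * l) (by positivity)
  replace lo := lo (by
    have : σ * l ≤ 1 / 2 * l := by gcongr; linarith
    linarith)
  have hσl : σ * l ≤ 1 / 2 * l := by gcongr; linarith
  have q1 := mul_pos hη0 (mul_pos hσ0 hl0)
  have q2 := mul_pos hη0 hl0
  have q3 : η * (σ * l) ≤ 1 / 2 * (η * l) := by
    calc η * (σ * l) ≤ η * (1 / 2 * l) := by gcongr
      _ = _ := by ring
  have hR0 : ∀ L, 0 ≤ RG v β L := fun L => integral_nonneg fun p => GG_nonneg (by linarith [h1 p])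
  have hP0 : ∀ L, 0 ≤ PP v β L := fun L => integral_nonneg fun p => mul_nonneg (by linarith [h1 p]) (by positivity)
  have i1 : 1 - 8 * η ≤ 1 / (1 + 8 * η) := by
    rw [le_div_iff₀ (by positivity)]
    have := mul_pos hη0 hη0
    linarith
  constructor
  · set A := (1 - 12 * η) * l with hA
    set B := (1 + 20 * η) * (l - σ * l) with hB'
    have hB0 : 0 ≤ B := by have : 0 ≤ l - σ * l := by linarith
                           positivity
    have hBl : B ≤ l := by
      calc B = (1 + 20 * η) * (1 - σ) * l := by rw [hB']; ring
        _ ≤ 1 * l := by gcongr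
        _ = l := one_mul l
    have hAB : (σ - 32 * η) * l ≤ A - B := by rw [hA, hB']; linarith
    have hAB0 : 0 ≤ A - B := le_trans (mul_nonneg (by linarith) hl0.le) hAB
    have d1 := (RG_diff hm hf h1 hB0 (show B ≤ A by linarith)).1
    have d2 := RG_le hm hf h1 hB0
    have hPB : PP v β l ≤ (1 + κ) * PP v β B := by
      have hBs : (1 - σ) * l ≤ B := by rw [hB']; linarith
      have hBL : La ≤ B := by linarith
      refine (PP_mono hm hf h1 hl0.le ?_).trans (hP B hBL)
      calc l ≤ (1 + τ) * ((1 - σ) * l) := by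
            have := mul_le_mul_of_nonneg_right n2 hl0.le
            linarith
        _ ≤ _ := by gcongr
    have e1 : (1 - 8 * η) * RG v β A - (1 + 8 * η) * RG v β B ≤ σ * l * N l := by
      refine le_trans ?_ lo
      have := mul_le_mul_of_nonneg_right i1 (hR0 A)
      rw [div_mul_eq_mul_div, one_mul] at this
      linarith
    have e2 : (1 - 8 * η) * ((σ - 32 * η) * l * PP v β B) - 16 * η * (l * PP v β B) ≤ σ * l * (2 * π * N l) := by
      have p1 : (σ - 32 * η) * l * PP v β B ≤ 2 * π * RG v β A - 2 * π * RG v β B := le_trans (mul_le_mul_of_nonneg_right hAB (hP0 B)) d1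
      have p2 : 2 * π * RG v β B ≤ l * PP v β B := d2.trans (mul_le_mul_of_nonneg_right hBl (hP0 B))
      have p3 := mul_le_mul_of_nonneg_left p1 (show 0 ≤ 1 - 8 * η by linarith)
      have p4 := mul_le_mul_of_nonneg_left p2 (show 0 ≤ 16 * η by linarith)
      have p5 := mul_le_mul_of_nonneg_left e1 (show 0 ≤ 2 * π by positivity)
      linarith
    have e3 : σ * l * ((1 - κ) * PP v β B) ≤ σ * l * (2 * π * N l) := by
      refine le_trans ?_ e2
      calc _ = σ * (1 - κ) * (l * PP v β B) := by ring
        _ ≤ ((1 - 8 * η) * (σ - 32 * η) - 16 * η) * (l * PP v β B) := mul_le_mul_of_nonneg_right n3 (mul_nonneg hl0.le (hP0 B))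
        _ = _ := by ring
    have e4 := le_of_mul_le_mul_left e3 (by positivity)
    calc _ ≤ (1 - κ) * ((1 + κ) * PP v β B) := mul_le_mul_of_nonneg_left hPB (by linarith)
      _ = (1 + κ) * ((1 - κ) * PP v β B) := by ring
      _ ≤ _ := by gcongr
  · set A := (1 + 20 * η) * (l + σ * l) with hA
    set B := (1 - 12 * η) * l with hB'
    have hB0 : 0 ≤ B := mul_nonneg (by linarith) hl0.le
    have hBl : B ≤ l := by rw [hB']; linarith
    have hAB : A - B ≤ (σ + 52 * η) * l := by rw [hA, hB']; linarith
    have hAl : l ≤ A := by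
      have := mul_pos hσ0 hl0
      rw [hA]; linarith
    have d1 := (RG_diff hm hf h1 hB0 (show B ≤ A by linarith)).2
    have d2 := RG_le hm hf h1 hB0
    have hPA : PP v β A ≤ (1 + κ) * PP v β l := by
      refine (PP_mono hm hf h1 (by linarith) ?_).trans (hP l (by linarith))
      rw [hA]
      calc _ = ((1 + 20 * η) * (1 + σ)) * l := by ring
        _ ≤ (1 + τ) * l := by gcongr
    have hPBA : PP v β B ≤ PP v β A := PP_mono hm hf h1 hB0 (by linarith)
    have e1 : σ * l * N l ≤ (1 + 8 * η) * RG v β A - (1 - 8 * η) * RG v β B := by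
      refine up.trans ?_
      have := mul_le_mul_of_nonneg_right i1 (hR0 B)
      rw [div_mul_eq_mul_div, one_mul] at this
      linarith
    have e2 : σ * l * (2 * π * N l) ≤ (1 + 8 * η) * ((σ + 52 * η) * l * PP v β A) + 16 * η * (l * PP v β A) := by
      have p1 : 2 * π * RG v β A - 2 * π * RG v β B ≤ (σ + 52 * η) * l * PP v β A := le_trans d1 (mul_le_mul_of_nonneg_right hAB (hP0 A))
      have p2 : 2 * π * RG v β B ≤ l * PP v β A := d2.trans (mul_le_mul hBl hPBA (hP0 B) hl0.le)
      have p3 := mul_le_mul_of_nonneg_left p1 (show 0 ≤ 1 + 8 * η by linarith)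
      have p4 := mul_le_mul_of_nonneg_left p2 (show 0 ≤ 16 * η by linarith)
      have p5 := mul_le_mul_of_nonneg_left e1 (show 0 ≤ 2 * π by positivity)
      linarith
    have e3 : σ * l * (2 * π * N l) ≤ σ * l * ((1 + κ) * PP v β A) := by
      refine e2.trans ?_
      calc _ = ((1 + 8 * η) * (σ + 52 * η) + 16 * η) * (l * PP v β A) := by ring
        _ ≤ (σ * (1 + κ)) * (l * PP v β A) := mul_le_mul_of_nonneg_right n5 (mul_nonneg hl0.le (hP0 A))
        _ = _ := by ring
    have e4 := le_of_mul_le_mul_left e3 (by positivity)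
    calc _ ≤ (1 + κ) * ((1 + κ) * PP v β l) := e4.trans (mul_le_mul_of_nonneg_left hPA (by linarith))
      _ = _ := by ring
end Abs2
end SP9c

section Abs3
variable {X : Type*} [MeasurableSpace X] {v : Measure X} {b β : X → ℝ}

lemma L_cmp (hm : AEMeasurable b v) (hf : ∀ μ, v {p | b p < μ} ≠ ⊤) (hmβ : AEMeasurable β v) (hfβ : ∀ μ, v {p | β p < μ} ≠ ⊤) (h0 : ∀ p, 0 ≤ b p)
    (hβ : ∀ p, β p = max (b p) 1) {L : ℝ} (hL : 0 ≤ L) :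
    |∫ p, b p * ∑' k : ℕ, heav (L - (2 * (k : ℝ) + 1) * b p) ∂v - PP v β L| ≤ L * om v β 2 := by
  have e : ∀ p, b p * ∑' k : ℕ, heav (L - (2 * (k : ℝ) + 1) * b p) = b p * cc (b p) L := by
    intro p
    rcases (h0 p).eq_or_lt with h | h
    · rw [← h]; simp
    · rw [heav_tsum h]
  simp only [e]
  have i1 := int_cc hm hf h0 hL
  have hβ0 : ∀ p, 0 ≤ β p := fun p => by rw [hβ]; positivity
  have i2 := int_cc hmβ hfβ hβ0 hL
  unfold PP om
  rw [← integral_sub i1 i2, ← integral_const_mul]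
  refine (abs_integral_le_integral_abs).trans (integral_mono (i1.sub i2).abs ((int_heav hmβ hfβ 2).const_mul L) fun p => ?_)
  change |b p * cc (b p) L - β p * cc (β p) L| ≤ L * heav (2 - β p)
  by_cases h : 1 ≤ b p
  · have : β p = b p := by rw [hβ]; exact max_eq_left h
    rw [this]; simp; exact mul_nonneg hL (heav_nonneg _)
  · have : β p = 1 := by rw [hβ]; exact max_eq_right (not_le.1 h).le
    have h2 : heav (2 - β p) = 1 := if_pos (by rw [this]; norm_num)
    rw [h2, mul_one]
    have a := (cc_ub (h0 p) hL).trans (mul_le_of_le_one_right hL (heav_le_one _))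
    have a' := (cc_ub (hβ0 p) hL).trans (mul_le_of_le_one_right hL (heav_le_one _))
    have c : 0 ≤ b p * cc (b p) L := mul_nonneg (h0 p) (by positivity)
    have c' : 0 ≤ β p * cc (β p) L := mul_nonneg (hβ0 p) (by positivity)
    rw [abs_le]; constructor <;> linarith

lemma L_asym {C1 : ℝ} (hC : 0 < C1)
    (hω : ∀ μ, C1 < μ → ∀ τ, 0 < τ → τ < 1 → om v β ((1 + τ) * μ) - om v β μ ≤ C1 * τ * om v β μ)
    (hm : AEMeasurable b v) (hf : ∀ μ, v {p | b p < μ} ≠ ⊤) (hmβ : AEMeasurable β v) (hfβ : ∀ μ, v {p | β p < μ} ≠ ⊤) (h0 : ∀ p, 0 ≤ b p)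
    (hβ : ∀ p, β p = max (b p) 1) (hinf : Tendsto (om v β) atTop atTop) {κ : ℝ} (hκ : 0 < κ) :
    ∀ᶠ l in atTop, 0 < PP v β l ∧ |∫ p, b p * ∑' k : ℕ, heav (l - 1/4 - (2 * (k : ℝ) + 1) * b p) ∂v - PP v β l| ≤ 2 * κ * PP v β l := by
  have h1 : ∀ p, 1 ≤ β p := fun p => by rw [hβ]; exact le_max_right _ _
  obtain ⟨τ, hτ0, hτ1, La, hLa, hP⟩ := PP_cont hC hω hmβ hfβ h1 hκ
  filter_upwards [hinf.eventually_ge_atTop (4 * (1 + C1) ^ 2 * om v β 2 / κ), hinf.eventually_ge_atTop 1, eventually_gt_atTop (2 * C1),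
    eventually_ge_atTop (La + 1 + 1 / τ)] with l w1 w2 w3 w4
  have hτi : 0 < 1 / τ := by positivity
  have hl : 1 < l := by linarith
  have lb := PP_lb2 hC hω hmβ hfβ h1 w3
  have hP0 : 0 < PP v β l := by
    have : 0 < l * om v β l := mul_pos (by linarith) (by linarith)
    have h4 : 0 < 4 * (1 + C1) ^ 2 * PP v β l := by linarith
    exact pos_of_mul_pos_right h4 (by positivity)
  refine ⟨hP0, ?_⟩
  have a := L_cmp hm hf hmβ hfβ h0 hβ (L := l - 1/4) (by linarith)
  have a2 : (l - 1/4) * om v β 2 ≤ κ * PP v β l := by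
    rw [div_le_iff₀ hκ] at w1
    have o2 := om_nonneg (v := v) (β := β) 2
    have : 4 * (1 + C1) ^ 2 * ((l - 1/4) * om v β 2) ≤ 4 * (1 + C1) ^ 2 * (κ * PP v β l) := by
      calc _ ≤ l * (4 * (1 + C1) ^ 2 * om v β 2) := by nlinarith [mul_nonneg (sq_nonneg (1 + C1)) o2]
        _ ≤ l * (om v β l * κ) := by gcongr
        _ = κ * (l * om v β l) := by ring
        _ ≤ κ * (4 * (1 + C1) ^ 2 * PP v β l) := by gcongr
        _ = _ := by ring
    exact le_of_mul_le_mul_left this (by positivity)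
  have m1 := PP_mono hmβ hfβ h1 (L := l - 1/4) (L' := l) (by linarith) (by linarith)
  have m2 : PP v β l ≤ (1 + κ) * PP v β (l - 1/4) := by
    refine (PP_mono hmβ hfβ h1 (by linarith) ?_).trans (hP (l - 1/4) (by linarith))
    have : 1 ≤ τ * (l - 1/4) := by
      have : 1 / τ ≤ l - 1/4 := by linarith
      rw [div_le_iff₀ hτ0] at this; linarith
    linarith
  have m3 : PP v β l - PP v β (l - 1/4) ≤ κ * PP v β l := by
    have := mul_le_mul_of_nonneg_left m1 hκ.le
    linarith
  rw [abs_le] at a ⊢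
  constructor <;> linarith [a.1, a.2]

lemma fin_abs {N : ℝ → ℝ} {C1 : ℝ} (hC : 0 < C1)
    (hω : ∀ μ, C1 < μ → ∀ τ, 0 < τ → τ < 1 → om v β ((1 + τ) * μ) - om v β μ ≤ C1 * τ * om v β μ)
    (hm : AEMeasurable b v) (hf : ∀ μ, v {p | b p < μ} ≠ ⊤) (hmβ : AEMeasurable β v) (hfβ : ∀ μ, v {p | β p < μ} ≠ ⊤) (h0 : ∀ p, 0 ≤ b p)
    (hβ : ∀ p, β p = max (b p) 1) (hinf : Tendsto (om v β) atTop atTop)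
    (hN : ∀ η, 0 < η → η ≤ 1/20 → ∃ L0 ≥ 1, ∀ l ≥ L0, ∀ h > 0,
      h * N l ≤ (1 + 8 * η) * RG v β ((1 + 20 * η) * (l + h)) - RG v β ((1 - 12 * η) * l) / (1 + 8 * η) ∧
      (L0 ≤ l - h → RG v β ((1 - 12 * η) * l) / (1 + 8 * η) - (1 + 8 * η) * RG v β ((1 + 20 * η) * (l - h)) ≤ h * N l)) :
    Tendsto (fun l : ℝ => N l / ((1 / (2 * π)) * ∫ p, b p * ∑' k : ℕ, heav (l - 1/4 - (2 * (k : ℝ) + 1) * b p) ∂v)) atTop (nhds 1) := by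
  have h1 : ∀ p, 1 ≤ β p := fun p => by rw [hβ]; exact le_max_right _ _
  set Lf : ℝ → ℝ := fun l => ∫ p, b p * ∑' k : ℕ, heav (l - 1/4 - (2 * (k : ℝ) + 1) * b p) ∂v with hLf
  have t1 : Tendsto (fun l => Lf l / PP v β l) atTop (nhds 1) := by
    rw [Metric.tendsto_nhds]
    intro ε hε
    filter_upwards [L_asym hC hω hm hf hmβ hfβ h0 hβ hinf (κ := ε / 4) (by positivity)] with l hl
    obtain ⟨p0, hl⟩ := hl
    rw [Real.dist_eq, div_sub_one p0.ne', abs_div, abs_of_pos p0, div_lt_iff₀ p0]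
    refine lt_of_le_of_lt hl ?_
    nlinarith
  have t2 : Tendsto (fun l => 2 * π * N l / PP v β l) atTop (nhds 1) := by
    rw [Metric.tendsto_nhds]
    intro ε hε
    obtain ⟨κ, k0, k1, k2⟩ : ∃ κ : ℝ, 0 < κ ∧ κ < 1 ∧ 4 * κ ≤ ε := ⟨min (1/2) (ε / 4), by positivity, by
      have := min_le_left (1/2) (ε / 4); linarith, by have := min_le_right (1/2) (ε / 4); linarith⟩
    filter_upwards [L_asym hC hω hm hf hmβ hfβ h0 hβ hinf (κ := 1) (by positivity), N_asym hC hω hmβ hfβ h1 hN k0 k1] with l hl hl2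
    obtain ⟨p0, -⟩ := hl
    obtain ⟨n1, n2⟩ := hl2
    rw [Real.dist_eq, div_sub_one p0.ne', abs_div, abs_of_pos p0, div_lt_iff₀ p0, abs_lt]
    have e1 : 4 * κ * PP v β l ≤ ε * PP v β l := by gcongr
    have e2 : κ ^ 2 * PP v β l < κ * PP v β l := by
      have : κ ^ 2 < κ := by nlinarith
      gcongr
    have e3 : 0 < κ * PP v β l := by positivity
    constructor
    · set x := 2 * π * N l
      set P := PP v β l
      by_contra hc
      have hc' : x ≤ (1 - 4 * κ) * P := by linarith
      have : (1 + κ) * x ≤ (1 + κ) * ((1 - 4 * κ) * P) := by gcongr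
      have h5 : 0 ≤ κ ^ 2 * P := by positivity
      linarith
    · linarith
  have t3 := t2.div t1 one_ne_zero
  rw [div_one] at t3
  refine t3.congr' ?_
  filter_upwards [L_asym hC hω hm hf hmβ hfβ h0 hβ hinf (κ := 1) (by positivity)] with l hl
  change 2 * π * N l / PP v β l / (Lf l / PP v β l) = N l / ((1 / (2 * π)) * Lf l)
  rw [div_div_div_cancel_right₀ hl.1.ne']
  have := pi_pos.ne'
  by_cases hz : Lf l = 0
  · rw [hz]; simp
  · field_simp
end Abs3

lemma volH_ac : volH ≪ volume.restrict UHP := withDensity_absolutelyContinuous _ _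

lemma UHP_meas : MeasurableSet UHP := measurableSet_lt measurable_const measurable_snd

lemma volH_cpt {K : Set (R2)} (hK : IsCompact K) (hU : K ⊆ UHP) : volH K = ∫⁻ p in K, ENNReal.ofReal ((p.2 ^ 2)⁻¹) ∧ volH K < ⊤ := by
  have e : volH K = ∫⁻ p in K, ENNReal.ofReal ((p.2 ^ 2)⁻¹) := by
    unfold volH
    rw [withDensity_apply _ hK.measurableSet, Measure.restrict_restrict hK.measurableSet, Set.inter_eq_left.2 hU]
  refine ⟨e, ?_⟩
  rw [e]
  have : IntegrableOn (fun p : R2 => (p.2 ^ 2)⁻¹) K := by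
    refine ContinuousOn.integrableOn_compact hK ?_
    refine ContinuousOn.inv₀ (by fun_prop) fun p hp => ?_
    have : 0 < p.2 := hU hp
    positivity
  exact this.lintegral_lt_top

lemma volH_UHP : ∀ᵐ p ∂volH, p ∈ UHP := volH_ac.ae_le (ae_restrict_mem UHP_meas)

lemma vfin {A1 A2 : R2 → ℝ} (h1 : ContDiffOn ℝ 2 A1 UHP) (h2 : ContDiffOn ℝ 2 A2 UHP) (hH1 : H1 A1 A2) (μ : ℝ) :
    volH {p | intenB A1 A2 p < μ} ≠ ⊤ := by
  have hK := beta_cpt h1 h2 hH1 (max μ 1)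
  refine ne_of_lt (lt_of_le_of_lt ?_ (volH_cpt hK fun p hp => hp.1).2)
  refine measure_mono_ae ?_
  filter_upwards [volH_UHP] with p hp hb
  exact ⟨hp, max_le_max (le_of_lt hb) le_rfl⟩

lemma vinf {A1 A2 : R2 → ℝ} (h1 : ContDiffOn ℝ 2 A1 UHP) (h2 : ContDiffOn ℝ 2 A2 UHP)
    (hm : AEMeasurable (beta A1 A2) volH) (hf : ∀ μ, volH {p | beta A1 A2 p < μ} ≠ ⊤) : Tendsto (om volH (beta A1 A2)) atTop atTop := by
  rw [tendsto_atTop]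
  intro M
  set n := max M 0 * 4 with hn
  have hn0 : 0 ≤ n := by positivity
  set K : Set (R2) := Set.Icc 0 n ×ˢ Set.Icc 1 2 with hKd
  have hK : IsCompact K := isCompact_Icc.prod isCompact_Icc
  have hU : K ⊆ UHP := fun p hp => lt_of_lt_of_le one_pos hp.2.1
  obtain ⟨e, fin⟩ := volH_cpt hK hU
  have lb : ENNReal.ofReal (max M 0) ≤ volH K := by
    have hv : volume K = ENNReal.ofReal n := by
      rw [hKd, Measure.volume_eq_prod, Measure.prod_prod, Real.volume_Icc, Real.volume_Icc]; norm_num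
    calc ENNReal.ofReal (max M 0) = ENNReal.ofReal (1/4) * volume K := by
          rw [hv, ← ENNReal.ofReal_mul (by norm_num), hn]; congr 1; ring
      _ = ∫⁻ p in K, ENNReal.ofReal (1/4) := by rw [setLIntegral_const]
      _ ≤ _ := by
        rw [e]
        refine setLIntegral_mono' hK.measurableSet fun p hp => ENNReal.ofReal_le_ofReal ?_
        have a1 := hp.2.1
        have a2 := hp.2.2
        rw [one_div]
        exact inv_anti₀ (by positivity) (by nlinarith)
  have lb2 : M ≤ volH.real K := (le_max_left _ _).trans ((ENNReal.ofReal_le_iff_le_toReal fin.ne).1 lb)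
  obtain ⟨B, hB⟩ := hK.bddAbove_image ((beta_cont h1 h2).mono hU)
  filter_upwards [eventually_gt_atTop B] with μ hμ
  refine lb2.trans ?_
  rw [← integral_indicator_one hK.measurableSet]
  refine integral_mono ((integrable_indicator_iff hK.measurableSet).2 (integrableOn_const fin.ne)) (int_heav hm hf μ) fun p => ?_
  by_cases hp : p ∈ K
  · rw [Set.indicator_of_mem hp]
    have : beta A1 A2 p ≤ B := hB ⟨p, hp, rfl⟩
    have h3 : heav (μ - beta A1 A2 p) = 1 := if_pos (by linarith)
    rw [h3]; rfl
  · rw [Set.indicator_of_notMem hp]; exact heav_nonneg _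

lemma RG_eq (A1 A2 : R2 → ℝ) (L : ℝ) : RG volH (beta A1 A2) L = RR A1 A2 L := by
  unfold RG RR
  have : ∫ p, GG (beta A1 A2 p) L ∂volH = ∫ p, Set.indicator UHP (fun p => GG (beta A1 A2 p) L) p ∂volH := by
    refine integral_congr_ae ?_
    filter_upwards [volH_UHP] with p hp
    rw [Set.indicator_of_mem hp]
  rw [this, volH_int _ (fun p hp => Set.indicator_of_notMem hp _)]
  congr 1; ext p
  unfold Gam
  by_cases hp : p ∈ UHP
  · rw [Set.indicator_of_mem hp, if_pos (show 0 < p.2 from hp), smul_eq_mul, div_eq_inv_mul]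
  · rw [Set.indicator_of_notMem hp, if_neg (show ¬ 0 < p.2 from hp), smul_zero]

/-- Weyl-type asymptotics for the counting function of the magnetic
bottle, under the regularity assumption on `ω`. -/
theorem counting_asymptotics
    (A₁ A₂ : ℝ × ℝ → ℝ) (hA₁ : ContDiffOn ℝ 2 A₁ UHP) (hA₂ : ContDiffOn ℝ 2 A₂ UHP)
    (h1 : H1 A₁ A₂) (h2 : ∃ C₀ > 0, H2 C₀ A₁ A₂)
    (hω : ∃ C₁ > 0, ∀ μ : ℝ, C₁ < μ → ∀ τ : ℝ, 0 < τ → τ < 1 →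
      omegaFn A₁ A₂ ((1 + τ) * μ) - omegaFn A₁ A₂ μ ≤ C₁ * τ * omegaFn A₁ A₂ μ) :
    Tendsto (fun lam : ℝ => (NH A₁ A₂ lam : ℝ) /
        ((1 / (2 * π)) * ∫ p, intenB A₁ A₂ p *
          ∑' k : ℕ, heav (lam - 1/4 - (2 * (k : ℝ) + 1) * intenB A₁ A₂ p) ∂volH))
      atTop (nhds 1) := by
  obtain ⟨C₀, hC, hH⟩ := h2
  obtain ⟨C₁, hC1, hω⟩ := hω
  have hm : AEMeasurable (intenB A₁ A₂) volH := by
    have hc : ContinuousOn (intenB A₁ A₂) UHP := (fieldB_cd hA₁ hA₂).continuousOn.abs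
    exact (hc.aemeasurable UHP_meas).mono_ac volH_ac
  have hmβ : AEMeasurable (beta A₁ A₂) volH := ((beta_cont hA₁ hA₂).aemeasurable UHP_meas).mono_ac volH_ac
  have hf := vfin hA₁ hA₂ h1
  have hfβ : ∀ μ, volH {p | beta A₁ A₂ p < μ} ≠ ⊤ := fun μ => ne_top_of_le_ne_top (hf μ) (measure_mono fun p hp => (show intenB A₁ A₂ p < μ from lt_of_le_of_lt (le_max_left (intenB A₁ A₂ p) 1) hp))
  have hom : ∀ μ, 1 < μ → om volH (beta A₁ A₂) μ = omegaFn A₁ A₂ μ := by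
    intro μ hμ
    unfold om omegaFn
    congr 1; ext p
    unfold heav beta
    simp only [sub_pos, max_lt_iff, hμ, and_true]
  refine fin_abs (N := fun l => (NH A₁ A₂ l : ℝ)) (C1 := C₁ + 1) (by linarith) (fun μ hμ τ t0 t1 => ?_) hm hf hmβ hfβ (fun p => abs_nonneg _) (fun p => rfl)
    (vinf hA₁ hA₂ hmβ hfβ) (fun η e0 e1 => ?_)
  · rw [hom μ (by linarith), hom ((1 + τ) * μ) (by nlinarith)]
    refine (hω μ (by linarith) τ t0 t1).trans ?_
    have : 0 ≤ omegaFn A₁ A₂ μ := integral_nonneg fun p => heav_nonneg _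
    gcongr; linarith
  · simp only [RG_eq]
    exact NH_bounds hA₁ hA₂ h1 hC hH e0 e1
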